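/- Let ψ : [0,∞)×ℝ³ → ℂ be a smooth solution, Schwartz in x locally uniformly in t, of the Schrödinger–Poisson system i ∂_t ψ = −(1/2)Δψ + Vψ, with V(t,x) = (1/4π) ∫_{ℝ³} |x−y|^{−1} |ψ(t,y)|² dy, and set n(t,x) = |ψ(t,x)|². Let R solve R̈ = R^{−2}, R(0) = 1, Ṙ(0) = 0. Then the function L(t) = R(t) ∫_{ℝ³} |∇ψ(t,x) − i (Ṙ(t)/R(t)) x ψ(t,x)|² dx + R(t) ∫_{ℝ³} V(t,x) |ψ(t,x)|² dx + R(t)^{−2} ∫_{ℝ³} |x|² |ψ(t,x)|² dx is nonincreasing on [0,∞), and there exists a constant C > 0 such that for every p ∈ [2,6] and every t > 0, ‖n(t,·)‖_{L^p(ℝ³)} ≤ C · Ṙ(t)^{3(2/p − 1)} · R(t)^{(3/2)(1/p − 1/2)}. -/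

import Mathlib

open MeasureTheory Set Real
open scoped ENNReal Topology BigOperators

noncomputable section

namespace SchrodingerPoisson

/-- Three-dimensional Euclidean space. -/
abbrev E3 := EuclideanSpace ℝ (Fin 3)

/-- The partial derivative in the `i`-th coordinate direction. -/
def pd (i : Fin 3) (f : E3 → ℝ) (x : E3) : ℝ := fderiv ℝ f x (EuclideanSpace.single i 1)

/-- The Laplacian, as the sum of the pure second partial derivatives. -/
def lap (f : E3 → ℝ) (x : E3) : ℝ := ∑ i, pd i (pd i f) x

/-- Continuous functions decaying faster than any power. -/
structure RapidDecay (f : E3 → ℝ) : Prop where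
  cont : Continuous f
  decay : ∀ k : ℕ, ∃ C, ∀ x, ‖x‖ ^ k * |f x| ≤ C

namespace RapidDecay

variable {f g : E3 → ℝ}

lemma bounded (hf : RapidDecay f) : ∃ C, 0 ≤ C ∧ ∀ x, |f x| ≤ C := by
  obtain ⟨C, hC⟩ := hf.decay 0
  refine ⟨C, ?_, fun x => by simpa using hC x⟩
  exact (abs_nonneg (f 0)).trans (by simpa using hC 0)

lemma of_le (hf : RapidDecay f) (hg : Continuous g) (C : ℝ) (m : ℕ)
    (h : ∀ x, |g x| ≤ C * (1 + ‖x‖ ^ m) * |f x|) : RapidDecay g := by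
  refine ⟨hg, fun k => ?_⟩
  obtain ⟨C₁, h₁⟩ := hf.decay k
  obtain ⟨C₂, h₂⟩ := hf.decay (k + m)
  refine ⟨|C| * (C₁ + C₂), fun x => ?_⟩
  calc ‖x‖ ^ k * |g x| ≤ ‖x‖ ^ k * (C * (1 + ‖x‖ ^ m) * |f x|) := by gcongr; exact h x
    _ ≤ ‖x‖ ^ k * (|C| * (1 + ‖x‖ ^ m) * |f x|) := by gcongr; exact le_abs_self C
    _ = |C| * (‖x‖ ^ k * |f x| + ‖x‖ ^ (k + m) * |f x|) := by ring
    _ ≤ |C| * (C₁ + C₂) := by gcongr; exacts [h₁ x, h₂ x]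

lemma integrable (hf : RapidDecay f) : Integrable f := by
  obtain ⟨C₁, h₁⟩ := hf.decay 0
  obtain ⟨C₂, h₂⟩ := hf.decay (0 + (volume : Measure E3).integrablePower)
  have := integrable_of_le_of_pow_mul_le (μ := (volume : Measure E3)) (k := 0) (f := f)
    (C₁ := C₁) (C₂ := C₂) (by simpa using h₁) h₂ hf.cont.aestronglyMeasurable
  rw [← integrable_norm_iff hf.cont.aestronglyMeasurable]
  simpa using this

lemma of_abs_le (hf : RapidDecay f) (hg : Continuous g) (h : ∀ x, |g x| ≤ |f x|) :
    RapidDecay g :=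
  hf.of_le hg 1 0 fun x => (h x).trans (by nlinarith [abs_nonneg (f x), norm_nonneg x])

lemma mul_of_le (hf : RapidDecay f) (hg : Continuous g) (C : ℝ) (m : ℕ)
    (h : ∀ x, |g x| ≤ C * (1 + ‖x‖ ^ m)) : RapidDecay fun x => g x * f x :=
  hf.of_le (hg.mul hf.cont) C m fun x => by
    rw [abs_mul]; exact mul_le_mul_of_nonneg_right (h x) (abs_nonneg _)

lemma mul (hf : RapidDecay f) (hg : RapidDecay g) : RapidDecay fun x => f x * g x := by
  obtain ⟨C, hC, h⟩ := hf.bounded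
  exact hg.mul_of_le hf.cont C 0 fun x => (h x).trans (by simp; linarith)

lemma add (hf : RapidDecay f) (hg : RapidDecay g) : RapidDecay fun x => f x + g x := by
  refine ⟨hf.cont.add hg.cont, fun k => ?_⟩
  obtain ⟨C₁, h₁⟩ := hf.decay k
  obtain ⟨C₂, h₂⟩ := hg.decay k
  refine ⟨C₁ + C₂, fun x => ?_⟩
  calc ‖x‖ ^ k * |f x + g x| ≤ ‖x‖ ^ k * (|f x| + |g x|) := by gcongr; exact abs_add_le _ _
    _ ≤ C₁ + C₂ := by rw [mul_add]; exact add_le_add (h₁ x) (h₂ x)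

lemma const_mul (hf : RapidDecay f) (c : ℝ) : RapidDecay fun x => c * f x :=
  hf.mul_of_le continuous_const |c| 0 fun x => by simp; linarith [abs_nonneg c]

lemma neg (hf : RapidDecay f) : RapidDecay fun x => -f x := by
  simpa using hf.const_mul (-1)

lemma sub (hf : RapidDecay f) (hg : RapidDecay g) : RapidDecay fun x => f x - g x := by
  simpa [sub_eq_add_neg] using hf.add hg.neg

lemma sq (hf : RapidDecay f) : RapidDecay fun x => f x ^ 2 := by
  simpa [_root_.sq] using hf.mul hf

lemma sum {ι : Type*} (s : Finset ι) {F : ι → E3 → ℝ} (h : ∀ i, RapidDecay (F i)) :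
    RapidDecay fun x => ∑ i ∈ s, F i x := by
  classical
  induction s using Finset.induction_on with
  | empty => exact ⟨by simpa using continuous_const, fun k => ⟨0, by simp⟩⟩
  | insert i s hi ih => simpa [Finset.sum_insert hi] using (h i).add ih

lemma coord_mul (hf : RapidDecay f) (i : Fin 3) : RapidDecay fun x => x i * f x :=
  hf.mul_of_le (by fun_prop) 1 1 fun x => by
    have h2 := PiLp.norm_apply_le x i
    rw [Real.norm_eq_abs] at h2; simp; linarith

lemma abs (hf : RapidDecay f) : RapidDecay fun x => |f x| :=
  hf.of_abs_le hf.cont.abs fun x => by simp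

end RapidDecay

section PartialDerivatives

variable {f g : E3 → ℝ} {i : Fin 3}

lemma pd_add (hf : Differentiable ℝ f) (hg : Differentiable ℝ g) :
    pd i (fun x => f x + g x) = fun x => pd i f x + pd i g x := by
  ext x; simp [pd, fderiv_fun_add (hf x) (hg x)]

lemma pd_sub (hf : Differentiable ℝ f) (hg : Differentiable ℝ g) :
    pd i (fun x => f x - g x) = fun x => pd i f x - pd i g x := by
  ext x; simp [pd, fderiv_fun_sub (hf x) (hg x)]

lemma pd_mul (hf : Differentiable ℝ f) (hg : Differentiable ℝ g) :
    pd i (fun x => f x * g x) = fun x => pd i f x * g x + f x * pd i g x := by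
  ext x; simp [pd, fderiv_fun_mul (hf x) (hg x)]; ring

lemma pd_sq (hf : Differentiable ℝ f) :
    pd i (fun x => f x ^ 2) = fun x => 2 * f x * pd i f x := by
  simp_rw [sq]; rw [pd_mul hf hf]; ext x; ring

lemma pd_const (c : ℝ) : pd i (fun _ => c) = fun _ => 0 := by
  ext x; simp [pd]

lemma pd_const_mul (hf : Differentiable ℝ f) (c : ℝ) :
    pd i (fun x => c * f x) = fun x => c * pd i f x := by
  rw [pd_mul (differentiable_const c) hf, pd_const]; simp

lemma pd_coord (j : Fin 3) : pd i (fun x : E3 => x j) = fun _ => if i = j then 1 else 0 := by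
  ext x
  have : HasFDerivAt (fun x : E3 => x j) (EuclideanSpace.proj j : E3 →L[ℝ] ℝ) x :=
    (EuclideanSpace.proj j : E3 →L[ℝ] ℝ).hasFDerivAt
  simp [pd, this.fderiv, eq_comm]

lemma contDiff_pd {n : ℕ} (hf : ContDiff ℝ (n + 1 : ℕ) f) : ContDiff ℝ n (pd i f) := by
  unfold pd
  exact (hf.fderiv_right (m := n) (by norm_cast)).clm_apply contDiff_const

lemma contDiff_one_pd (hf : ContDiff ℝ 2 f) : ContDiff ℝ 1 (pd i f) :=
  contDiff_pd (n := 1) hf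

lemma continuous_pd (hf : ContDiff ℝ 1 f) : Continuous (pd i f) :=
  (contDiff_pd (n := 0) (by exact_mod_cast hf)).continuous

lemma pd_comm (hf : ContDiff ℝ 2 f) (i j : Fin 3) (x : E3) :
    pd i (pd j f) x = pd j (pd i f) x := by
  have h : Differentiable ℝ (fderiv ℝ f) :=
    (hf.fderiv_right (m := 1) (by norm_num)).differentiable (by norm_num)
  have key : ∀ k l : Fin 3, pd k (pd l f) x =
      fderiv ℝ (fderiv ℝ f) x (EuclideanSpace.single k 1) (EuclideanSpace.single l 1) := by
    intro k l
    unfold pd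
    rw [fderiv_clm_apply (h x) (differentiableAt_const _)]
    simp
  rw [key, key]
  exact (hf.contDiffAt.isSymmSndFDerivAt (by simp)) _ _

lemma integral_pd_eq_zero (hg : Differentiable ℝ g) (hi : Integrable g)
    (hi' : Integrable (pd i g)) : ∫ x, pd i g x = 0 := by
  have := integral_mul_fderiv_eq_neg_fderiv_mul_of_integrable (μ := (volume : Measure E3))
    (f := fun _ => (1 : ℝ)) (g := g) (v := EuclideanSpace.single i 1)
    (by simp) (by simpa [pd] using! hi') (by simpa using hi) (fun x _ => by fun_prop)
    (fun x _ => hg x)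
  simpa [pd] using this

lemma hasCompactSupport_pd (hg : HasCompactSupport g) : HasCompactSupport (pd i g) :=
  hg.fderiv_apply ℝ _

/-- The divergence theorem for compactly supported vector fields. -/
lemma integral_div_eq_zero {v : Fin 3 → E3 → ℝ} (hv : ∀ i, ContDiff ℝ 1 (v i))
    (hc : ∀ i, HasCompactSupport (v i)) : ∫ x, ∑ i, pd i (v i) x = 0 := by
  have hI : ∀ i, Integrable (pd i (v i)) := fun i =>
    (continuous_pd (hv i)).integrable_of_hasCompactSupport (hasCompactSupport_pd (hc i))
  rw [integral_finsetSum _ fun i _ => hI i]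
  exact Finset.sum_eq_zero fun i _ => integral_pd_eq_zero ((hv i).differentiable one_ne_zero)
    ((hv i).continuous.integrable_of_hasCompactSupport (hc i)) (hI i)

end PartialDerivatives

/-- Twice differentiable functions that decay rapidly together with their derivatives. -/
structure Nice (f : E3 → ℝ) : Prop where
  smooth : ContDiff ℝ 2 f
  rd : RapidDecay f
  rd_pd : ∀ i, RapidDecay (pd i f)
  rd_pd₂ : ∀ i, RapidDecay (pd i (pd i f))

namespace Nice

variable {f g : E3 → ℝ}

lemma diff (hf : Nice f) : Differentiable ℝ f := hf.smooth.differentiable two_ne_zero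

lemma diff_pd (hf : Nice f) (i : Fin 3) : Differentiable ℝ (pd i f) :=
  (contDiff_one_pd hf.smooth).differentiable one_ne_zero

lemma rd_lap (hf : Nice f) : RapidDecay (lap f) := .sum _ hf.rd_pd₂

lemma sub (hf : Nice f) (hg : Nice g) : Nice fun x => f x - g x where
  smooth := hf.smooth.sub hg.smooth
  rd := hf.rd.sub hg.rd
  rd_pd i := by rw [pd_sub hf.diff hg.diff]; exact (hf.rd_pd i).sub (hg.rd_pd i)
  rd_pd₂ i := by
    rw [pd_sub hf.diff hg.diff, pd_sub (hf.diff_pd i) (hg.diff_pd i)]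
    exact (hf.rd_pd₂ i).sub (hg.rd_pd₂ i)

lemma lap_sub (hf : Nice f) (hg : Nice g) (x : E3) :
    lap (fun x => f x - g x) x = lap f x - lap g x := by
  simp only [lap, ← Finset.sum_sub_distrib]
  refine Finset.sum_congr rfl fun i _ => ?_
  rw [pd_sub hf.diff hg.diff, pd_sub (hf.diff_pd i) (hg.diff_pd i)]

end Nice

/-- Squared modulus of `a + ib`. -/
def den (a b : E3 → ℝ) (x : E3) : ℝ := a x ^ 2 + b x ^ 2

/-- Squared modulus of the gradient of `a + ib`. -/
def gsq (a b : E3 → ℝ) (x : E3) : ℝ := ∑ i, (pd i a x ^ 2 + pd i b x ^ 2)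

/-- The `i`-th component of the current of `a + ib`. -/
def cur (a b : E3 → ℝ) (i : Fin 3) (x : E3) : ℝ := a x * pd i b x - b x * pd i a x

lemma den_nonneg (a b : E3 → ℝ) (x : E3) : 0 ≤ den a b x := by unfold den; positivity
lemma gsq_nonneg (a b : E3 → ℝ) (x : E3) : 0 ≤ gsq a b x := by unfold gsq; positivity

lemma Nice.rd_den {a b : E3 → ℝ} (ha : Nice a) (hb : Nice b) : RapidDecay (den a b) :=
  ha.rd.sq.add hb.rd.sq

lemma Nice.rd_gsq {a b : E3 → ℝ} (ha : Nice a) (hb : Nice b) : RapidDecay (gsq a b) :=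
  .sum _ fun i => (ha.rd_pd i).sq.add (hb.rd_pd i).sq

lemma Nice.rd_cur {a b : E3 → ℝ} (ha : Nice a) (hb : Nice b) (i : Fin 3) :
    RapidDecay (cur a b i) :=
  (ha.rd.mul (hb.rd_pd i)).sub (hb.rd.mul (ha.rd_pd i))

section RegularisedKernel

/-- The regularised Newton kernel `(|x - y|² + ε)^{-1/2}`. -/
def kap (ε : ℝ) (y x : E3) : ℝ := (√(‖x - y‖ ^ 2 + ε))⁻¹

variable {ε : ℝ} (hε : 0 < ε) (x y : E3) (i : Fin 3)

lemma kap_comm (ε : ℝ) (x y : E3) : kap ε y x = kap ε x y := by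
  unfold kap; rw [norm_sub_rev]

lemma norm_sub_sq_eq (x y : E3) : ‖x - y‖ ^ 2 = ∑ i, (x i - y i) ^ 2 := by
  simp [EuclideanSpace.real_norm_sq_eq]

include hε

lemma kap_pos : 0 < kap ε y x := by unfold kap; positivity

lemma kap_sq : kap ε y x ^ 2 = (‖x - y‖ ^ 2 + ε)⁻¹ := by
  unfold kap; rw [inv_pow, Real.sq_sqrt (by positivity)]

lemma kap_sq_mul : kap ε y x ^ 2 * ∑ i, (x i - y i) ^ 2 = 1 - ε * kap ε y x ^ 2 := by
  rw [kap_sq hε, ← norm_sub_sq_eq]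
  field_simp
  ring

lemma kap_le : kap ε y x ≤ (√ε)⁻¹ := by
  unfold kap; gcongr; nlinarith [sq_nonneg ‖x - y‖]

lemma abs_coord_mul_kap_le : |x i - y i| * kap ε y x ≤ 1 := by
  have h := kap_sq_mul hε x y
  have h0 := kap_pos hε x y
  have h1 : (x i - y i) ^ 2 ≤ ∑ i, (x i - y i) ^ 2 :=
    Finset.single_le_sum (f := fun i => (x i - y i) ^ 2) (fun _ _ => sq_nonneg _) (Finset.mem_univ i)
  rw [← abs_of_pos h0, ← abs_mul]
  refine abs_le_one_iff_mul_self_le_one.2 ?_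
  nlinarith [mul_le_mul_of_nonneg_left h1 (sq_nonneg (kap ε y x)),
    mul_nonneg hε.le (sq_nonneg (kap ε y x))]

lemma kap_le_inv (h : x ≠ y) : kap ε y x ≤ ‖x - y‖⁻¹ := by
  have : 0 < ‖x - y‖ := norm_pos_iff.2 (sub_ne_zero.2 h)
  unfold kap
  gcongr
  exact Real.le_sqrt_of_sq_le (by linarith)

lemma contDiff_kap {n : ℕ∞} : ContDiff ℝ n (kap ε y) := by
  unfold kap
  have h : ∀ x : E3, ‖x - y‖ ^ 2 + ε ≠ 0 := fun x => by positivity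
  refine ContDiff.inv (ContDiff.sqrt ?_ h) fun x => by have := h x; positivity
  exact ((contDiff_id.sub contDiff_const).norm_sq ℝ).add contDiff_const

lemma differentiable_kap : Differentiable ℝ (kap ε y) :=
  (contDiff_kap hε y (n := 1)).differentiable (by norm_num)

lemma pd_kap : pd i (kap ε y) = fun x => -(x i - y i) * kap ε y x ^ 3 := by
  ext x
  have h1 : HasFDerivAt (fun x : E3 => ‖x - y‖ ^ 2 + ε)
      (2 • (innerSL ℝ (x - y)).comp (ContinuousLinearMap.id ℝ E3)) x :=
    (((hasFDerivAt_id x).sub_const y).norm_sq).add_const ε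
  have hp : 0 < ‖x - y‖ ^ 2 + ε := by positivity
  have h2 := (hasDerivAt_inv (Real.sqrt_pos.2 hp).ne').comp_hasFDerivAt x (h1.sqrt hp.ne')
  have : pd i (kap ε y) x = _ := congrArg (fun L => L (EuclideanSpace.single i 1)) h2.fderiv
  rw [this]
  simp [kap, EuclideanSpace.inner_single_right]
  field_simp
  ring

end RegularisedKernel

/-- Integration by parts against a function with bounded first derivatives. -/
lemma integral_mul_pd {φ f : E3 → ℝ} {i : Fin 3} (hφ : ContDiff ℝ 1 φ) {C : ℝ}
    (h0 : ∀ x, |φ x| ≤ C) (h1 : ∀ x, |pd i φ x| ≤ C) (hf : Differentiable ℝ f)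
    (hr : RapidDecay f) (hr' : RapidDecay (pd i f)) :
    ∫ x, φ x * pd i f x = -∫ x, pd i φ x * f x := by
  have e : pd i (fun x => φ x * f x) = fun x => pd i φ x * f x + φ x * pd i f x :=
    pd_mul (hφ.differentiable one_ne_zero) hf
  have hC : 0 ≤ C := (abs_nonneg _).trans (h0 0)
  have i1 : RapidDecay fun x => pd i φ x * f x :=
    hr.mul_of_le (continuous_pd hφ) C 0 fun x => (h1 x).trans (by simp; linarith)
  have i2 : RapidDecay fun x => φ x * pd i f x :=
    hr'.mul_of_le hφ.continuous C 0 fun x => (h0 x).trans (by simp; linarith)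
  have i3 : RapidDecay fun x => φ x * f x :=
    hr.mul_of_le hφ.continuous C 0 fun x => (h0 x).trans (by simp; linarith)
  have := integral_pd_eq_zero (i := i) ((hφ.differentiable one_ne_zero).fun_mul hf) i3.integrable
    (by rw [e]; exact (i1.add i2).integrable)
  rw [e, integral_add i1.integrable i2.integrable] at this
  linarith

/-- Squared modulus of the gauge-transformed gradient `∇ψ - iαxψ` of `ψ = a + ib`. -/
def gd (α : ℝ) (a b : E3 → ℝ) (x : E3) : ℝ :=
  ∑ i, ((pd i a x + α * x i * b x) ^ 2 + (pd i b x - α * x i * a x) ^ 2)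

lemma gd_zero (a b : E3 → ℝ) : gd 0 a b = gsq a b := by
  ext x; simp [gd, gsq]

lemma gd_nonneg (α : ℝ) (a b : E3 → ℝ) (x : E3) : 0 ≤ gd α a b x := by unfold gd; positivity

namespace Nice

variable {a b : E3 → ℝ} (ha : Nice a) (hb : Nice b)
include ha hb

lemma rd_gd (α : ℝ) : RapidDecay (gd α a b) := by
  refine .sum _ fun i => (RapidDecay.sq ?_).add (RapidDecay.sq ?_)
  · simpa [mul_assoc] using (ha.rd_pd i).add ((hb.rd.coord_mul i).const_mul α)
  · simpa [mul_assoc] using (hb.rd_pd i).sub ((ha.rd.coord_mul i).const_mul α)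

lemma smooth_den : ContDiff ℝ 2 (den a b) := (ha.smooth.pow 2).add (hb.smooth.pow 2)

lemma pd_den (i : Fin 3) :
    pd i (den a b) = fun x => 2 * a x * pd i a x + 2 * b x * pd i b x := by
  unfold den
  rw [pd_add (ha.diff.fun_pow 2) (hb.diff.fun_pow 2), pd_sq ha.diff, pd_sq hb.diff]

lemma rd_pd_den (i : Fin 3) : RapidDecay (pd i (den a b)) := by
  rw [pd_den ha hb]
  simpa [mul_assoc] using
    ((ha.rd.mul (ha.rd_pd i)).const_mul 2).add ((hb.rd.mul (hb.rd_pd i)).const_mul 2)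

lemma lap_den (x : E3) : lap (den a b) x = 2 * gsq a b x + 2 * (a x * lap a x + b x * lap b x) := by
  have : ∀ i, pd i (pd i (den a b)) x = 2 * (pd i a x ^ 2 + pd i b x ^ 2) +
      2 * (a x * pd i (pd i a) x + b x * pd i (pd i b) x) := by
    intro i
    have h : ∀ {f}, Nice f → Differentiable ℝ fun x => 2 * f x := fun h => h.diff.const_mul 2
    rw [pd_den ha hb, pd_add ((h ha).fun_mul (ha.diff_pd i)) ((h hb).fun_mul (hb.diff_pd i)),
      pd_mul (h ha) (ha.diff_pd i), pd_mul (h hb) (hb.diff_pd i), pd_const_mul ha.diff,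
      pd_const_mul hb.diff]
    ring
  simp only [lap, gsq, this, Finset.sum_add_distrib, Finset.mul_sum, mul_add]

lemma hardy_regularised (α : ℝ) {ε : ℝ} (hε : 0 < ε) (y : E3) :
    ∫ x, kap ε y x ^ 2 * den a b x ≤ 4 * ∫ x, gd α a b x := by
  have hk := fun x => kap_pos hε x y
  have hkε := fun x => kap_le hε x y
  have hn := rd_den ha hb
  have kdiff := differentiable_kap hε y
  have ck : Continuous (kap ε y) := kdiff.continuous
  set v : Fin 3 → E3 → ℝ := fun i x => (x i - y i) * kap ε y x ^ 2 with hv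
  have cdiff : ∀ i, Differentiable ℝ fun x : E3 => x i - y i := fun i => by fun_prop
  have pdk2 : ∀ i, pd i (fun x => kap ε y x ^ 2) =
      fun x => 2 * kap ε y x * (-(x i - y i) * kap ε y x ^ 3) := fun i => by
    rw [pd_sq kdiff, pd_kap hε]
  have pdv : ∀ i, pd i (v i) = fun x => kap ε y x ^ 2 - 2 * (x i - y i) ^ 2 * kap ε y x ^ 4 := by
    intro i
    simp only [hv]
    rw [pd_mul (cdiff i) (kdiff.fun_pow 2), pdk2,
      pd_sub (by fun_prop) (by fun_prop), pd_coord, pd_const]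
    ext x; simp; ring
  have bd0 : ∀ i x, |v i x| ≤ (√ε)⁻¹ + 3 * (√ε)⁻¹ ^ 2 := by
    intro i x
    simp only [hv, sq, ← mul_assoc, abs_mul, abs_of_pos (hk x)]
    have := mul_le_mul (abs_coord_mul_kap_le hε x y i) (hkε x) (hk x).le zero_le_one
    have h2 : 0 ≤ 3 * (√ε)⁻¹ * (√ε)⁻¹ := by positivity
    linarith
  have bd1 : ∀ i x, |pd i (v i) x| ≤ (√ε)⁻¹ + 3 * (√ε)⁻¹ ^ 2 := by
    intro i x
    rw [pdv]
    have h1 := abs_coord_mul_kap_le hε x y i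
    have h3 : ((x i - y i) * kap ε y x) ^ 2 ≤ 1 := by
      rw [sq_le_one_iff_abs_le_one, abs_mul, abs_of_pos (hk x)]; exact h1
    have h4 : kap ε y x ^ 2 ≤ (√ε)⁻¹ ^ 2 := pow_le_pow_left₀ (hk x).le (hkε x) 2
    have h5 : 0 ≤ (√ε)⁻¹ := by positivity
    beta_reduce
    rw [show kap ε y x ^ 2 - 2 * (x i - y i) ^ 2 * kap ε y x ^ 4 =
      kap ε y x ^ 2 - 2 * (((x i - y i) * kap ε y x) ^ 2 * kap ε y x ^ 2) by ring, abs_le]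
    have h6 := mul_le_mul_of_nonneg_right h3 (sq_nonneg (kap ε y x))
    have h7 : 0 ≤ ((x i - y i) * kap ε y x) ^ 2 * kap ε y x ^ 2 := by positivity
    constructor <;> nlinarith
  have cv : ∀ i, ContDiff ℝ 1 (v i) := fun i =>
    (contDiff_euclidean.1 contDiff_id i |>.sub contDiff_const).mul
      ((contDiff_kap hε y (n := 1)).pow 2)
  have ibp : ∀ i, ∫ x, v i x * pd i (den a b) x = -∫ x, pd i (v i) x * den a b x := fun i =>
    integral_mul_pd (cv i) (bd0 i) (bd1 i) ((smooth_den ha hb).differentiable two_ne_zero) hn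
      (rd_pd_den ha hb i)
  have r1 : ∀ i, RapidDecay fun x => v i x * pd i (den a b) x := fun i =>
    (rd_pd_den ha hb i).mul_of_le (cv i).continuous _ 0 fun x =>
      (bd0 i x).trans (le_mul_of_one_le_right ((abs_nonneg _).trans (bd0 i x)) (by simp))
  have r2 : ∀ i, RapidDecay fun x => pd i (v i) x * den a b x := fun i =>
    hn.mul_of_le (continuous_pd (cv i)) _ 0 fun x =>
      (bd1 i x).trans (le_mul_of_one_le_right ((abs_nonneg _).trans (bd1 i x)) (by simp))
  have rk : RapidDecay fun x => kap ε y x ^ 2 * den a b x :=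
    hn.mul_of_le (ck.pow 2) ((√ε)⁻¹ ^ 2) 0 fun x => by
      rw [abs_of_nonneg (by positivity)]
      have := pow_le_pow_left₀ (hk x).le (hkε x) 2
      simp only [pow_zero]
      nlinarith [sq_nonneg ((√ε)⁻¹)]
  have rg := rd_gd ha hb α
  have key : ∫ x, ∑ i, pd i (v i) x * den a b x = ∫ x, ∑ i, -(v i x * pd i (den a b) x) := by
    rw [integral_finsetSum _ fun i _ => (r2 i).integrable,
      integral_finsetSum _ fun i _ => (r1 i).neg.integrable]
    refine Finset.sum_congr rfl fun i _ => ?_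
    rw [integral_neg, ibp i, neg_neg]
  have l1 : ∫ x, kap ε y x ^ 2 * den a b x ≤ ∫ x, ∑ i, pd i (v i) x * den a b x := by
    refine integral_mono rk.integrable (integrable_finsetSum _ fun i _ => (r2 i).integrable) ?_
    intro x
    simp only [pdv]
    rw [← Finset.sum_mul]
    refine mul_le_mul_of_nonneg_right ?_ (den_nonneg a b x)
    have e := kap_sq_mul hε x y
    rw [Finset.sum_sub_distrib, ← Finset.sum_mul, ← Finset.mul_sum]
    simp only [Finset.sum_const, Finset.card_univ, Fintype.card_fin, nsmul_eq_mul]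
    have : (∑ i, (x i - y i) ^ 2) * kap ε y x ^ 4 = kap ε y x ^ 2 * (1 - ε * kap ε y x ^ 2) := by
      rw [← e]; ring
    push_cast
    nlinarith [mul_nonneg hε.le (sq_nonneg (kap ε y x ^ 2))]
  have l2 : ∫ x, ∑ i, -(v i x * pd i (den a b) x) ≤
      ∫ x, ((1 / 2) * (kap ε y x ^ 2 * den a b x) + 2 * gd α a b x) := by
    refine integral_mono (integrable_finsetSum _ fun i _ => (r1 i).neg.integrable)
      ((rk.const_mul _).add (rg.const_mul 2)).integrable ?_
    intro x
    simp only [pd_den ha hb]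
    have : ∀ i, -(v i x * (2 * a x * pd i a x + 2 * b x * pd i b x)) ≤
        (1 / 2) * (v i x ^ 2 * den a b x) +
        2 * ((pd i a x + α * x i * b x) ^ 2 + (pd i b x - α * x i * a x) ^ 2) := by
      intro i
      unfold den
      nlinarith [sq_nonneg (v i x * a x + 2 * (pd i a x + α * x i * b x)),
        sq_nonneg (v i x * b x + 2 * (pd i b x - α * x i * a x))]
    refine (Finset.sum_le_sum fun i _ => this i).trans ?_
    rw [Finset.sum_add_distrib, ← Finset.mul_sum, ← Finset.mul_sum, ← Finset.sum_mul]
    change _ + 2 * gd α a b x ≤ _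
    gcongr
    · exact den_nonneg a b x
    · have e := kap_sq_mul hε x y
      simp only [hv, mul_pow]
      rw [← Finset.sum_mul, show (kap ε y x ^ 2) ^ 2 = kap ε y x ^ 2 * kap ε y x ^ 2 by ring,
        ← mul_assoc, mul_comm (∑ i, _) (kap ε y x ^ 2), e]
      nlinarith [mul_nonneg hε.le (sq_nonneg (kap ε y x ^ 2)), sq_nonneg (kap ε y x)]
  rw [integral_add (rk.const_mul _).integrable (rg.const_mul 2).integrable,
    integral_const_mul, integral_const_mul] at l2
  linarith [key]

end Nice

section MeasureTools

variable {X : Type*} [MeasurableSpace X] {μ : Measure X}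

/-- Fatou's lemma for real-valued nonnegative functions. -/
lemma integrable_and_integral_le_of_tendsto {F : ℕ → X → ℝ} {f : X → ℝ} {c : ℝ}
    (hF : ∀ k, Integrable (F k) μ) (h0 : ∀ k, 0 ≤ᵐ[μ] F k) (hc : ∀ k, ∫ x, F k x ∂μ ≤ c)
    (hl : ∀ᵐ x ∂μ, Filter.Tendsto (fun k => F k x) Filter.atTop (𝓝 (f x))) :
    Integrable f μ ∧ ∫ x, f x ∂μ ≤ c := by
  have hm : AEStronglyMeasurable f μ :=
    aestronglyMeasurable_of_tendsto_ae _ (fun k => (hF k).aestronglyMeasurable) hl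
  have f0 : 0 ≤ᵐ[μ] f := by
    filter_upwards [hl, ae_all_iff.2 h0] with x hx h
    exact ge_of_tendsto' hx h
  have hc0 : 0 ≤ c := (integral_nonneg_of_ae (h0 0)).trans (hc 0)
  have key : ∫⁻ x, ENNReal.ofReal (f x) ∂μ ≤ ENNReal.ofReal c := by
    calc ∫⁻ x, ENNReal.ofReal (f x) ∂μ
        = ∫⁻ x, Filter.liminf (fun k => ENNReal.ofReal (F k x)) Filter.atTop ∂μ := by
          refine lintegral_congr_ae ?_
          filter_upwards [hl] with x hx
          exact ((ENNReal.continuous_ofReal.tendsto _).comp hx).liminf_eq.symm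
      _ ≤ Filter.liminf (fun k => ∫⁻ x, ENNReal.ofReal (F k x) ∂μ) Filter.atTop :=
          lintegral_liminf_le' fun k => (hF k).aestronglyMeasurable.aemeasurable.ennreal_ofReal
      _ ≤ ENNReal.ofReal c := by
          refine Filter.liminf_le_of_frequently_le' (Filter.Frequently.of_forall fun k => ?_)
          rw [← ofReal_integral_eq_lintegral_ofReal (hF k) (h0 k)]
          exact ENNReal.ofReal_le_ofReal (hc k)
  have hi : Integrable f μ := by
    refine ⟨hm, ?_⟩
    rw [hasFiniteIntegral_iff_ofReal f0]
    exact key.trans_lt ENNReal.ofReal_lt_top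
  refine ⟨hi, ?_⟩
  rw [← ofReal_integral_eq_lintegral_ofReal hi f0] at key
  exact (ENNReal.ofReal_le_ofReal_iff hc0).1 key

lemma integrable_mul_of_sq {f g : X → ℝ} (hf : AEStronglyMeasurable f μ)
    (hg : AEStronglyMeasurable g μ) (hf2 : Integrable (fun x => f x ^ 2) μ)
    (hg2 : Integrable (fun x => g x ^ 2) μ) : Integrable (fun x => f x * g x) μ := by
  refine (hf2.add hg2).mono' (hf.mul hg) (Filter.Eventually.of_forall fun x => ?_)
  simp only [Pi.add_apply, norm_mul, Real.norm_eq_abs]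
  nlinarith [sq_nonneg (|f x| - |g x|), sq_abs (f x), sq_abs (g x), sq_nonneg (f x),
    sq_nonneg (g x)]

lemma sq_le_of_forall_quadratic {A B C : ℝ} (hA : 0 ≤ A)
    (h : ∀ s : ℝ, 0 ≤ A + 2 * s * B + s ^ 2 * C) : |B| ≤ √A * √C := by
  have := discrim_le_zero (a := C) (b := 2 * B) (c := A) fun s => by nlinarith [h s]
  rw [discrim] at this
  rw [← Real.sqrt_mul hA]
  exact Real.abs_le_sqrt (by nlinarith)

/-- The Cauchy–Schwarz inequality. -/
lemma abs_integral_mul_le {f g : X → ℝ} (hf : AEStronglyMeasurable f μ)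
    (hg : AEStronglyMeasurable g μ) (hf2 : Integrable (fun x => f x ^ 2) μ)
    (hg2 : Integrable (fun x => g x ^ 2) μ) :
    |∫ x, f x * g x ∂μ| ≤ √(∫ x, f x ^ 2 ∂μ) * √(∫ x, g x ^ 2 ∂μ) := by
  have hi := integrable_mul_of_sq hf hg hf2 hg2
  refine sq_le_of_forall_quadratic (integral_nonneg fun x => sq_nonneg _) fun s => ?_
  calc 0 ≤ ∫ x, (f x + s * g x) ^ 2 ∂μ := integral_nonneg fun x => sq_nonneg _
    _ = ∫ x, (f x ^ 2 + 2 * s * (f x * g x) + s ^ 2 * g x ^ 2) ∂μ := by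
      congr 1; ext x; ring
    _ = _ := by
      rw [integral_add (hf2.fun_add (hi.const_mul _)) (hg2.const_mul _),
        integral_add hf2 (hi.const_mul _), integral_const_mul, integral_const_mul]

/-- The Cauchy–Schwarz inequality for products of absolute values of pairs. -/
lemma integral_le_sqrt_mul_sqrt {u f g : X → ℝ} (hf : Integrable f μ) (hg : Integrable g μ)
    (hu : AEStronglyMeasurable u μ)
    (hf0 : ∀ x, 0 ≤ f x) (hg0 : ∀ x, 0 ≤ g x) (h : ∀ x, |u x| ≤ √(f x) * √(g x)) :
    Integrable u μ ∧ |∫ x, u x ∂μ| ≤ √(∫ x, f x ∂μ) * √(∫ x, g x ∂μ) := by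
  have e1 : (fun x => √(f x) ^ 2) = f := funext fun x => Real.sq_sqrt (hf0 x)
  have e2 : (fun x => √(g x) ^ 2) = g := funext fun x => Real.sq_sqrt (hg0 x)
  have m1 := Real.continuous_sqrt.comp_aestronglyMeasurable hf.aestronglyMeasurable
  have m2 := Real.continuous_sqrt.comp_aestronglyMeasurable hg.aestronglyMeasurable
  have hi := integrable_mul_of_sq (f := fun x => √(f x)) (g := fun x => √(g x)) m1 m2
    (by rwa [e1]) (by rwa [e2])
  have hcs := abs_integral_mul_le (f := fun x => √(f x)) (g := fun x => √(g x)) m1 m2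
    (by rwa [e1]) (by rwa [e2])
  rw [e1, e2] at hcs
  have hui : Integrable u μ := hi.mono' hu (Filter.Eventually.of_forall h)
  refine ⟨hui, ?_⟩
  calc |∫ x, u x ∂μ| ≤ ∫ x, |u x| ∂μ := abs_integral_le_integral_abs
    _ ≤ ∫ x, √(f x) * √(g x) ∂μ := integral_mono hui.abs hi h
    _ ≤ _ := (le_abs_self _).trans hcs

end MeasureTools

lemma tendsto_kap {ε : ℕ → ℝ} (h : Filter.Tendsto ε Filter.atTop (𝓝 0)) {x y : E3} (hxy : x ≠ y) :
    Filter.Tendsto (fun m => kap (ε m) y x) Filter.atTop (𝓝 ‖x - y‖⁻¹) := by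
  have hp : 0 < ‖x - y‖ := norm_pos_iff.2 (sub_ne_zero.2 hxy)
  have : ‖x - y‖⁻¹ = (√(‖x - y‖ ^ 2 + 0))⁻¹ := by
    rw [add_zero, Real.sqrt_sq hp.le]
  rw [this]
  unfold kap
  exact ((Real.continuous_sqrt.tendsto _).comp (tendsto_const_nhds.add h)).inv₀
    (by positivity)

lemma ae_ne (y : E3) : ∀ᵐ x : E3, x ≠ y := by
  rw [ae_iff]; simp

/-- The regularisation parameters `1 / (m + 1)`. -/
def eps (m : ℕ) : ℝ := 1 / ((m : ℝ) + 1)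

lemma eps_pos (m : ℕ) : 0 < eps m := by unfold eps; positivity

lemma tendsto_eps : Filter.Tendsto eps Filter.atTop (𝓝 0) :=
  tendsto_one_div_add_atTop_nhds_zero_nat

/-- The potential generated by `|a + ib|²`. -/
def pot (a b : E3 → ℝ) (x : E3) : ℝ := (1 / (4 * π)) * ∫ y, ‖x - y‖⁻¹ * den a b y

lemma pot_nonneg (a b : E3 → ℝ) (x : E3) : 0 ≤ pot a b x :=
  mul_nonneg (by positivity) (integral_nonneg fun y => mul_nonneg (by positivity) (den_nonneg _ _ _))

namespace Nice

variable {a b : E3 → ℝ} (ha : Nice a) (hb : Nice b)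
include ha hb

/-- Hardy's inequality in the gauge `α`. -/
lemma hardy (α : ℝ) (y : E3) :
    Integrable (fun x => (‖x - y‖ ^ 2)⁻¹ * den a b x) ∧
      ∫ x, (‖x - y‖ ^ 2)⁻¹ * den a b x ≤ 4 * ∫ x, gd α a b x := by
  refine integrable_and_integral_le_of_tendsto
    (F := fun m x => kap (eps m) y x ^ 2 * den a b x) (fun m => ?_) (fun m => ?_)
    (fun m => hardy_regularised ha hb α (eps_pos m) y) ?_
  · refine ((rd_den ha hb).mul_of_le ((differentiable_kap (eps_pos m) y).continuous.pow 2)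
      ((√(eps m))⁻¹ ^ 2) 0 fun x => ?_).integrable
    change |kap (eps m) y x ^ 2| ≤ _
    rw [abs_of_nonneg (by positivity)]
    have := pow_le_pow_left₀ (kap_pos (eps_pos m) x y).le (kap_le (eps_pos m) x y) 2
    simp only [pow_zero]
    nlinarith [sq_nonneg ((√(eps m))⁻¹)]
  · exact Filter.Eventually.of_forall fun x => mul_nonneg (sq_nonneg _) (den_nonneg _ _ _)
  · filter_upwards [ae_ne y] with x hx
    simpa only [inv_pow] using ((tendsto_kap tendsto_eps hx).pow 2).mul_const _

lemma continuous_den : Continuous (den a b) := (rd_den ha hb).cont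

lemma integrable_inv_mul_den (y : E3) : Integrable fun x => ‖y - x‖⁻¹ * den a b x := by
  refine (((rd_den ha hb).integrable).add (hardy ha hb 0 y).1).mono'
    (by have := (continuous_den ha hb).measurable; fun_prop) (Filter.Eventually.of_forall fun x => ?_)
  have h0 := den_nonneg a b x
  rw [Real.norm_eq_abs, abs_of_nonneg (by positivity), norm_sub_rev]
  simp only [Pi.add_apply]
  rw [← one_add_mul]
  gcongr
  rw [← inv_pow]
  nlinarith [sq_nonneg (‖x - y‖⁻¹ - 1), inv_nonneg.2 (norm_nonneg (x - y))]

lemma integral_inv_mul_den_le (y : E3) : ∫ x, ‖y - x‖⁻¹ * den a b x ≤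
    (∫ x, den a b x) + 4 * ∫ x, gsq a b x := by
  have h := hardy ha hb 0 y
  rw [gd_zero] at h
  refine le_trans ?_ (add_le_add_right h.2 (∫ x, den a b x))
  rw [← integral_add (rd_den ha hb).integrable h.1]
  refine integral_mono (integrable_inv_mul_den ha hb y) ((rd_den ha hb).integrable.add h.1) ?_
  intro x
  have h0 := den_nonneg a b x
  beta_reduce
  rw [← one_add_mul, norm_sub_rev]
  gcongr
  rw [← inv_pow]
  nlinarith [sq_nonneg (‖x - y‖⁻¹ - 1), inv_nonneg.2 (norm_nonneg (x - y))]

lemma pot_le (x : E3) : pot a b x ≤ (∫ x, den a b x) + 4 * ∫ x, gsq a b x := by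
  have h1 := integral_inv_mul_den_le ha hb x
  have h2 : (1 : ℝ) / (4 * π) ≤ 1 := by
    rw [div_le_one (by positivity)]; nlinarith [Real.pi_gt_three]
  have h3 : 0 ≤ ∫ y, ‖x - y‖⁻¹ * den a b y :=
    integral_nonneg fun y => mul_nonneg (by positivity) (den_nonneg _ _ _)
  unfold pot
  nlinarith

lemma measurable_pot : StronglyMeasurable (pot a b) := by
  have : StronglyMeasurable fun p : E3 × E3 => ‖p.1 - p.2‖⁻¹ * den a b p.2 := by
    have := (continuous_den ha hb).measurable
    exact (by fun_prop : Measurable fun p : E3 × E3 => ‖p.1 - p.2‖⁻¹ * den a b p.2).stronglyMeasurable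
  exact (this.integral_prod_right').const_mul _

end Nice

/-- The time derivative. -/
def dt (F : ℝ → E3 → ℝ) (t : ℝ) (x : E3) : ℝ := deriv (fun s => F s x) t

/-- Joint `n`-fold continuous differentiability in time and space. -/
def Joint (n : ℕ) (F : ℝ → E3 → ℝ) : Prop := ContDiff ℝ n fun p : ℝ × E3 => F p.1 p.2

namespace Joint

variable {F G : ℝ → E3 → ℝ} {n : ℕ}

lemma of_le {m : ℕ} (hF : Joint n F) (h : m ≤ n) : Joint m F :=
  ContDiff.of_le hF (by exact_mod_cast h)

lemma slice (hF : Joint n F) (t : ℝ) : ContDiff ℝ n (F t) :=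
  hF.comp (contDiff_const.prodMk contDiff_id)

lemma hasFDerivAt (hF : Joint (n + 1) F) (t : ℝ) (x : E3) : HasFDerivAt
    (fun p : ℝ × E3 => F p.1 p.2) (fderiv ℝ (fun p : ℝ × E3 => F p.1 p.2) (t, x)) (t, x) :=
  (ContDiff.differentiable hF (by norm_cast) (t, x)).hasFDerivAt

lemma hasDerivAt_fderiv (hF : Joint (n + 1) F) (t : ℝ) (x : E3) : HasDerivAt (fun s => F s x)
    (fderiv ℝ (fun p : ℝ × E3 => F p.1 p.2) (t, x) (1, 0)) t :=
  (hF.hasFDerivAt t x).comp_hasDerivAt (f := fun s => (s, x)) t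
    ((hasDerivAt_id t).prodMk (hasDerivAt_const t x))

lemma dt_eq (hF : Joint (n + 1) F) (t : ℝ) (x : E3) :
    dt F t x = fderiv ℝ (fun p : ℝ × E3 => F p.1 p.2) (t, x) (1, 0) :=
  (hF.hasDerivAt_fderiv t x).deriv

lemma hasDerivAt (hF : Joint (n + 1) F) (t : ℝ) (x : E3) :
    HasDerivAt (fun s => F s x) (dt F t x) t := by
  rw [hF.dt_eq]; exact hF.hasDerivAt_fderiv t x

lemma pd_eq (hF : Joint (n + 1) F) (i : Fin 3) (t : ℝ) (x : E3) : pd i (F t) x =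
    fderiv ℝ (fun p : ℝ × E3 => F p.1 p.2) (t, x) (0, EuclideanSpace.single i 1) := by
  have h : HasFDerivAt (F t) _ x :=
    (hF.hasFDerivAt t x).comp (f := fun y => (t, y)) x
      ((hasFDerivAt_const t x).prodMk (hasFDerivAt_id x))
  rw [pd, h.fderiv]
  simp

lemma dt (hF : Joint (n + 1) F) : Joint n (dt F) := by
  have : (fun p : ℝ × E3 => SchrodingerPoisson.dt F p.1 p.2) =
      fun p => fderiv ℝ (fun p : ℝ × E3 => F p.1 p.2) p (1, 0) :=
    funext fun p => hF.dt_eq p.1 p.2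
  unfold Joint
  rw [this]
  exact (ContDiff.fderiv_right hF (by norm_cast)).clm_apply contDiff_const

lemma pd (hF : Joint (n + 1) F) (i : Fin 3) : Joint n fun t => pd i (F t) := by
  have : (fun p : ℝ × E3 => SchrodingerPoisson.pd i (F p.1) p.2) =
      fun p => fderiv ℝ (fun p : ℝ × E3 => F p.1 p.2) p (0, EuclideanSpace.single i 1) :=
    funext fun p => hF.pd_eq i p.1 p.2
  unfold Joint
  rw [this]
  exact (ContDiff.fderiv_right hF (by norm_cast)).clm_apply contDiff_const

lemma dt_pd (hF : Joint 2 F) (i : Fin 3) (t : ℝ) (x : E3) :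
    SchrodingerPoisson.dt (fun s => SchrodingerPoisson.pd i (F s)) t x =
      SchrodingerPoisson.pd i (SchrodingerPoisson.dt F t) x := by
  set Φ := fun p : ℝ × E3 => F p.1 p.2
  have hd : Differentiable ℝ (fderiv ℝ Φ) :=
    (ContDiff.fderiv_right (m := 1) hF (by norm_num)).differentiable one_ne_zero
  have key : ∀ u v, fderiv ℝ (fun p => fderiv ℝ Φ p v) (t, x) u =
      fderiv ℝ (fderiv ℝ Φ) (t, x) u v := by
    intro u v
    rw [fderiv_clm_apply (hd _) (differentiableAt_const _)]
    simp
  rw [(hF.pd i : Joint 1 _).dt_eq (n := 0), (hF.dt : Joint 1 _).pd_eq (n := 0)]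
  have e1 : (fun p : ℝ × E3 => SchrodingerPoisson.pd i (F p.1) p.2) =
      fun p => fderiv ℝ Φ p (0, EuclideanSpace.single i 1) :=
    funext fun p => hF.pd_eq (n := 1) i p.1 p.2
  have e2 : (fun p : ℝ × E3 => SchrodingerPoisson.dt F p.1 p.2) = fun p => fderiv ℝ Φ p (1, 0) :=
    funext fun p => hF.dt_eq (n := 1) p.1 p.2
  rw [e1, e2, key, key]
  exact (ContDiff.contDiffAt hF).isSymmSndFDerivAt (by simp) _ _

lemma add (hF : Joint n F) (hG : Joint n G) : Joint n fun t x => F t x + G t x :=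
  ContDiff.add hF hG

lemma sub (hF : Joint n F) (hG : Joint n G) : Joint n fun t x => F t x - G t x :=
  ContDiff.sub hF hG

lemma mul (hF : Joint n F) (hG : Joint n G) : Joint n fun t x => F t x * G t x :=
  ContDiff.mul hF hG

lemma sq (hF : Joint n F) : Joint n fun t x => F t x ^ 2 := ContDiff.pow hF 2

lemma sum {H : Fin 3 → ℝ → E3 → ℝ} (hH : ∀ i, Joint n (H i)) :
    Joint n fun t x => ∑ i, H i t x :=
  ContDiff.sum fun i _ => hH i

lemma const {f : E3 → ℝ} (hf : ContDiff ℝ n f) : Joint n fun _ => f :=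
  hf.comp contDiff_snd

/-- Differentiation under the integral sign against a continuous compactly supported weight. -/
lemma hasDerivAt_integral (hF : Joint 1 F) {m : E3 → ℝ} (hm : Continuous m)
    (hc : HasCompactSupport m) (t : ℝ) :
    HasDerivAt (fun s => ∫ x, m x * F s x) (∫ x, m x * SchrodingerPoisson.dt F t x) t := by
  have cF : Continuous fun p : ℝ × E3 => F p.1 p.2 := ContDiff.continuous hF
  have cd : Continuous fun p : ℝ × E3 => SchrodingerPoisson.dt F p.1 p.2 :=
    ContDiff.continuous (hF.dt (n := 0))
  obtain ⟨C, hC⟩ := ((isCompact_closedBall t 1).prod hc.isCompact).exists_bound_of_continuousOn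
    cd.continuousOn
  have csl : ∀ s, Continuous fun x => m x * F s x := fun s => hm.mul (hF.slice s).continuous
  refine (hasDerivAt_integral_of_dominated_loc_of_deriv_le
    (F := fun s x => m x * F s x) (F' := fun s x => m x * SchrodingerPoisson.dt F s x)
    (bound := fun x => |m x| * C)
    (Metric.closedBall_mem_nhds t one_pos)
    (Filter.Eventually.of_forall fun s => (csl s).aestronglyMeasurable)
    ((csl t).integrable_of_hasCompactSupport hc.mul_right)
    (hm.mul (cd.comp (by fun_prop : Continuous fun x => (t, x)))).aestronglyMeasurable
    (Filter.Eventually.of_forall fun x s hs => ?_)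
    ((hm.integrable_of_hasCompactSupport hc).abs.mul_const C)
    (Filter.Eventually.of_forall fun x s _ => (hF.hasDerivAt (n := 0) s x).const_mul (m x))).2
  rw [norm_mul, Real.norm_eq_abs]
  by_cases hx : x ∈ tsupport m
  · exact mul_le_mul_of_nonneg_left (hC (s, x) ⟨hs, hx⟩) (abs_nonneg _)
  · simp [image_eq_zero_of_notMem_tsupport hx]

end Joint

section Cutoff

/-- Smooth cutoff functions with logarithmic profile. -/
def chi (k : ℕ) (x : E3) : ℝ := Real.smoothTransition (2 - Real.log (1 + ‖x‖ ^ 2) / (k + 1))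

lemma contDiff_chi (k : ℕ) {n : ℕ∞} : ContDiff ℝ n (chi k) := by
  unfold chi
  refine Real.smoothTransition.contDiff.comp (contDiff_const.sub (ContDiff.div_const ?_ _))
  exact (contDiff_const.add (contDiff_norm_sq ℝ)).log fun x => by positivity

lemma chi_nonneg (k : ℕ) (x : E3) : 0 ≤ chi k x := Real.smoothTransition.nonneg _

lemma chi_le_one (k : ℕ) (x : E3) : chi k x ≤ 1 := Real.smoothTransition.le_one _

lemma continuous_chi (k : ℕ) : Continuous (chi k) := (contDiff_chi k (n := 0)).continuous

lemma hasCompactSupport_chi (k : ℕ) : HasCompactSupport (chi k) := by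
  refine HasCompactSupport.intro (isCompact_closedBall (0 : E3) (rexp (2 * (k + 1)))) fun x hx => ?_
  refine Real.smoothTransition.zero_of_nonpos ?_
  rw [Metric.mem_closedBall, dist_zero_right, not_le] at hx
  rw [sub_nonpos, le_div_iff₀ (by positivity), Real.le_log_iff_exp_le (by positivity)]
  have : 1 ≤ rexp (2 * (k + 1)) := Real.one_le_exp (by positivity)
  nlinarith

lemma one_sub_chi_le (k : ℕ) (x : E3) : 1 - chi k x ≤ ‖x‖ ^ 2 / (k + 1) := by
  rw [le_div_iff₀ (by positivity)]
  by_cases h : 1 ≤ 2 - Real.log (1 + ‖x‖ ^ 2) / (k + 1)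
  · rw [chi, Real.smoothTransition.one_of_one_le h]; simp
  · have h1 : (k : ℝ) + 1 < Real.log (1 + ‖x‖ ^ 2) := by
      have : (1 : ℝ) < Real.log (1 + ‖x‖ ^ 2) / (k + 1) := by linarith
      rwa [one_lt_div (by positivity)] at this
    have h2 := Real.log_le_sub_one_of_pos (show 0 < 1 + ‖x‖ ^ 2 by positivity)
    have := chi_nonneg k x
    nlinarith [chi_le_one k x, mul_nonneg this (show (0 : ℝ) ≤ k + 1 by positivity)]

lemma tendsto_inv_nat : Filter.Tendsto (fun k : ℕ => ((k : ℝ) + 1)⁻¹) Filter.atTop (𝓝 0) := by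
  simpa using tendsto_one_div_add_atTop_nhds_zero_nat (𝕜 := ℝ)

lemma tendsto_chi (x : E3) : Filter.Tendsto (fun k => chi k x) Filter.atTop (𝓝 1) := by
  have h1 : Filter.Tendsto (fun k : ℕ => 1 - ‖x‖ ^ 2 * ((k : ℝ) + 1)⁻¹) Filter.atTop (𝓝 1) := by
    simpa using (tendsto_inv_nat.const_mul (‖x‖ ^ 2)).const_sub 1
  refine tendsto_of_tendsto_of_tendsto_of_le_of_le h1 tendsto_const_nhds (fun k => ?_)
    fun k => chi_le_one k x
  have := one_sub_chi_le k x
  rw [div_eq_mul_inv] at this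
  linarith

lemma exists_chi_const : ∃ c : ℝ, 0 < c ∧ ∀ (k : ℕ) (i : Fin 3) (x : E3),
    (1 + ‖x‖) * |pd i (chi k) x| ≤ c * ((k : ℝ) + 1)⁻¹ := by
  have cd : Continuous (deriv Real.smoothTransition) :=
    Real.smoothTransition.contDiff.continuous_deriv (n := 1) le_rfl
  obtain ⟨C, hC⟩ := isCompact_Icc.exists_bound_of_continuousOn (s := Icc (0 : ℝ) 1) cd.continuousOn
  have hC0 : 0 ≤ C := (norm_nonneg _).trans (hC 0 (by simp))
  have hB : ∀ s, |deriv Real.smoothTransition s| ≤ C := by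
    intro s
    by_cases hs : s ∈ Icc (0 : ℝ) 1
    · exact hC s hs
    · rw [mem_Icc, not_and_or, not_le, not_le] at hs
      have : deriv Real.smoothTransition s = 0 := by
        rcases hs with hs | hs
        · have : Real.smoothTransition =ᶠ[𝓝 s] fun _ => 0 := by
            filter_upwards [Iio_mem_nhds hs] with r hr
            exact Real.smoothTransition.zero_of_nonpos (le_of_lt hr)
          rw [this.deriv_eq]; simp
        · have : Real.smoothTransition =ᶠ[𝓝 s] fun _ => 1 := by
            filter_upwards [Ioi_mem_nhds hs] with r hr
            exact Real.smoothTransition.one_of_one_le (le_of_lt hr)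
          rw [this.deriv_eq]; simp
      rw [this]; simpa using hC0
  refine ⟨4 * C + 1, by positivity, fun k i x => ?_⟩
  have hq : 0 < 1 + ‖x‖ ^ 2 := by positivity
  have h1 : HasFDerivAt (fun x : E3 => 1 + ‖x‖ ^ 2)
      (2 • (innerSL ℝ x).comp (ContinuousLinearMap.id ℝ E3)) x :=
    ((hasFDerivAt_id x).norm_sq).const_add 1
  have h2 := ((h1.log hq.ne').mul_const ((k : ℝ) + 1)⁻¹).const_sub 2
  have h3 : HasDerivAt Real.smoothTransition _ _ :=
    ((Real.smoothTransition.contDiff (n := 1)).differentiable (by norm_num)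
      (2 - Real.log (1 + ‖x‖ ^ 2) * ((k : ℝ) + 1)⁻¹)).hasDerivAt
  have h4 := h3.comp_hasFDerivAt x h2
  have e : pd i (chi k) x = _ := congrArg (fun L => L (EuclideanSpace.single i 1)) h4.fderiv
  rw [e]
  simp only [FunLike.coe_smul, Pi.smul_apply, neg_apply,
    ContinuousLinearMap.comp_id, nsmul_eq_mul, smul_eq_mul, abs_mul, abs_neg]
  have hx : |x i| ≤ ‖x‖ := by simpa using PiLp.norm_apply_le x i
  have hB' := hB (2 - Real.log (1 + ‖x‖ ^ 2) * ((k : ℝ) + 1)⁻¹)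
  have hk : 0 ≤ ((k : ℝ) + 1)⁻¹ := by positivity
  have h5 : (1 + ‖x‖) * (|(1 + ‖x‖ ^ 2)⁻¹| * (2 * |x i|)) ≤ 4 := by
    rw [abs_of_pos (by positivity), mul_left_comm, inv_mul_le_iff₀ hq]
    nlinarith [norm_nonneg x, sq_nonneg (‖x‖ - 1), mul_le_mul_of_nonneg_left hx (norm_nonneg x)]
  calc _ = (|deriv Real.smoothTransition (2 - Real.log (1 + ‖x‖ ^ 2) * ((k : ℝ) + 1)⁻¹)|) *
        ((1 + ‖x‖) * (|(1 + ‖x‖ ^ 2)⁻¹| * (2 * |x i|))) * ((k : ℝ) + 1)⁻¹ := by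
          simp [abs_of_nonneg hk, EuclideanSpace.inner_single_right]; ring
    _ ≤ C * 4 * ((k : ℝ) + 1)⁻¹ := by gcongr
    _ ≤ _ := by gcongr; linarith

/-- A constant controlling the gradients of the cutoff functions. -/
def cc : ℝ := exists_chi_const.choose

lemma cc_pos : 0 < cc := exists_chi_const.choose_spec.1

lemma pd_chi_le (k : ℕ) (i : Fin 3) (x : E3) :
    (1 + ‖x‖) * |pd i (chi k) x| ≤ cc * ((k : ℝ) + 1)⁻¹ :=
  exists_chi_const.choose_spec.2 k i x

lemma abs_pd_chi_le (k : ℕ) (i : Fin 3) (x : E3) : |pd i (chi k) x| ≤ cc * ((k : ℝ) + 1)⁻¹ := by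
  refine le_trans ?_ (pd_chi_le k i x)
  nlinarith [norm_nonneg x, abs_nonneg (pd i (chi k) x)]

end Cutoff

lemma tendsto_integral_chi_mul {f : E3 → ℝ} (hf : Integrable f) :
    Filter.Tendsto (fun k => ∫ x, chi k x * f x) Filter.atTop (𝓝 (∫ x, f x)) := by
  refine tendsto_integral_of_dominated_convergence (fun x => |f x|)
    (fun k => (continuous_chi k).aestronglyMeasurable.mul hf.aestronglyMeasurable) hf.abs
    (fun k => Filter.Eventually.of_forall fun x => ?_) (Filter.Eventually.of_forall fun x => ?_)
  · rw [norm_mul, Real.norm_eq_abs, Real.norm_eq_abs, abs_of_nonneg (chi_nonneg k x)]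
    exact mul_le_of_le_one_left (abs_nonneg _) (chi_le_one k x)
  · simpa using (tendsto_chi x).mul_const (f x)

lemma integrable_mul_of_compactSupport {χ f : E3 → ℝ} (hχ : Continuous χ)
    (hc : HasCompactSupport χ) (hf : Continuous f) : Integrable fun x => χ x * f x :=
  (hχ.mul hf).integrable_of_hasCompactSupport hc.mul_right

lemma integrable_chi_mul (k : ℕ) {f : E3 → ℝ} (hf : Continuous f) :
    Integrable fun x => chi k x * f x :=
  integrable_mul_of_compactSupport (continuous_chi k) (hasCompactSupport_chi k) hf

lemma integral_chi_mul_le (k : ℕ) {f : E3 → ℝ} (hf : Integrable f) (h0 : ∀ x, 0 ≤ f x) :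
    ∫ x, chi k x * f x ≤ ∫ x, f x :=
  integral_mono_of_nonneg (Filter.Eventually.of_forall fun x => mul_nonneg (chi_nonneg k x) (h0 x))
    hf (Filter.Eventually.of_forall fun x => mul_le_of_le_one_left (h0 x) (chi_le_one k x))

section SliceIdentities

variable {χ a b f g : E3 → ℝ}

lemma continuous_lap (ha : ContDiff ℝ 2 a) : Continuous (lap a) :=
  continuous_finsetSum _ fun _ _ => continuous_pd (contDiff_one_pd ha)

lemma contDiff_cur (ha : ContDiff ℝ 2 a) (hb : ContDiff ℝ 2 b) (i : Fin 3) :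
    ContDiff ℝ 1 (cur a b i) :=
  ((ha.of_le one_le_two).mul (contDiff_one_pd hb)).sub
    ((hb.of_le one_le_two).mul (contDiff_one_pd ha))

lemma pd_cur (ha : ContDiff ℝ 2 a) (hb : ContDiff ℝ 2 b) (i : Fin 3) :
    pd i (cur a b i) = fun x => a x * pd i (pd i b) x - b x * pd i (pd i a) x := by
  have da := ha.differentiable two_ne_zero
  have db := hb.differentiable two_ne_zero
  have da' := (contDiff_one_pd (i := i) ha).differentiable one_ne_zero
  have db' := (contDiff_one_pd (i := i) hb).differentiable one_ne_zero
  unfold cur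
  rw [pd_sub (da.fun_mul db') (db.fun_mul da'), pd_mul da db', pd_mul db da']
  ext x; ring

/-- The continuity equation in weak form. -/
lemma integral_mul_curl (hχ : ContDiff ℝ 1 χ) (hc : HasCompactSupport χ)
    (ha : ContDiff ℝ 2 a) (hb : ContDiff ℝ 2 b) :
    ∫ x, χ x * (a x * lap b x - b x * lap a x) = -∫ x, ∑ i, pd i χ x * cur a b i x := by
  have h := integral_div_eq_zero (v := fun i x => χ x * cur a b i x)
    (fun i => hχ.mul (contDiff_cur ha hb i)) (fun i => hc.mul_right)
  have e : ∀ x, ∑ i, pd i (fun x => χ x * cur a b i x) x =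
      (∑ i, pd i χ x * cur a b i x) + χ x * (a x * lap b x - b x * lap a x) := by
    intro x
    simp only [lap, Finset.mul_sum, ← Finset.sum_sub_distrib, ← Finset.sum_add_distrib]
    refine Finset.sum_congr rfl fun i _ => ?_
    rw [pd_mul (hχ.differentiable one_ne_zero) ((contDiff_cur ha hb i).differentiable one_ne_zero),
      pd_cur ha hb]
  simp only [e] at h
  have c1 : Continuous fun x => a x * lap b x - b x * lap a x :=
    (ha.continuous.mul (continuous_lap hb)).sub (hb.continuous.mul (continuous_lap ha))
  rw [integral_add (integrable_finsetSum _ fun i _ => integrable_mul_of_compactSupport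
    (continuous_pd hχ) (hasCompactSupport_pd hc) (contDiff_cur ha hb i).continuous)
    (integrable_mul_of_compactSupport hχ.continuous hc c1)] at h
  linarith

/-- Green's identity with a cutoff. -/
lemma integral_mul_inner_pd (hχ : ContDiff ℝ 1 χ) (hc : HasCompactSupport χ)
    (hf : ContDiff ℝ 2 f) (hg : ContDiff ℝ 1 g) :
    ∫ x, χ x * ∑ i, pd i f x * pd i g x =
      -(∫ x, χ x * (lap f x * g x)) - ∫ x, ∑ i, pd i χ x * (pd i f x * g x) := by
  have cf : ∀ i, ContDiff ℝ 1 (pd i f) := fun i => contDiff_one_pd hf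
  have h := integral_div_eq_zero (v := fun i x => χ x * (pd i f x * g x))
    (fun i => hχ.mul ((cf i).mul hg)) (fun i => hc.mul_right)
  have e : ∀ x, ∑ i, pd i (fun x => χ x * (pd i f x * g x)) x =
      (∑ i, pd i χ x * (pd i f x * g x)) + χ x * (lap f x * g x) +
        χ x * ∑ i, pd i f x * pd i g x := by
    intro x
    simp only [lap, Finset.mul_sum, Finset.sum_mul, ← Finset.sum_add_distrib]
    refine Finset.sum_congr rfl fun i _ => ?_
    rw [pd_mul (hχ.differentiable one_ne_zero)
      (((cf i).mul hg).differentiable one_ne_zero), pd_mul ((cf i).differentiable one_ne_zero)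
      (hg.differentiable one_ne_zero)]
    ring
  simp only [e] at h
  have i1 : Integrable fun x => ∑ i, pd i χ x * (pd i f x * g x) :=
    integrable_finsetSum _ fun i _ => integrable_mul_of_compactSupport
      (continuous_pd hχ) (hasCompactSupport_pd hc) ((cf i).continuous.mul hg.continuous)
  have i2 : Integrable fun x => χ x * (lap f x * g x) :=
    integrable_mul_of_compactSupport hχ.continuous hc ((continuous_lap hf).mul hg.continuous)
  have i3 : Integrable fun x => χ x * ∑ i, pd i f x * pd i g x :=
    integrable_mul_of_compactSupport hχ.continuous hc
      (continuous_finsetSum _ fun i _ => (cf i).continuous.mul (continuous_pd hg))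
  rw [integral_add (i1.fun_add i2) i3, integral_add i1 i2] at h
  linarith

end SliceIdentities

lemma abs_sub_le_of_abs_deriv_le {f f' B B' : ℝ → ℝ} {s t : ℝ} (hst : s ≤ t)
    (hf : ∀ τ ∈ Icc s t, HasDerivAt f (f' τ) τ) (hB : ∀ τ ∈ Icc s t, HasDerivAt B (B' τ) τ)
    (h : ∀ τ ∈ Icc s t, |f' τ| ≤ B' τ) : |f t - f s| ≤ B t - B s := by
  have := image_norm_le_of_norm_deriv_right_le_deriv_boundary' (f := fun τ => f τ - f s)
    (f' := f') (a := s) (b := t) (B := fun τ => B τ - B s) (B' := B')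
    (fun τ hτ => ((hf τ hτ).sub_const _).continuousAt.continuousWithinAt)
    (fun τ hτ => ((hf τ (Ico_subset_Icc_self hτ)).sub_const _).hasDerivWithinAt) (by simp)
    (fun τ hτ => ((hB τ hτ).sub_const _).continuousAt.continuousWithinAt)
    (fun τ hτ => ((hB τ (Ico_subset_Icc_self hτ)).sub_const _).hasDerivWithinAt)
    (fun τ hτ => h τ (Ico_subset_Icc_self hτ))
  exact this ⟨hst, le_rfl⟩

lemma sum_abs_cur_le (a b : E3 → ℝ) (x : E3) :
    ∑ i, |cur a b i x| ≤ 3 * den a b x + gsq a b x := by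
  have : ∀ i, |cur a b i x| ≤ den a b x + (pd i a x ^ 2 + pd i b x ^ 2) := by
    intro i
    unfold cur den
    rw [abs_le]
    constructor <;> nlinarith [sq_nonneg (a x + pd i b x), sq_nonneg (a x - pd i b x),
      sq_nonneg (b x + pd i a x), sq_nonneg (b x - pd i a x)]
  refine (Finset.sum_le_sum fun i _ => this i).trans ?_
  rw [Finset.sum_add_distrib]
  simp [gsq]

lemma abs_integral_pd_chi_cur_le (k : ℕ) {a b : E3 → ℝ} (ha : Nice a) (hb : Nice b) {Q : ℝ}
    (h1 : ∫ x, den a b x ≤ Q) (h2 : ∫ x, gsq a b x ≤ Q) :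
    |∫ x, ∑ i, pd i (chi k) x * cur a b i x| ≤ 4 * Q * (cc * ((k : ℝ) + 1)⁻¹) := by
  have hi : Integrable fun x => cc * ((k : ℝ) + 1)⁻¹ * (3 * den a b x + gsq a b x) :=
    ((((ha.rd_den hb).const_mul 3).add (ha.rd_gsq hb)).const_mul _).integrable
  have hcc : 0 ≤ cc * ((k : ℝ) + 1)⁻¹ := mul_nonneg cc_pos.le (by positivity)
  rw [← Real.norm_eq_abs]
  refine (norm_integral_le_of_norm_le hi (Filter.Eventually.of_forall fun x => ?_)).trans ?_
  · rw [Real.norm_eq_abs]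
    refine (Finset.abs_sum_le_sum_abs _ _).trans ?_
    refine le_trans ?_ (mul_le_mul_of_nonneg_left (sum_abs_cur_le a b x) hcc)
    rw [Finset.mul_sum]
    refine Finset.sum_le_sum fun i _ => ?_
    rw [abs_mul]
    exact mul_le_mul_of_nonneg_right (abs_pd_chi_le k i x) (abs_nonneg _)
  · rw [integral_const_mul, integral_add ((ha.rd_den hb).const_mul 3).integrable
      (ha.rd_gsq hb).integrable, integral_const_mul]
    nlinarith

lemma Joint.den {a b : ℝ → E3 → ℝ} {n : ℕ} (ha : Joint n a) (hb : Joint n b) :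
    Joint n fun t => den (a t) (b t) := ha.sq.add hb.sq

lemma Joint.dt_den {a b : ℝ → E3 → ℝ} (ha : Joint 1 a) (hb : Joint 1 b) (t : ℝ) (x : E3) :
    SchrodingerPoisson.dt (fun t => SchrodingerPoisson.den (a t) (b t)) t x =
      2 * (a t x * SchrodingerPoisson.dt a t x + b t x * SchrodingerPoisson.dt b t x) := by
  have := ((ha.hasDerivAt (n := 0) t x).pow 2).add ((hb.hasDerivAt (n := 0) t x).pow 2)
  refine this.deriv.trans ?_
  simp; ring

/-- Growth of the `L²` norm of a forced Schrödinger flow. -/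
lemma abs_sqrt_mass_sub_le {a b : ℝ → E3 → ℝ} (ja : Joint 2 a) (jb : Joint 2 b)
    (ha : ∀ t, Nice (a t)) (hb : ∀ t, Nice (b t)) {s t Q : ℝ} (hst : s ≤ t)
    (hM : ∀ τ ∈ Icc s t, ∫ x, den (a τ) (b τ) x ≤ Q)
    (hK : ∀ τ ∈ Icc s t, ∫ x, gsq (a τ) (b τ) x ≤ Q)
    {G : ℝ → E3 → ℝ}
    (heq : ∀ τ ∈ Icc s t, ∀ x, 2 * (a τ x * dt a τ x + b τ x * dt b τ x) =
      -(a τ x * lap (b τ) x - b τ x * lap (a τ) x) + G τ x)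
    {B β : ℝ → ℝ} (hB : ∀ τ ∈ Icc s t, HasDerivAt B (β τ) τ)
    (hβ : ∀ τ ∈ Icc s t, 0 ≤ β τ)
    (hG : ∀ τ ∈ Icc s t, ∀ k, |∫ x, chi k x * G τ x| ≤
      2 * β τ * √(∫ x, chi k x * den (a τ) (b τ) x)) :
    |√(∫ x, den (a t) (b t) x) - √(∫ x, den (a s) (b s) x)| ≤ B t - B s := by
  have jd : Joint 1 fun t => den (a t) (b t) := (ja.den jb).of_le one_le_two
  have m0 : ∀ k τ, 0 ≤ ∫ x, chi k x * den (a τ) (b τ) x := fun k τ =>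
    integral_nonneg fun x => mul_nonneg (chi_nonneg k x) (den_nonneg _ _ _)
  have step : ∀ (ε : ℝ), 0 < ε → ∀ k : ℕ,
      |√((∫ x, chi k x * den (a t) (b t) x) + ε ^ 2) -
        √((∫ x, chi k x * den (a s) (b s) x) + ε ^ 2)| ≤
      (B t + 4 * Q * (cc * ((k : ℝ) + 1)⁻¹) / (2 * ε) * t) -
        (B s + 4 * Q * (cc * ((k : ℝ) + 1)⁻¹) / (2 * ε) * s) := by
    intro ε hε k
    set δ := 4 * Q * (cc * ((k : ℝ) + 1)⁻¹) with hδ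
    refine abs_sub_le_of_abs_deriv_le
      (f := fun τ => √((∫ x, chi k x * den (a τ) (b τ) x) + ε ^ 2))
      (B := fun τ => B τ + δ / (2 * ε) * τ) (B' := fun τ => β τ + δ / (2 * ε)) hst
      (fun τ _ => ((jd.hasDerivAt_integral (continuous_chi k) (hasCompactSupport_chi k) τ).add_const
        (ε ^ 2)).sqrt (by have := m0 k τ; positivity))
      (fun τ hτ => by simpa using (hB τ hτ).fun_add ((hasDerivAt_id τ).const_mul (δ / (2 * ε)))) ?_
    intro τ hτ
    have cG : Continuous (G τ) := by
      have : G τ = fun x => dt (fun t => den (a t) (b t)) τ x +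
          (a τ x * lap (b τ) x - b τ x * lap (a τ) x) := by
        ext x
        rw [Joint.dt_den (ja.of_le one_le_two) (jb.of_le one_le_two), heq τ hτ x]; ring
      rw [this]
      exact ((jd.dt (n := 0)).slice τ).continuous.add
        (((ja.slice τ).continuous.mul (continuous_lap (hb τ).smooth)).sub
        ((jb.slice τ).continuous.mul (continuous_lap (ha τ).smooth)))
    have c1 : Continuous fun x => a τ x * lap (b τ) x - b τ x * lap (a τ) x :=
      ((ja.slice τ).continuous.mul (continuous_lap (hb τ).smooth)).sub
        ((jb.slice τ).continuous.mul (continuous_lap (ha τ).smooth))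
    have e : ∫ x, chi k x * dt (fun t => den (a t) (b t)) τ x =
        (∫ x, ∑ i, pd i (chi k) x * cur (a τ) (b τ) i x) + ∫ x, chi k x * G τ x := by
      have e1 := integral_mul_curl (contDiff_chi k) (hasCompactSupport_chi k)
        (ha τ).smooth (hb τ).smooth
      rw [← neg_eq_iff_eq_neg] at e1
      rw [← e1, ← integral_neg, ← integral_add (integrable_chi_mul k c1).fun_neg
        (integrable_chi_mul k cG)]
      refine integral_congr_ae (Filter.Eventually.of_forall fun x => ?_)
      beta_reduce
      rw [Joint.dt_den (ja.of_le one_le_two) (jb.of_le one_le_two), heq τ hτ x]; ring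
    have h1 := abs_integral_pd_chi_cur_le k (ha τ) (hb τ) (hM τ hτ) (hK τ hτ)
    have h2 := hG τ hτ k
    set m := ∫ x, chi k x * den (a τ) (b τ) x with hm
    have hm0 : 0 ≤ m := m0 k τ
    have hp : 0 < m + ε ^ 2 := by positivity
    have hs : 0 < √(m + ε ^ 2) := Real.sqrt_pos.2 hp
    have hs1 : ε ≤ √(m + ε ^ 2) := Real.le_sqrt_of_sq_le (by linarith)
    have hs2 : √m ≤ √(m + ε ^ 2) := Real.sqrt_le_sqrt (by nlinarith)
    have hδ0 : 0 ≤ δ := (abs_nonneg _).trans h1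
    rw [abs_div, abs_of_pos (show 0 < 2 * √(m + ε ^ 2) by positivity), div_le_iff₀ (by positivity),
      e]
    refine (abs_add_le _ _).trans ?_
    have h3 : δ ≤ δ / (2 * ε) * (2 * √(m + ε ^ 2)) := by
      rw [div_mul_eq_mul_div, le_div_iff₀ (by positivity)]
      nlinarith
    have hβm : 2 * β τ * √m ≤ β τ * (2 * √(m + ε ^ 2)) := by
      nlinarith [hβ τ hτ]
    nlinarith
  have lim1 : ∀ ε : ℝ, 0 < ε → |√((∫ x, den (a t) (b t) x) + ε ^ 2) -
        √((∫ x, den (a s) (b s) x) + ε ^ 2)| ≤ B t - B s := by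
    intro ε hε
    have T : ∀ τ, Filter.Tendsto (fun k => √((∫ x, chi k x * den (a τ) (b τ) x) + ε ^ 2))
        Filter.atTop (𝓝 √((∫ x, den (a τ) (b τ) x) + ε ^ 2)) := fun τ =>
      (Real.continuous_sqrt.tendsto _).comp
        ((tendsto_integral_chi_mul ((ha τ).rd_den (hb τ)).integrable).add_const _)
    have T2 : ∀ r, Filter.Tendsto (fun k : ℕ => 4 * Q * (cc * ((k : ℝ) + 1)⁻¹) / (2 * ε) * r)
        Filter.atTop (𝓝 0) := fun r => by
      simpa using ((((tendsto_inv_nat.const_mul cc).const_mul (4 * Q)).div_const (2 * ε)).mul_const r)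
    have := le_of_tendsto_of_tendsto' ((T t).sub (T s)).abs
      (((T2 t).const_add (B t)).sub ((T2 s).const_add (B s))) (step ε hε)
    simpa using this
  have T : ∀ τ, Filter.Tendsto (fun j : ℕ => √((∫ x, den (a τ) (b τ) x) + ((j : ℝ) + 1)⁻¹ ^ 2))
      Filter.atTop (𝓝 √(∫ x, den (a τ) (b τ) x)) := fun τ =>
    (Real.continuous_sqrt.tendsto _).comp (by
      simpa using (tendsto_inv_nat.pow 2).const_add (∫ x, den (a τ) (b τ) x))
  exact le_of_tendsto' ((T t).sub (T s)).abs fun j => lim1 _ (by positivity)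

/-- A Schrödinger–Poisson flow `ψ = a + ib`, written in real and imaginary parts. -/
structure Flow (a b : ℝ → E3 → ℝ) : Prop where
  ja : Joint 2 a
  jb : Joint 2 b
  na : ∀ t, Nice (a t)
  nb : ∀ t, Nice (b t)
  eqa : ∀ t, 0 ≤ t → ∀ x, dt a t x = -(1 / 2) * lap (b t) x + pot (a t) (b t) x * b t x
  eqb : ∀ t, 0 ≤ t → ∀ x, dt b t x = 1 / 2 * lap (a t) x - pot (a t) (b t) x * a t x

lemma integrable_kernel {k : E3 × E3 → ℝ} (mk : Measurable k) (k0 : ∀ z, 0 ≤ k z) {p q : E3 → ℝ}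
    (mp : Continuous p) (p0 : ∀ x, 0 ≤ p x) (mq : Continuous q) (q0 : ∀ x, 0 ≤ q x)
    (hq : Integrable q) {S : ℝ} (hi : ∀ y, Integrable fun x => k (x, y) * p x)
    (hS : ∀ y, ∫ x, k (x, y) * p x ≤ S) :
    Integrable (fun z : E3 × E3 => k z * p z.1 * q z.2) (volume.prod volume) ∧
      ∫ z : E3 × E3, k z * p z.1 * q z.2 ∂(volume.prod volume) ≤ S * ∫ y, q y := by
  have m : AEStronglyMeasurable (fun z : E3 × E3 => k z * p z.1 * q z.2) (volume.prod volume) := by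
    have := mp.measurable
    have := mq.measurable
    exact (by fun_prop : Measurable fun z : E3 × E3 => k z * p z.1 * q z.2).aestronglyMeasurable
  have hi2 : Integrable (fun z : E3 × E3 => k z * p z.1 * q z.2) (volume.prod volume) := by
    rw [integrable_prod_iff' m]
    refine ⟨Filter.Eventually.of_forall fun y => (hi y).mul_const (q y), ?_⟩
    refine (hq.const_mul S).mono' m.norm.prod_swap.integral_prod_right'
      (Filter.Eventually.of_forall fun y => ?_)
    simp only [norm_mul, Real.norm_eq_abs, abs_of_nonneg (k0 _), abs_of_nonneg (p0 _),
      abs_of_nonneg (q0 _)]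
    rw [integral_mul_const, abs_of_nonneg
      (mul_nonneg (integral_nonneg fun x => mul_nonneg (k0 _) (p0 _)) (q0 _))]
    exact mul_le_mul_of_nonneg_right (hS y) (q0 y)
  refine ⟨hi2, ?_⟩
  rw [integral_prod_symm _ hi2, ← integral_const_mul]
  refine integral_mono hi2.integral_prod_right (hq.const_mul S) fun y => ?_
  dsimp only
  rw [integral_mul_const]
  exact mul_le_mul_of_nonneg_right (hS y) (q0 y)

lemma abs_sum_mul_le (u v : Fin 3 → ℝ) : |∑ i, u i * v i| ≤ √(∑ i, u i ^ 2) * √(∑ i, v i ^ 2) := by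
  rw [← Real.sqrt_mul (Finset.sum_nonneg fun i _ => sq_nonneg _)]
  exact Real.abs_le_sqrt (Finset.sum_mul_sq_le_sq_mul_sq _ _ _)

lemma abs_sum_mul_cur_le (v : Fin 3 → ℝ) (a b : E3 → ℝ) (x : E3) :
    |∑ i, v i * cur a b i x| ≤ √(∑ i, v i ^ 2) * (√(den a b x) * √(gsq a b x)) := by
  refine (abs_sum_mul_le _ _).trans ?_
  gcongr
  rw [← Real.sqrt_mul (den_nonneg _ _ _)]
  refine Real.sqrt_le_sqrt ?_
  rw [gsq, Finset.mul_sum]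
  refine Finset.sum_le_sum fun i _ => ?_
  unfold cur den
  nlinarith [sq_nonneg (a x * pd i a x + b x * pd i b x)]

lemma sqrt_sum_kap_le {ε : ℝ} (hε : 0 < ε) {x y : E3} (h : x ≠ y) :
    √(∑ i, (-(y i - x i) * kap ε x y ^ 3) ^ 2) ≤ (‖x - y‖ ^ 2)⁻¹ := by
  have h1 := kap_sq_mul hε y x
  have h2 := kap_le_inv hε y x h.symm
  have h3 := kap_pos hε y x
  have e : ∑ i, (-(y i - x i) * kap ε x y ^ 3) ^ 2 ≤ (kap ε x y ^ 2) ^ 2 := by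
    simp only [mul_pow, neg_sq]
    rw [← Finset.sum_mul]
    have : (∑ i, (y i - x i) ^ 2) * (kap ε x y ^ 3) ^ 2 =
        (kap ε x y ^ 2 * ∑ i, (y i - x i) ^ 2) * kap ε x y ^ 4 := by ring
    rw [this, h1]
    nlinarith [mul_nonneg hε.le (sq_nonneg (kap ε x y)), sq_nonneg (kap ε x y ^ 2),
      mul_nonneg (mul_nonneg hε.le (sq_nonneg (kap ε x y))) (sq_nonneg (kap ε x y ^ 2))]
  refine (Real.sqrt_le_sqrt e).trans ?_
  rw [Real.sqrt_sq (by positivity), ← inv_pow, norm_sub_rev]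
  exact pow_le_pow_left₀ h3.le h2 2

lemma continuous_kap₂ {ε : ℝ} (hε : 0 < ε) : Continuous fun z : E3 × E3 => kap ε z.2 z.1 := by
  unfold kap
  refine Continuous.inv₀ (by fun_prop) fun z => ?_
  positivity

lemma Flow.dt_den {a b : ℝ → E3 → ℝ} (F : Flow a b) {t : ℝ} (ht : 0 ≤ t) (x : E3) :
    dt (fun t => den (a t) (b t)) t x = -(a t x * lap (b t) x - b t x * lap (a t) x) := by
  rw [Joint.dt_den (F.ja.of_le one_le_two) (F.jb.of_le one_le_two), F.eqa t ht, F.eqb t ht]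
  ring

section Potential

variable {a b : ℝ → E3 → ℝ} (F : Flow a b) {a' b' : E3 → ℝ} (ha' : Nice a') (hb' : Nice b')
  {s t S κ Q : ℝ} (hS : 0 ≤ S) (hκ : 0 ≤ κ)
  {g h : E3 → ℝ} (cg : Continuous g) (sg : HasCompactSupport g) (ch : Continuous h)
  (ih : Integrable fun x => h x ^ 2) (h0 : ∀ x, 0 ≤ h x)
  (hgh : ∀ x, |g x| ≤ h x * √(den a' b' x))

include F ha' hb' cg sg ch ih h0 hgh hκ

lemma deriv_regularised_potential_le {τ : ℝ} (hτ : 0 ≤ τ)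
    (hH : ∀ y, ∫ x, (‖x - y‖ ^ 2)⁻¹ * den (a τ) (b τ) x ≤ S ^ 2)
    (hH' : ∀ y, ∫ x, (‖x - y‖ ^ 2)⁻¹ * den a' b' x ≤ S ^ 2)
    (hK : ∫ x, gsq (a τ) (b τ) x ≤ κ ^ 2) (hM : ∫ x, den (a τ) (b τ) x ≤ Q)
    (hKQ : ∫ x, gsq (a τ) (b τ) x ≤ Q)
    {ε : ℝ} (hε : 0 < ε) (k : ℕ) :
    |∫ y, (chi k y * ∫ x, g x * kap ε y x) * dt (fun t => den (a t) (b t)) τ y| ≤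
      (∫ x, |g x|) * ((√ε)⁻¹ * (4 * Q * (cc * ((k : ℝ) + 1)⁻¹))) + √(∫ x, h x ^ 2) * S ^ 2 * κ := by
  have na := F.na τ
  have nb := F.nb τ
  have jd : Joint 1 fun t => den (a t) (b t) := (F.ja.den F.jb).of_le one_le_two
  have cdt : Continuous (dt (fun t => den (a t) (b t)) τ) := ((jd.dt (n := 0)).slice τ).continuous
  have cd := (na.rd_den nb).cont
  have cs := (na.rd_gsq nb).cont
  have cd' := (ha'.rd_den hb').cont
  have ig : Integrable g := cg.integrable_of_hasCompactSupport sg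
  -- Fubini
  have ip : Integrable (fun z : E3 × E3 => kap ε z.2 z.1 *
      (g z.1 * (chi k z.2 * dt (fun t => den (a t) (b t)) τ z.2))) (volume.prod volume) := by
    refine (ig.mul_prod (integrable_chi_mul k cdt)).bdd_mul (c := (√ε)⁻¹)
      (continuous_kap₂ hε).aestronglyMeasurable (Filter.Eventually.of_forall fun z => ?_)
    rw [Real.norm_eq_abs, abs_of_pos (kap_pos hε _ _)]
    exact kap_le hε _ _
  have e1 : ∫ y, (chi k y * ∫ x, g x * kap ε y x) * dt (fun t => den (a t) (b t)) τ y =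
      ∫ x, g x * ∫ y, (chi k y * kap ε x y) * dt (fun t => den (a t) (b t)) τ y := by
    calc _ = ∫ y, ∫ x, kap ε y x * (g x * (chi k y * dt (fun t => den (a t) (b t)) τ y)) := by
          congr 1; ext y
          rw [mul_right_comm, ← integral_const_mul]
          congr 1; ext x; ring
      _ = ∫ x, ∫ y, kap ε y x * (g x * (chi k y * dt (fun t => den (a t) (b t)) τ y)) :=
          (integral_prod_symm _ ip).symm.trans (integral_prod _ ip)
      _ = _ := by
          congr 1; ext x
          rw [← integral_const_mul]
          congr 1; ext y; rw [kap_comm]; ring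
  -- the dominating function
  set Fd : E3 × E3 → ℝ := fun z => √((‖z.1 - z.2‖ ^ 2)⁻¹ * h z.1 ^ 2 * den (a τ) (b τ) z.2) *
    √((‖z.1 - z.2‖ ^ 2)⁻¹ * den a' b' z.1 * gsq (a τ) (b τ) z.2) with hFd
  have mk : Measurable fun z : E3 × E3 => (‖z.1 - z.2‖ ^ 2)⁻¹ := by fun_prop
  have I1 := integrable_kernel (k := fun z => (‖z.1 - z.2‖ ^ 2)⁻¹) (q := fun x => h x ^ 2) mk
    (fun z => by positivity) cd (den_nonneg _ _) (ch.pow 2) (fun x => sq_nonneg _)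
    ih (fun y => (na.hardy nb 0 y).1) hH
  have I1' : Integrable (fun z : E3 × E3 => (‖z.1 - z.2‖ ^ 2)⁻¹ * h z.1 ^ 2 *
      den (a τ) (b τ) z.2) (volume.prod volume) := by
    refine I1.1.swap.congr (Filter.Eventually.of_forall fun z => ?_)
    simp only [Function.comp, Prod.fst_swap, Prod.snd_swap, norm_sub_rev z.2]; ring
  have I1'' : ∫ z : E3 × E3, (‖z.1 - z.2‖ ^ 2)⁻¹ * h z.1 ^ 2 *
      den (a τ) (b τ) z.2 ∂(volume.prod volume) ≤ S ^ 2 * ∫ x, h x ^ 2 := by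
    refine le_trans (le_of_eq ?_) I1.2
    rw [← integral_prod_swap]
    congr 1; ext z
    simp only [Prod.fst_swap, Prod.snd_swap, norm_sub_rev z.2]; ring
  have I2 := integrable_kernel (k := fun z => (‖z.1 - z.2‖ ^ 2)⁻¹) mk
    (fun z => by positivity) cd' (den_nonneg _ _) cs (gsq_nonneg _ _)
    (na.rd_gsq nb).integrable (fun y => (ha'.hardy hb' 0 y).1) hH'
  have mFd : AEStronglyMeasurable Fd (volume.prod volume) :=
    (Real.continuous_sqrt.comp_aestronglyMeasurable I1'.aestronglyMeasurable).mul
      (Real.continuous_sqrt.comp_aestronglyMeasurable I2.1.aestronglyMeasurable)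
  have Fd0 : ∀ z, 0 ≤ Fd z := fun z => mul_nonneg (Real.sqrt_nonneg _) (Real.sqrt_nonneg _)
  obtain ⟨iFd, bFd⟩ := integral_le_sqrt_mul_sqrt I1' I2.1 mFd
    (fun z => mul_nonneg (mul_nonneg (by positivity) (sq_nonneg _)) (den_nonneg _ _ _))
    (fun z => mul_nonneg (mul_nonneg (by positivity) (den_nonneg _ _ _)) (gsq_nonneg _ _ _))
    (fun z => (abs_of_nonneg (Fd0 z)).le)
  have bFd' : ∫ z, Fd z ∂(volume.prod volume) ≤ √(∫ x, h x ^ 2) * S ^ 2 * κ := by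
    refine ((le_abs_self _).trans bFd).trans ?_
    calc _ ≤ √(S ^ 2 * ∫ x, h x ^ 2) * √(S ^ 2 * κ ^ 2) := by
          gcongr
          exact I2.2.trans (mul_le_mul_of_nonneg_left hK (sq_nonneg _))
      _ = _ := by
          rw [Real.sqrt_mul (sq_nonneg _), Real.sqrt_mul (sq_nonneg _), Real.sqrt_sq hκ,
            Real.sqrt_sq_eq_abs]
          rw [← sq_abs S]; ring
  -- pointwise bound of the inner integral
  have inner : ∀ᵐ x : E3, ‖g x * ∫ y, (chi k y * kap ε x y) * dt (fun t => den (a t) (b t)) τ y‖ ≤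
      |g x| * ((√ε)⁻¹ * (4 * Q * (cc * ((k : ℝ) + 1)⁻¹))) + ∫ y, Fd (x, y) := by
    filter_upwards [iFd.prod_right_ae] with x hx
    have cκ : ContDiff ℝ 1 (kap ε x) := contDiff_kap hε x
    have dκ := cκ.differentiable one_ne_zero
    have dχ : Differentiable ℝ (chi k) := (contDiff_chi k (n := 1)).differentiable (by norm_num)
    have e2 : ∫ y, (chi k y * kap ε x y) * dt (fun t => den (a t) (b t)) τ y =
        ∫ y, ∑ i, pd i (fun y => chi k y * kap ε x y) y * cur (a τ) (b τ) i y := by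
      have := integral_mul_curl (χ := fun y => chi k y * kap ε x y)
        ((contDiff_chi k).mul cκ) (hasCompactSupport_chi k).mul_right na.smooth nb.smooth
      rw [← neg_eq_iff_eq_neg] at this
      rw [← this, ← integral_neg]
      congr 1; ext y
      rw [F.dt_den hτ]; ring
    have ik : Integrable fun y => (√ε)⁻¹ * (cc * ((k : ℝ) + 1)⁻¹ *
        (3 * den (a τ) (b τ) y + gsq (a τ) (b τ) y)) :=
      (((((na.rd_den nb).const_mul 3).add (na.rd_gsq nb)).const_mul _).const_mul _).integrable
    rw [e2, ← integral_const_mul]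
    have ibd : Integrable fun y => |g x| * ((√ε)⁻¹ * (cc * ((k : ℝ) + 1)⁻¹ *
        (3 * den (a τ) (b τ) y + gsq (a τ) (b τ) y))) + Fd (x, y) := (ik.const_mul _).add hx
    have hcc : 0 ≤ cc * ((k : ℝ) + 1)⁻¹ := mul_nonneg cc_pos.le (by positivity)
    refine (norm_integral_le_of_norm_le ibd ?_).trans ?_
    · filter_upwards [ae_ne x] with y hy
      have e3 : ∑ i, pd i (fun y => chi k y * kap ε x y) y * cur (a τ) (b τ) i y =
          (∑ i, (kap ε x y * pd i (chi k) y) * cur (a τ) (b τ) i y) +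
          chi k y * ∑ i, (-(y i - x i) * kap ε x y ^ 3) * cur (a τ) (b τ) i y := by
        rw [Finset.mul_sum, ← Finset.sum_add_distrib]
        refine Finset.sum_congr rfl fun i _ => ?_
        rw [pd_mul dχ dκ, pd_kap hε]; ring
      rw [e3, norm_mul, Real.norm_eq_abs]
      have b1 : |∑ i, (kap ε x y * pd i (chi k) y) * cur (a τ) (b τ) i y| ≤
          (√ε)⁻¹ * (cc * ((k : ℝ) + 1)⁻¹ * (3 * den (a τ) (b τ) y + gsq (a τ) (b τ) y)) := by
        refine (Finset.abs_sum_le_sum_abs _ _).trans ?_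
        have : ∀ i, |kap ε x y * pd i (chi k) y * cur (a τ) (b τ) i y| ≤
            (√ε)⁻¹ * (cc * ((k : ℝ) + 1)⁻¹ * |cur (a τ) (b τ) i y|) := by
          intro i
          rw [abs_mul, abs_mul, abs_of_pos (kap_pos hε _ _), mul_assoc]
          have := kap_le hε y x
          have := abs_pd_chi_le k i y
          have := (kap_pos hε y x).le
          have : (0 : ℝ) ≤ (√ε)⁻¹ := by positivity
          rw [kap_comm] at *
          gcongr
        refine (Finset.sum_le_sum fun i _ => this i).trans ?_
        rw [← Finset.mul_sum, ← Finset.mul_sum]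
        have := sum_abs_cur_le (a τ) (b τ) y
        gcongr
      have b2 : |g x| * |chi k y * ∑ i, (-(y i - x i) * kap ε x y ^ 3) * cur (a τ) (b τ) i y| ≤
          Fd (x, y) := by
        rw [abs_mul, abs_of_nonneg (chi_nonneg k y)]
        have c1 := abs_sum_mul_cur_le (fun i => -(y i - x i) * kap ε x y ^ 3) (a τ) (b τ) y
        have c2 := sqrt_sum_kap_le hε hy.symm
        have c3 : |∑ i, (-(y i - x i) * kap ε x y ^ 3) * cur (a τ) (b τ) i y| ≤
            (‖x - y‖ ^ 2)⁻¹ * (√(den (a τ) (b τ) y) * √(gsq (a τ) (b τ) y)) :=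
          c1.trans (mul_le_mul_of_nonneg_right c2 (by positivity))
        have e4 : Fd (x, y) = (h x * √(den a' b' x)) * (1 * ((‖x - y‖ ^ 2)⁻¹ *
            (√(den (a τ) (b τ) y) * √(gsq (a τ) (b τ) y)))) := by
          simp only [hFd]
          have hr : 0 ≤ (‖x - y‖ ^ 2)⁻¹ := by positivity
          rw [Real.sqrt_mul (mul_nonneg hr (sq_nonneg _)), Real.sqrt_mul hr, Real.sqrt_sq (h0 x),
            Real.sqrt_mul (mul_nonneg hr (den_nonneg _ _ _)), Real.sqrt_mul hr]
          linear_combination (h x * √(den a' b' x) * √(den (a τ) (b τ) y) * √(gsq (a τ) (b τ) y)) *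
            Real.mul_self_sqrt hr
        rw [e4]
        have := chi_le_one k y
        have := hgh x
        have := h0 x
        have := chi_nonneg k y
        gcongr
      calc |g x| * |_ + _| ≤ |g x| * (_ + _) :=
            mul_le_mul_of_nonneg_left (abs_add_le _ _) (abs_nonneg _)
        _ ≤ _ := by rw [mul_add]; exact add_le_add (mul_le_mul_of_nonneg_left b1 (abs_nonneg _)) b2
    · rw [integral_add (ik.const_mul _) hx]
      refine add_le_add_left ?_ _
      rw [integral_const_mul, integral_const_mul, integral_const_mul,
        integral_add ((na.rd_den nb).const_mul 3).integrable (na.rd_gsq nb).integrable,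
        integral_const_mul]
      refine mul_le_mul_of_nonneg_left (mul_le_mul_of_nonneg_left ?_ (by positivity)) (abs_nonneg _)
      nlinarith
  rw [e1, ← Real.norm_eq_abs]
  refine (norm_integral_le_of_norm_le ((ig.abs.mul_const _).add iFd.integral_prod_left) inner).trans ?_
  rw [integral_add' (ig.abs.mul_const _) iFd.integral_prod_left, integral_mul_const,
    ← integral_prod _ iFd]
  exact add_le_add_right bFd' _

end Potential

lemma kap_mul_den_le (a b : E3 → ℝ) {ε : ℝ} (hε : 0 < ε) (x : E3) :
    ∀ᵐ y : E3, ‖kap ε x y * den a b y‖ ≤ ‖x - y‖⁻¹ * den a b y := by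
  filter_upwards [ae_ne x] with y hy
  rw [norm_mul, Real.norm_eq_abs, Real.norm_eq_abs, abs_of_pos (kap_pos hε _ _),
    abs_of_nonneg (den_nonneg _ _ _)]
  exact mul_le_mul_of_nonneg_right (kap_comm ε x y ▸ kap_le_inv hε x y hy.symm) (den_nonneg _ _ _)

lemma continuous_integral_kap_mul {ε : ℝ} (hε : 0 < ε) {g : E3 → ℝ} (hg : Integrable g) :
    Continuous fun y => ∫ x, g x * kap ε y x := by
  refine continuous_of_dominated (bound := fun x => |g x| * (√ε)⁻¹)
    (fun y => hg.aestronglyMeasurable.mul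
      (differentiable_kap hε y).continuous.aestronglyMeasurable)
    (fun y => Filter.Eventually.of_forall fun x => ?_) (hg.abs.mul_const _)
    (Filter.Eventually.of_forall fun x => ?_)
  · rw [norm_mul, Real.norm_eq_abs, Real.norm_eq_abs, abs_of_pos (kap_pos hε _ _)]
    exact mul_le_mul_of_nonneg_left (kap_le hε _ _) (abs_nonneg _)
  · simp only [kap_comm]
    exact continuous_const.mul (differentiable_kap hε x).continuous

section Regularised

variable {a b : E3 → ℝ} (ha : Nice a) (hb : Nice b)
include ha hb

lemma measurable_kap_mul_den {ε : ℝ} (hε : 0 < ε) (x : E3) :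
    AEStronglyMeasurable fun y => kap ε x y * den a b y :=
  ((differentiable_kap hε x).continuous.mul (ha.continuous_den hb)).aestronglyMeasurable

lemma integrable_kap_mul_den {ε : ℝ} (hε : 0 < ε) (x : E3) :
    Integrable fun y => kap ε x y * den a b y :=
  (ha.integrable_inv_mul_den hb x).mono' (measurable_kap_mul_den ha hb hε x)
    (kap_mul_den_le a b hε x)

lemma abs_integral_kap_mul_den_le {ε : ℝ} (hε : 0 < ε) (x : E3) :
    |∫ y, kap ε x y * den a b y| ≤ (∫ y, den a b y) + 4 * ∫ y, gsq a b y :=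
  (norm_integral_le_of_norm_le (ha.integrable_inv_mul_den hb x)
    (kap_mul_den_le a b hε x)).trans (ha.integral_inv_mul_den_le hb x)

lemma tendsto_integral_kap_mul_den (x : E3) :
    Filter.Tendsto (fun m => ∫ y, kap (eps m) x y * den a b y) Filter.atTop
      (𝓝 (4 * π * pot a b x)) := by
  have e : 4 * π * pot a b x = ∫ y, ‖x - y‖⁻¹ * den a b y := by
    unfold pot; field_simp
  rw [e]
  refine tendsto_integral_of_dominated_convergence _
    (fun m => measurable_kap_mul_den ha hb (eps_pos m) x) (ha.integrable_inv_mul_den hb x)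
    (fun m => kap_mul_den_le a b (eps_pos m) x) ?_
  filter_upwards [ae_ne x] with y hy
  have := tendsto_kap tendsto_eps hy
  rw [norm_sub_rev] at this
  exact this.mul_const _

lemma tendsto_integral_mul_kap {φ : E3 → ℝ} (hφ : Integrable φ) :
    Filter.Tendsto (fun m => ∫ x, φ x * ∫ y, kap (eps m) x y * den a b y) Filter.atTop
      (𝓝 (4 * π * ∫ x, φ x * pot a b x)) := by
  have e : 4 * π * ∫ x, φ x * pot a b x = ∫ x, φ x * (4 * π * pot a b x) := by
    rw [← integral_const_mul]; congr 1; ext x; ring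
  rw [e]
  refine tendsto_integral_of_dominated_convergence
    (fun x => |φ x| * ((∫ y, den a b y) + 4 * ∫ y, gsq a b y)) (fun m => ?_)
    (hφ.abs.mul_const _) (fun m => Filter.Eventually.of_forall fun x => ?_)
    (Filter.Eventually.of_forall fun x => (tendsto_integral_kap_mul_den ha hb x).const_mul _)
  · refine hφ.aestronglyMeasurable.mul ?_
    have := continuous_integral_kap_mul (eps_pos m) (ha.rd_den hb).integrable
    simp only [mul_comm (kap _ _ _)]
    exact this.aestronglyMeasurable
  · rw [norm_mul]
    exact mul_le_mul_of_nonneg_left (abs_integral_kap_mul_den_le ha hb (eps_pos m) x) (abs_nonneg _)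

lemma integral_kap_swap {ε : ℝ} (hε : 0 < ε) {g : E3 → ℝ} (hg : Integrable g) :
    ∫ y, (∫ x, g x * kap ε y x) * den a b y = ∫ x, g x * ∫ y, kap ε x y * den a b y := by
  have ip : Integrable (fun z : E3 × E3 => kap ε z.2 z.1 * (g z.1 * den a b z.2))
      (volume.prod volume) := by
    refine (hg.mul_prod (ha.rd_den hb).integrable).bdd_mul (c := (√ε)⁻¹)
      (continuous_kap₂ hε).aestronglyMeasurable (Filter.Eventually.of_forall fun z => ?_)
    rw [Real.norm_eq_abs, abs_of_pos (kap_pos hε _ _)]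
    exact kap_le hε _ _
  calc _ = ∫ y, ∫ x, kap ε y x * (g x * den a b y) := by
        congr 1; ext y
        rw [← integral_mul_const]
        congr 1; ext x; ring
    _ = ∫ x, ∫ y, kap ε y x * (g x * den a b y) :=
        (integral_prod_symm _ ip).symm.trans (integral_prod _ ip)
    _ = _ := by
        congr 1; ext x
        rw [← integral_const_mul]
        congr 1; ext y; rw [kap_comm]; ring

end Regularised

section Potential

variable {a b : ℝ → E3 → ℝ} (F : Flow a b) {a' b' : E3 → ℝ} (ha' : Nice a') (hb' : Nice b')
  {s t S κ Q : ℝ} (hκ : 0 ≤ κ)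
  {g h : E3 → ℝ} (cg : Continuous g) (sg : HasCompactSupport g) (ch : Continuous h)
  (ih : Integrable fun x => h x ^ 2) (h0 : ∀ x, 0 ≤ h x)
  (hgh : ∀ x, |g x| ≤ h x * √(den a' b' x))

include F ha' hb' cg sg ch ih h0 hgh hκ

lemma abs_integral_pot_sub_le (hs : 0 ≤ s) (hst : s ≤ t)
    (hH : ∀ τ ∈ Icc s t, ∀ y, ∫ x, (‖x - y‖ ^ 2)⁻¹ * den (a τ) (b τ) x ≤ S ^ 2)
    (hH' : ∀ y, ∫ x, (‖x - y‖ ^ 2)⁻¹ * den a' b' x ≤ S ^ 2)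
    (hK : ∀ τ ∈ Icc s t, ∫ x, gsq (a τ) (b τ) x ≤ κ ^ 2)
    (hM : ∀ τ ∈ Icc s t, ∫ x, den (a τ) (b τ) x ≤ Q)
    (hKQ : ∀ τ ∈ Icc s t, ∫ x, gsq (a τ) (b τ) x ≤ Q) :
    |∫ x, g x * (pot (a t) (b t) x - pot (a s) (b s) x)| ≤
      √(∫ x, h x ^ 2) * S ^ 2 * κ * (t - s) := by
  have jd : Joint 1 fun t => den (a t) (b t) := (F.ja.den F.jb).of_le one_le_two
  have ig : Integrable g := cg.integrable_of_hasCompactSupport sg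
  set D := √(∫ x, h x ^ 2) * S ^ 2 * κ with hD
  have key : ∀ ε, 0 < ε → |(∫ x, g x * ∫ y, kap ε x y * den (a t) (b t) y) -
      ∫ x, g x * ∫ y, kap ε x y * den (a s) (b s) y| ≤ D * (t - s) := by
    intro ε hε
    have cm := continuous_integral_kap_mul hε ig
    set m : E3 → ℝ := fun y => ∫ x, g x * kap ε y x with hm
    have bm : ∀ y, ‖m y‖ ≤ ∫ x, |g x| * (√ε)⁻¹ := fun y => by
      refine norm_integral_le_of_norm_le (ig.abs.mul_const _) (Filter.Eventually.of_forall fun x => ?_)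
      rw [norm_mul, Real.norm_eq_abs, Real.norm_eq_abs, abs_of_pos (kap_pos hε _ _)]
      exact mul_le_mul_of_nonneg_left (kap_le hε _ _) (abs_nonneg _)
    have hk : ∀ k : ℕ, |(∫ y, chi k y * (m y * den (a t) (b t) y)) -
        ∫ y, chi k y * (m y * den (a s) (b s) y)| ≤
        ((∫ x, |g x|) * ((√ε)⁻¹ * (4 * Q * (cc * ((k : ℝ) + 1)⁻¹))) + D) * t -
        ((∫ x, |g x|) * ((√ε)⁻¹ * (4 * Q * (cc * ((k : ℝ) + 1)⁻¹))) + D) * s := by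
      intro k
      have := abs_sub_le_of_abs_deriv_le
        (f := fun τ => ∫ y, (chi k y * m y) * den (a τ) (b τ) y) hst
        (fun τ _ => jd.hasDerivAt_integral ((continuous_chi k).mul cm)
          (hasCompactSupport_chi k).mul_right τ)
        (fun τ _ => (hasDerivAt_id τ).const_mul _)
        (fun τ hτ => by
          rw [mul_one]
          exact deriv_regularised_potential_le F ha' hb' hκ cg sg ch ih h0 hgh (hs.trans hτ.1)
            (hH τ hτ) hH' (hK τ hτ) (hM τ hτ) (hKQ τ hτ) hε k)
      simpa only [mul_assoc, id, hD] using this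
    have im : ∀ τ, Integrable fun y => m y * den (a τ) (b τ) y := fun τ =>
      ((F.na τ).rd_den (F.nb τ)).integrable.bdd_mul cm.aestronglyMeasurable
        (Filter.Eventually.of_forall bm)
    have l1 := ((tendsto_integral_chi_mul (im t)).sub (tendsto_integral_chi_mul (im s))).abs
    have l2 : Filter.Tendsto (fun k : ℕ =>
        ((∫ x, |g x|) * ((√ε)⁻¹ * (4 * Q * (cc * ((k : ℝ) + 1)⁻¹))) + D) * t -
        ((∫ x, |g x|) * ((√ε)⁻¹ * (4 * Q * (cc * ((k : ℝ) + 1)⁻¹))) + D) * s) Filter.atTop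
        (𝓝 (D * (t - s))) := by
      have := (((tendsto_inv_nat.const_mul cc).const_mul (4 * Q)).const_mul (√ε)⁻¹).const_mul
        (∫ x, |g x|)
      have := ((this.add_const D).mul_const t).sub ((this.add_const D).mul_const s)
      convert this using 2; ring
    have := le_of_tendsto_of_tendsto' l1 l2 hk
    rwa [integral_kap_swap (F.na t) (F.nb t) hε ig, integral_kap_swap (F.na s) (F.nb s) hε ig] at this
  have l := ((tendsto_integral_mul_kap (F.na t) (F.nb t) ig).sub
    (tendsto_integral_mul_kap (F.na s) (F.nb s) ig)).abs
  have h1 := le_of_tendsto l (Filter.Eventually.of_forall fun m => key _ (eps_pos m))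
  have ip : ∀ τ, Integrable fun x => g x * pot (a τ) (b τ) x := fun τ =>
    ig.mul_bdd (c := (∫ x, den (a τ) (b τ) x) + 4 * ∫ x, gsq (a τ) (b τ) x)
      ((F.na τ).measurable_pot (F.nb τ)).aestronglyMeasurable
      (Filter.Eventually.of_forall fun x => by
        rw [Real.norm_eq_abs, abs_of_nonneg (pot_nonneg _ _ _)]
        exact (F.na τ).pot_le (F.nb τ) x)
  simp only [mul_sub]
  rw [integral_sub (ip t) (ip s)]
  rw [← mul_sub, abs_mul, abs_of_pos (by positivity)] at h1
  have hπ := Real.pi_gt_three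
  refine le_trans ?_ (h1.trans_eq (by ring))
  exact le_mul_of_one_le_left (abs_nonneg _) (by linarith)

end Potential

lemma den_sub_le (a b a' b' : E3 → ℝ) (x : E3) :
    den (fun x => a x - a' x) (fun x => b x - b' x) x ≤ 2 * (den a b x + den a' b' x) := by
  unfold den; nlinarith [sq_nonneg (a x + a' x), sq_nonneg (b x + b' x)]

lemma gsq_sub_le {a b a' b' : E3 → ℝ} (ha : Nice a) (hb : Nice b) (ha' : Nice a') (hb' : Nice b')
    (x : E3) :
    gsq (fun x => a x - a' x) (fun x => b x - b' x) x ≤ 2 * (gsq a b x + gsq a' b' x) := by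
  unfold gsq
  rw [← Finset.sum_add_distrib, Finset.mul_sum]
  refine Finset.sum_le_sum fun i _ => ?_
  rw [pd_sub ha.diff ha'.diff, pd_sub hb.diff hb'.diff]
  nlinarith [sq_nonneg (pd i a x + pd i a' x), sq_nonneg (pd i b x + pd i b' x)]

lemma integral_sub_le {a b a' b' : E3 → ℝ} (ha : Nice a) (hb : Nice b) (ha' : Nice a')
    (hb' : Nice b') {Q : ℝ} (hM : ∫ x, den a b x ≤ Q) (hK : ∫ x, gsq a b x ≤ Q)
    (hM' : ∫ x, den a' b' x ≤ Q) (hK' : ∫ x, gsq a' b' x ≤ Q) :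
    ∫ x, den (fun x => a x - a' x) (fun x => b x - b' x) x ≤ 4 * Q ∧
    ∫ x, gsq (fun x => a x - a' x) (fun x => b x - b' x) x ≤ 4 * Q := by
  constructor
  · calc _ ≤ ∫ x, 2 * (den a b x + den a' b' x) := integral_mono
          ((ha.sub ha').rd_den (hb.sub hb')).integrable
          (((ha.rd_den hb).add (ha'.rd_den hb')).const_mul 2).integrable (den_sub_le a b a' b')
      _ = 2 * ((∫ x, den a b x) + ∫ x, den a' b' x) := by
          rw [integral_const_mul, integral_add (ha.rd_den hb).integrable (ha'.rd_den hb').integrable]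
      _ ≤ _ := by linarith
  · calc _ ≤ ∫ x, 2 * (gsq a b x + gsq a' b' x) := integral_mono
          ((ha.sub ha').rd_gsq (hb.sub hb')).integrable
          (((ha.rd_gsq hb).add (ha'.rd_gsq hb')).const_mul 2).integrable
          (gsq_sub_le ha hb ha' hb')
      _ = 2 * ((∫ x, gsq a b x) + ∫ x, gsq a' b' x) := by
          rw [integral_const_mul, integral_add (ha.rd_gsq hb).integrable (ha'.rd_gsq hb').integrable]
      _ ≤ _ := by linarith

lemma integral_den_nonneg (a b : E3 → ℝ) : 0 ≤ ∫ x, den a b x := integral_nonneg (den_nonneg a b)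

lemma integral_gsq_nonneg (a b : E3 → ℝ) : 0 ≤ ∫ x, gsq a b x := integral_nonneg (gsq_nonneg a b)

lemma Nice.pot_le_of_le {a b : E3 → ℝ} (ha : Nice a) (hb : Nice b) {Q : ℝ}
    (hM : ∫ x, den a b x ≤ Q) (hK : ∫ x, gsq a b x ≤ Q) (x : E3) : pot a b x ≤ 5 * Q := by
  linarith [ha.pot_le hb x]

/-- A bound for the squared `L²` distance travelled per unit time. -/
def speed (Q : ℝ) (a b : E3 → ℝ) : ℝ :=
  ∫ x, (1 / 2 * den (lap a) (lap b) x + 50 * Q ^ 2 * den a b x)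

namespace Flow

variable {a b : ℝ → E3 → ℝ} (F : Flow a b) {s t Q : ℝ}
include F

lemma mass_eq (hs : 0 ≤ s) (hst : s ≤ t)
    (hM : ∀ τ ∈ Icc s t, ∫ x, den (a τ) (b τ) x ≤ Q)
    (hK : ∀ τ ∈ Icc s t, ∫ x, gsq (a τ) (b τ) x ≤ Q) :
    ∫ x, den (a t) (b t) x = ∫ x, den (a s) (b s) x := by
  have := abs_sqrt_mass_sub_le F.ja F.jb F.na F.nb hst hM hK (G := fun _ _ => 0)
    (fun τ hτ x => by rw [F.eqa τ (hs.trans hτ.1), F.eqb τ (hs.trans hτ.1)]; ring)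
    (B := fun _ => 0) (β := fun _ => 0) (fun τ _ => hasDerivAt_const τ 0) (fun _ _ => le_rfl)
    (fun τ _ k => by simp)
  rw [sub_self] at this
  have := sub_eq_zero.1 (abs_nonpos_iff.1 this)
  exact (Real.sqrt_inj (integral_den_nonneg _ _) (integral_den_nonneg _ _)).1 this

lemma speed_integrand_integrable (Q : ℝ) (s : ℝ) :
    RapidDecay fun x => 1 / 2 * den (lap (a s)) (lap (b s)) x + 50 * Q ^ 2 * den (a s) (b s) x :=
  (((F.na s).rd_lap.sq.add (F.nb s).rd_lap.sq).const_mul (1 / 2)).add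
    (((F.na s).rd_den (F.nb s)).const_mul (50 * Q ^ 2))

omit F in
lemma speed_integrand_nonneg (Q : ℝ) (a b : E3 → ℝ) (x : E3) :
    0 ≤ 1 / 2 * den (lap a) (lap b) x + 50 * Q ^ 2 * den a b x := by
  have := den_nonneg (lap a) (lap b) x
  have := den_nonneg a b x
  positivity

omit F in
lemma sq_force_le {V Q : ℝ} (h0 : 0 ≤ V) (h : V ≤ 5 * Q) (a b : E3 → ℝ) (x : E3) :
    (-(1 / 2) * lap b x + V * b x) ^ 2 + (1 / 2 * lap a x - V * a x) ^ 2 ≤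
      1 / 2 * den (lap a) (lap b) x + 50 * Q ^ 2 * den a b x := by
  have h1 : V ^ 2 ≤ 25 * Q ^ 2 := by nlinarith
  have h2 := mul_le_mul_of_nonneg_right h1 (den_nonneg a b x)
  unfold den at *
  nlinarith [sq_nonneg (1 / 2 * lap b x + V * b x), sq_nonneg (1 / 2 * lap a x + V * a x)]

lemma sqrt_mass_sub_initial_le (hs : 0 ≤ s) (hst : s ≤ t)
    (hM : ∀ τ ∈ Icc s t, ∫ x, den (a τ) (b τ) x ≤ Q)
    (hK : ∀ τ ∈ Icc s t, ∫ x, gsq (a τ) (b τ) x ≤ Q) :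
    √(∫ x, den (fun x => a t x - a s x) (fun x => b t x - b s x) x) ≤
      √(speed Q (a s) (b s)) * (t - s) := by
  set β := √(speed Q (a s) (b s)) with hβ
  set V : ℝ → E3 → ℝ := fun τ => pot (a τ) (b τ) with hV
  set G : ℝ → E3 → ℝ := fun τ x => 2 * ((a τ x - a s x) * (-(1 / 2) * lap (b s) x + V τ x * b s x) +
    (b τ x - b s x) * (1 / 2 * lap (a s) x - V τ x * a s x)) with hG
  have na : ∀ τ, Nice fun x => a τ x - a s x := fun τ => (F.na τ).sub (F.na s)
  have nb : ∀ τ, Nice fun x => b τ x - b s x := fun τ => (F.nb τ).sub (F.nb s)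
  have hb := fun τ (hτ : τ ∈ Icc s t) => integral_sub_le (F.na τ) (F.nb τ) (F.na s) (F.nb s)
    (hM τ hτ) (hK τ hτ) (hM s ⟨le_rfl, hst⟩) (hK s ⟨le_rfl, hst⟩)
  have := abs_sqrt_mass_sub_le (a := fun τ x => a τ x - a s x) (b := fun τ x => b τ x - b s x)
    (F.ja.sub (.const (F.na s).smooth)) (F.jb.sub (.const (F.nb s).smooth)) na nb hst
    (fun τ hτ => (hb τ hτ).1) (fun τ hτ => (hb τ hτ).2) (G := G)
    (fun τ hτ x => by
      have h1 : dt (fun τ x => a τ x - a s x) τ x = dt a τ x := by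
        simp only [dt, deriv_sub_const]
      have h2 : dt (fun τ x => b τ x - b s x) τ x = dt b τ x := by
        simp only [dt, deriv_sub_const]
      rw [h1, h2, F.eqa τ (hs.trans hτ.1), F.eqb τ (hs.trans hτ.1),
        (F.na τ).lap_sub (F.na s), (F.nb τ).lap_sub (F.nb s)]
      simp only [hG, hV]; ring)
    (B := fun τ => β * τ) (β := fun _ => β)
    (fun τ _ => by simpa using (hasDerivAt_id τ).const_mul β) (fun _ _ => Real.sqrt_nonneg _)
    (fun τ hτ k => by
      have hm : AEStronglyMeasurable (fun x => chi k x * G τ x) volume := by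
        have := ((F.na τ).measurable_pot (F.nb τ)).measurable
        have := (continuous_chi k).measurable
        have := (F.na τ).rd.cont.measurable
        have := (F.nb τ).rd.cont.measurable
        have := (F.na s).rd.cont.measurable
        have := (F.nb s).rd.cont.measurable
        have := (F.na s).rd_lap.cont.measurable
        have := (F.nb s).rd_lap.cont.measurable
        exact (by simp only [hG, hV]; fun_prop :
          Measurable fun x => chi k x * G τ x).aestronglyMeasurable
      have h := (integral_le_sqrt_mul_sqrt
        (f := fun x => 4 * (chi k x * den (fun x => a τ x - a s x) (fun x => b τ x - b s x) x))
        ((integrable_chi_mul k ((na τ).continuous_den (nb τ))).const_mul 4)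
        (F.speed_integrand_integrable Q s).integrable hm
        (fun x => mul_nonneg (by norm_num) (mul_nonneg (chi_nonneg k x) (den_nonneg _ _ _)))
        (speed_integrand_nonneg Q _ _) (fun x => ?_)).2
      · refine h.trans (le_of_eq ?_)
        rw [integral_const_mul, Real.sqrt_mul (by norm_num), ← speed, ← hβ,
          show √(4 : ℝ) = 2 by rw [show (4 : ℝ) = 2 ^ 2 by norm_num, Real.sqrt_sq (by norm_num)]]
        ring
      · have hf := sq_force_le (pot_nonneg (a τ) (b τ) x)
          ((F.na τ).pot_le_of_le (F.nb τ) (hM τ hτ) (hK τ hτ) x) (a s) (b s) x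
        have hd := den_nonneg (fun x => a τ x - a s x) (fun x => b τ x - b s x) x
        have c0 := chi_nonneg k x
        rw [← Real.sqrt_mul (by positivity)]
        refine Real.abs_le_sqrt (le_trans ?_ (mul_le_mul_of_nonneg_left hf (by positivity)))
        have c1 : chi k x ^ 2 ≤ chi k x := by nlinarith [chi_le_one k x]
        simp only [hG, hV, den] at hd ⊢
        set p := a τ x - a s x
        set q := b τ x - b s x
        set u := -(1 / 2) * lap (b s) x + pot (a τ) (b τ) x * b s x
        set v := 1 / 2 * lap (a s) x - pot (a τ) (b τ) x * a s x
        have h1 : (p * u + q * v) ^ 2 ≤ (p ^ 2 + q ^ 2) * (u ^ 2 + v ^ 2) := by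
          nlinarith [sq_nonneg (p * v - q * u)]
        have h2 : 0 ≤ (p ^ 2 + q ^ 2) * (u ^ 2 + v ^ 2) := by positivity
        calc (chi k x * (2 * (p * u + q * v))) ^ 2 = 4 * (chi k x ^ 2 * (p * u + q * v) ^ 2) := by ring
          _ ≤ 4 * (chi k x * ((p ^ 2 + q ^ 2) * (u ^ 2 + v ^ 2))) := by gcongr
          _ = _ := by ring)
  have h0 : ∫ x, den (fun x => a s x - a s x) (fun x => b s x - b s x) x = 0 := by simp [den]
  rw [h0, Real.sqrt_zero, sub_zero, ← mul_sub] at this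
  exact (le_abs_self _).trans this

end Flow

lemma Joint.shift {n : ℕ} {F : ℝ → E3 → ℝ} (hF : Joint n F) (h : ℝ) :
    Joint n fun t => F (t + h) :=
  hF.comp ((contDiff_fst.add contDiff_const).prodMk contDiff_snd)

lemma sqrt_four : √(4 : ℝ) = 2 := by
  rw [show (4 : ℝ) = 2 ^ 2 by norm_num, Real.sqrt_sq (by norm_num)]

namespace Flow

variable {a b : ℝ → E3 → ℝ} (F : Flow a b) {s t Q κ : ℝ} {S B β : ℝ → ℝ}
include F

lemma sqrt_mass_shift_sub_le {h : ℝ} (hs : 0 ≤ s) (hst : s ≤ t) (hh : 0 ≤ h) (hκ : 0 ≤ κ)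
    (hM : ∀ τ ∈ Icc s (t + h), ∫ x, den (a τ) (b τ) x ≤ Q)
    (hK : ∀ τ ∈ Icc s (t + h), ∫ x, gsq (a τ) (b τ) x ≤ Q)
    (hKκ : ∀ τ ∈ Icc s (t + h), ∫ x, gsq (a τ) (b τ) x ≤ κ ^ 2)
    (hH : ∀ τ ∈ Icc s t, ∀ r ∈ Icc τ (τ + h), ∀ y,
      ∫ x, (‖x - y‖ ^ 2)⁻¹ * den (a r) (b r) x ≤ S τ ^ 2)
    (hB : ∀ τ ∈ Icc s t, HasDerivAt B (β τ) τ) (hβ : ∀ τ ∈ Icc s t, S τ ^ 2 * κ ≤ β τ) :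
    √(∫ x, den (fun x => a (t + h) x - a t x) (fun x => b (t + h) x - b t x) x) ≤
      √(∫ x, den (fun x => a (s + h) x - a s x) (fun x => b (s + h) x - b s x) x) +
        h * (B t - B s) := by
  set V : ℝ → E3 → ℝ := fun τ => pot (a τ) (b τ) with hV
  set G : ℝ → E3 → ℝ := fun τ x => 2 * ((V (τ + h) x - V τ x) *
    ((a (τ + h) x - a τ x) * b τ x - (b (τ + h) x - b τ x) * a τ x)) with hG
  have na : ∀ τ, Nice fun x => a (τ + h) x - a τ x := fun τ => (F.na _).sub (F.na τ)
  have nb : ∀ τ, Nice fun x => b (τ + h) x - b τ x := fun τ => (F.nb _).sub (F.nb τ)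
  have m1 : ∀ {τ}, τ ∈ Icc s t → τ ∈ Icc s (t + h) := fun h => ⟨h.1, by linarith [h.2]⟩
  have m2 : ∀ {τ}, τ ∈ Icc s t → τ + h ∈ Icc s (t + h) :=
    fun h => ⟨by linarith [h.1], by linarith [h.2]⟩
  have hb := fun τ (hτ : τ ∈ Icc s t) => integral_sub_le (F.na (τ + h)) (F.nb (τ + h)) (F.na τ)
    (F.nb τ) (hM _ (m2 hτ)) (hK _ (m2 hτ)) (hM τ (m1 hτ)) (hK τ (m1 hτ))
  have β0 : ∀ τ ∈ Icc s t, 0 ≤ β τ := fun τ hτ => le_trans (by positivity) (hβ τ hτ)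
  have := abs_sqrt_mass_sub_le (a := fun τ x => a (τ + h) x - a τ x)
    (b := fun τ x => b (τ + h) x - b τ x)
    ((F.ja.shift h).sub F.ja) ((F.jb.shift h).sub F.jb) na nb hst
    (fun τ hτ => (hb τ hτ).1) (fun τ hτ => (hb τ hτ).2) (G := G)
    (fun τ hτ x => by
      have hd : ∀ {f : ℝ → E3 → ℝ}, Joint 2 f →
          dt (fun τ x => f (τ + h) x - f τ x) τ x = dt f (τ + h) x - dt f τ x := by
        intro f jf
        exact (((jf.of_le one_le_two).hasDerivAt (n := 0) (τ + h) x).comp_add_const τ h |>.sub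
          ((jf.of_le one_le_two).hasDerivAt (n := 0) τ x)).deriv
      rw [hd F.ja, hd F.jb, F.eqa τ (hs.trans hτ.1), F.eqb τ (hs.trans hτ.1),
        F.eqa _ (hs.trans (m2 hτ).1), F.eqb _ (hs.trans (m2 hτ).1),
        (F.na _).lap_sub (F.na τ), (F.nb _).lap_sub (F.nb τ)]
      simp only [hG, hV]; ring)
    (B := fun τ => h * B τ) (β := fun τ => h * β τ)
    (fun τ hτ => (hB τ hτ).const_mul h) (fun τ hτ => mul_nonneg hh (β0 τ hτ))
    (fun τ hτ k => by
      have cg : Continuous fun x => chi k x *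
          (2 * ((a (τ + h) x - a τ x) * b τ x - (b (τ + h) x - b τ x) * a τ x)) := by
        have := continuous_chi k
        have := (F.na τ).rd.cont
        have := (F.nb τ).rd.cont
        have := (F.na (τ + h)).rd.cont
        have := (F.nb (τ + h)).rd.cont
        fun_prop
      have cw := (na τ).continuous_den (nb τ)
      have ih : Integrable fun x => (2 * (chi k x *
          √(den (fun x => a (τ + h) x - a τ x) (fun x => b (τ + h) x - b τ x) x))) ^ 2 := by
        refine (((integrable_chi_mul k ((continuous_chi k).mul cw)).const_mul 4)).congr
          (Filter.Eventually.of_forall fun x => ?_)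
        simp only [Pi.mul_apply]
        rw [mul_pow, mul_pow, Real.sq_sqrt (den_nonneg _ _ _)]; ring
      have hl := abs_integral_pot_sub_le F (F.na τ) (F.nb τ) hκ
        (h := fun x => 2 * (chi k x *
          √(den (fun x => a (τ + h) x - a τ x) (fun x => b (τ + h) x - b τ x) x)))
        cg (hasCompactSupport_chi k).mul_right
        ((continuous_const.mul ((continuous_chi k).mul (Real.continuous_sqrt.comp cw)))) ih
        (fun x => by have := chi_nonneg k x; positivity) (fun x => by
          have c0 := chi_nonneg k x
          rw [abs_mul, abs_of_nonneg c0, mul_assoc, mul_assoc, mul_left_comm]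
          refine mul_le_mul_of_nonneg_left ?_ c0
          rw [abs_mul, abs_of_pos (by norm_num : (0 : ℝ) < 2)]
          refine mul_le_mul_of_nonneg_left ?_ (by norm_num)
          rw [← Real.sqrt_mul (den_nonneg _ _ _)]
          refine Real.abs_le_sqrt ?_
          unfold den
          nlinarith [sq_nonneg ((a (τ + h) x - a τ x) * a τ x + (b (τ + h) x - b τ x) * b τ x)])
        (hs.trans hτ.1) (by linarith : τ ≤ τ + h) (S := S τ) (Q := Q)
        (hH τ hτ) (hH τ hτ τ ⟨le_rfl, by linarith⟩)
        (fun r hr => hKκ r ⟨hτ.1.trans hr.1, hr.2.trans (m2 hτ).2⟩)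
        (fun r hr => hM r ⟨hτ.1.trans hr.1, hr.2.trans (m2 hτ).2⟩)
        (fun r hr => hK r ⟨hτ.1.trans hr.1, hr.2.trans (m2 hτ).2⟩)
      have e : ∀ x, chi k x * G τ x = chi k x *
          (2 * ((a (τ + h) x - a τ x) * b τ x - (b (τ + h) x - b τ x) * a τ x)) *
          (pot (a (τ + h)) (b (τ + h)) x - pot (a τ) (b τ) x) := fun x => by
        simp only [hG, hV]; ring
      simp only [e]
      refine hl.trans ?_
      have e2 : √(∫ x, (2 * (chi k x *
          √(den (fun x => a (τ + h) x - a τ x) (fun x => b (τ + h) x - b τ x) x))) ^ 2) ≤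
          2 * √(∫ x, chi k x *
            den (fun x => a (τ + h) x - a τ x) (fun x => b (τ + h) x - b τ x) x) := by
        rw [← sqrt_four, ← Real.sqrt_mul (by norm_num), sqrt_four, ← integral_const_mul]
        refine Real.sqrt_le_sqrt (integral_mono ih
          ((integrable_chi_mul k cw).const_mul 4) fun x => ?_)
        have d0 := den_nonneg (fun x => a (τ + h) x - a τ x) (fun x => b (τ + h) x - b τ x) x
        have c0 := chi_nonneg k x
        beta_reduce
        rw [mul_pow, mul_pow, Real.sq_sqrt d0, sq (chi k x), mul_assoc (chi k x)]
        have := mul_le_of_le_one_left (mul_nonneg c0 d0) (chi_le_one k x)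
        linarith
      have e3 := hβ τ hτ
      calc _ ≤ 2 * √(∫ x, chi k x *
            den (fun x => a (τ + h) x - a τ x) (fun x => b (τ + h) x - b τ x) x) *
            (S τ ^ 2 * κ * h) := by
            rw [add_sub_cancel_left, mul_assoc, mul_assoc, ← mul_assoc (S τ ^ 2)]
            exact mul_le_mul_of_nonneg_right e2 (by positivity)
        _ ≤ 2 * √(∫ x, chi k x *
            den (fun x => a (τ + h) x - a τ x) (fun x => b (τ + h) x - b τ x) x) *
            (β τ * h) := by gcongr
        _ = _ := by ring)
  rw [← mul_sub] at this
  linarith [(abs_le.1 this).2]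

end Flow

namespace Flow

variable {a b : ℝ → E3 → ℝ} (F : Flow a b) {s t Q κ : ℝ} {S B β : ℝ → ℝ}
include F

lemma rd_dt (ht : 0 ≤ t) : RapidDecay (dt a t) ∧ RapidDecay (dt b t) := by
  set C := (∫ x, den (a t) (b t) x) + 4 * ∫ x, gsq (a t) (b t) x with hC
  have hV : ∀ x, |pot (a t) (b t) x| ≤ C := fun x => by
    rw [abs_of_nonneg (pot_nonneg _ _ _)]; exact (F.na t).pot_le (F.nb t) x
  have ca : Continuous (dt a t) := ((F.ja.dt (n := 1)).slice t).continuous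
  have cb : Continuous (dt b t) := ((F.jb.dt (n := 1)).slice t).continuous
  refine ⟨RapidDecay.of_abs_le ((F.nb t).rd_lap.abs.add ((F.nb t).rd.abs.const_mul C)) ca
    fun x => ?_, RapidDecay.of_abs_le ((F.na t).rd_lap.abs.add ((F.na t).rd.abs.const_mul C)) cb
    fun x => ?_⟩
  · rw [F.eqa t ht]
    refine le_trans ?_ (le_abs_self _)
    refine (abs_add_le _ _).trans (add_le_add ?_ ?_)
    · rw [abs_mul]; norm_num; linarith [abs_nonneg (lap (b t) x)]
    · rw [abs_mul]; exact mul_le_mul_of_nonneg_right (hV x) (abs_nonneg _)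
  · rw [F.eqb t ht]
    refine le_trans ?_ (le_abs_self _)
    refine (abs_sub _ _).trans (add_le_add ?_ ?_)
    · rw [abs_mul]; norm_num; linarith [abs_nonneg (lap (a t) x)]
    · rw [abs_mul]; exact mul_le_mul_of_nonneg_right (hV x) (abs_nonneg _)

lemma integrable_den_dt (ht : 0 ≤ t) : Integrable (den (dt a t) (dt b t)) :=
  ((F.rd_dt ht).1.sq.add (F.rd_dt ht).2.sq).integrable

lemma integral_den_dt_le (hs : 0 ≤ s) (hst : s ≤ t) (hκ : 0 ≤ κ)
    (hM : ∀ τ ∈ Icc s t, ∫ x, den (a τ) (b τ) x ≤ Q)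
    (hK : ∀ τ ∈ Icc s t, ∫ x, gsq (a τ) (b τ) x ≤ Q)
    (hKκ : ∀ τ ∈ Icc s t, ∫ x, gsq (a τ) (b τ) x ≤ κ ^ 2)
    (hH : ∀ τ ∈ Icc s t, ∀ r ∈ Icc τ t, ∀ y,
      ∫ x, (‖x - y‖ ^ 2)⁻¹ * den (a r) (b r) x ≤ S τ ^ 2)
    (hB : ∀ τ ∈ Icc s t, HasDerivAt B (β τ) τ) (hβ : ∀ τ ∈ Icc s t, S τ ^ 2 * κ ≤ β τ) :
    ∫ x, den (dt a t) (dt b t) x ≤ (√(speed Q (a s) (b s)) + (B t - B s)) ^ 2 := by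
  have mono : ∀ {r r'}, s ≤ r → r ≤ r' → r' ≤ t → B r ≤ B r' := by
    intro r r' h1 h2 h3
    have := abs_sub_le_of_abs_deriv_le (f := fun _ => (0 : ℝ)) (f' := fun _ => 0) h2
      (fun τ _ => hasDerivAt_const τ 0) (fun τ hτ => hB τ ⟨h1.trans hτ.1, hτ.2.trans h3⟩)
      (fun τ hτ => by
        rw [abs_zero]
        exact le_trans (by positivity) (hβ τ ⟨h1.trans hτ.1, hτ.2.trans h3⟩))
    simpa using this
  rcases hst.eq_or_lt with rfl | hlt
  · rw [sub_self, add_zero, speed, Real.sq_sqrt (integral_nonneg (speed_integrand_nonneg _ _ _))]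
    refine integral_mono (F.integrable_den_dt hs) (F.speed_integrand_integrable Q s).integrable
      fun x => ?_
    have := sq_force_le (pot_nonneg (a s) (b s) x)
      ((F.na s).pot_le_of_le (F.nb s) (hM s ⟨le_rfl, le_rfl⟩) (hK s ⟨le_rfl, le_rfl⟩) x) (a s) (b s) x
    beta_reduce
    rwa [den, F.eqa s hs, F.eqb s hs]
  · set h : ℕ → ℝ := fun m => eps m * (t - s) with hh
    have h0 : ∀ m, 0 < h m := fun m => mul_pos (eps_pos m) (by linarith)
    have h1 : ∀ m, h m ≤ t - s := fun m => by
      refine mul_le_of_le_one_left (by linarith) ?_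
      unfold eps
      rw [div_le_one (by positivity)]
      have : (0 : ℝ) ≤ m := m.cast_nonneg
      linarith
    have hl : Filter.Tendsto (fun m => -h m) Filter.atTop (𝓝[≠] 0) := by
      refine tendsto_nhdsWithin_iff.2 ⟨?_, Filter.Eventually.of_forall fun m => ?_⟩
      · simpa using (tendsto_eps.mul_const (t - s)).neg
      · exact neg_ne_zero.2 (h0 m).ne'
    refine (integrable_and_integral_le_of_tendsto
      (F := fun m x => ((h m)⁻¹) ^ 2 * den (fun x => a (t - h m + h m) x - a (t - h m) x)
        (fun x => b (t - h m + h m) x - b (t - h m) x) x)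
      (fun m => ((((F.na _).sub (F.na _)).rd_den ((F.nb _).sub (F.nb _))).const_mul _).integrable)
      (fun m => Filter.Eventually.of_forall fun x => mul_nonneg (sq_nonneg _) (den_nonneg _ _ _))
      (fun m => ?_) (Filter.Eventually.of_forall fun x => ?_)).2
    · have hm1 := h1 m
      have hm0 := h0 m
      have e : t - h m + h m = t := by ring
      have A := F.sqrt_mass_shift_sub_le (s := s) (t := t - h m) (h := h m) hs (by linarith) hm0.le hκ
        (by rwa [e]) (by rwa [e]) (by rwa [e]) (S := S) (B := B) (β := β)
        (fun τ hτ r hr => hH τ ⟨hτ.1, by linarith [hτ.2]⟩ r ⟨hr.1, by linarith [hr.2, hτ.2]⟩)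
        (fun τ hτ => hB τ ⟨hτ.1, by linarith [hτ.2]⟩) (fun τ hτ => hβ τ ⟨hτ.1, by linarith [hτ.2]⟩)
      have A2 := F.sqrt_mass_sub_initial_le (s := s) (t := s + h m) hs (by linarith)
        (fun τ hτ => hM τ ⟨hτ.1, by linarith [hτ.2]⟩) (fun τ hτ => hK τ ⟨hτ.1, by linarith [hτ.2]⟩)
      have A3 : B (t - h m) ≤ B t := mono (by linarith) (by linarith) le_rfl
      set X := ∫ x, den (fun x => a (t - h m + h m) x - a (t - h m) x)
        (fun x => b (t - h m + h m) x - b (t - h m) x) x with hX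
      have X0 : 0 ≤ X := integral_den_nonneg _ _
      have A4 : √X ≤ h m * (√(speed Q (a s) (b s)) + (B t - B s)) := by
        have := mul_le_mul_of_nonneg_left A3 hm0.le
        rw [add_sub_cancel_left] at A2
        linarith
      rw [integral_const_mul]
      calc (h m)⁻¹ ^ 2 * X = (h m)⁻¹ ^ 2 * √X ^ 2 := by rw [Real.sq_sqrt X0]
        _ ≤ (h m)⁻¹ ^ 2 * (h m * (√(speed Q (a s) (b s)) + (B t - B s))) ^ 2 := by gcongr
        _ = _ := by field_simp
    · have key : ∀ {f : ℝ → E3 → ℝ}, Joint 2 f → Filter.Tendsto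
          (fun m => ((h m)⁻¹ * (f (t - h m + h m) x - f (t - h m) x)) ^ 2) Filter.atTop
          (𝓝 (dt f t x ^ 2)) := by
        intro f jf
        have := (((jf.of_le one_le_two).hasDerivAt (n := 0) t x).tendsto_slope_zero.comp hl).pow 2
        refine this.congr fun m => ?_
        simp only [Function.comp, smul_eq_mul, sub_add_cancel, ← sub_eq_add_neg]
        rw [inv_neg]; ring
      refine ((key F.ja).add (key F.jb)).congr fun m => ?_
      unfold den; ring

end Flow

lemma inv_sub_kap_le {ε : ℝ} (hε : 0 < ε) {x y : E3} (h : y ≠ x) :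
    |kap ε x y - ‖x - y‖⁻¹| ≤ √ε * (‖y - x‖ ^ 2)⁻¹ := by
  have hr : 0 < ‖x - y‖ := norm_pos_iff.2 (sub_ne_zero.2 h.symm)
  have hs : 0 < √ε := Real.sqrt_pos.2 hε
  have hle : √(‖y - x‖ ^ 2 + ε) ≤ ‖x - y‖ + √ε := by
    rw [norm_sub_rev]
    refine Real.sqrt_le_iff.2 ⟨by positivity, ?_⟩
    nlinarith [Real.sq_sqrt hε.le]
  have h1 : (‖x - y‖ + √ε)⁻¹ ≤ kap ε x y := by
    unfold kap
    have : 0 < √(‖y - x‖ ^ 2 + ε) := by positivity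
    gcongr
  have h2 : kap ε x y ≤ ‖x - y‖⁻¹ := kap_comm ε x y ▸ kap_le_inv hε x y h.symm
  rw [abs_sub_comm, abs_of_nonneg (by linarith), norm_sub_rev y x]
  calc ‖x - y‖⁻¹ - kap ε x y ≤ ‖x - y‖⁻¹ - (‖x - y‖ + √ε)⁻¹ := by linarith
    _ = √ε * (‖x - y‖ * (‖x - y‖ + √ε))⁻¹ := by field_simp; ring
    _ ≤ √ε * (‖x - y‖ ^ 2)⁻¹ := by gcongr; nlinarith

section Symmetry

variable {a b : E3 → ℝ} (ha : Nice a) (hb : Nice b)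
include ha hb

lemma abs_integral_kap_sub_le {ε : ℝ} (hε : 0 < ε) (x : E3) :
    |(∫ y, kap ε x y * den a b y) - 4 * π * pot a b x| ≤ √ε * (4 * ∫ y, gsq a b y) := by
  have e : 4 * π * pot a b x = ∫ y, ‖x - y‖⁻¹ * den a b y := by
    unfold pot; field_simp
  have hh := ha.hardy hb 0 x
  rw [gd_zero] at hh
  rw [e, ← integral_sub (integrable_kap_mul_den ha hb hε x) (ha.integrable_inv_mul_den hb x)]
  refine (norm_integral_le_of_norm_le (f := fun y => kap ε x y * den a b y - ‖x - y‖⁻¹ * den a b y)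
    (hh.1.const_mul √ε) ?_).trans ?_
  · filter_upwards [ae_ne x] with y hy
    rw [← sub_mul, norm_mul, Real.norm_eq_abs, Real.norm_eq_abs, abs_of_nonneg (den_nonneg _ _ _),
      ← mul_assoc]
    exact mul_le_mul_of_nonneg_right (inv_sub_kap_le hε hy) (den_nonneg _ _ _)
  · rw [integral_const_mul]
    exact mul_le_mul_of_nonneg_left hh.2 (Real.sqrt_nonneg _)

lemma Nice.continuous_pot : Continuous (pot a b) := by
  have h : Continuous fun x => 4 * π * pot a b x := by
    refine TendstoUniformly.continuous (F := fun m x => ∫ y, kap (eps m) x y * den a b y)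
      (p := Filter.atTop) ?_ (Filter.Frequently.of_forall fun m => ?_)
    · refine Metric.tendstoUniformly_iff.2 fun δ hδ => ?_
      have l : Filter.Tendsto (fun m => √(eps m) * (4 * ∫ y, gsq a b y)) Filter.atTop (𝓝 0) := by
        simpa using (tendsto_eps.sqrt).mul_const (4 * ∫ y, gsq a b y)
      filter_upwards [l.eventually (gt_mem_nhds hδ)] with m hm x
      rw [dist_comm, Real.dist_eq]
      exact (abs_integral_kap_sub_le ha hb (eps_pos m) x).trans_lt hm
    · have := continuous_integral_kap_mul (eps_pos m) (ha.rd_den hb).integrable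
      simpa only [mul_comm (kap _ _ _)] using this
  have h2 := h.const_mul (4 * π)⁻¹
  refine h2.congr fun x => ?_
  field_simp

lemma integral_den_mul_pot_comm {a' b' : E3 → ℝ} (ha' : Nice a') (hb' : Nice b') :
    ∫ x, den a' b' x * pot a b x = ∫ x, den a b x * pot a' b' x := by
  have l1 := tendsto_integral_mul_kap ha hb (ha'.rd_den hb').integrable
  have l2 := tendsto_integral_mul_kap ha' hb' (ha.rd_den hb).integrable
  have := tendsto_nhds_unique l1 (l2.congr fun m => ?_)
  · exact mul_left_cancel₀ (by positivity) this
  · rw [← integral_kap_swap ha hb (eps_pos m) (ha'.rd_den hb').integrable]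
    congr 1; ext y
    rw [mul_comm]; congr 2; ext x; ring

end Symmetry

lemma abs_integral_pd_chi_mul_le {v : Fin 3 → E3 → ℝ} {w : E3 → ℝ} (hw : Integrable w)
    (h : ∀ x, ∑ i, |v i x| ≤ w x) (k : ℕ) :
    |∫ x, ∑ i, pd i (chi k) x * v i x| ≤ cc * ((k : ℝ) + 1)⁻¹ * ∫ x, w x := by
  have hcc : 0 ≤ cc * ((k : ℝ) + 1)⁻¹ := mul_nonneg cc_pos.le (by positivity)
  rw [← integral_const_mul, ← Real.norm_eq_abs]
  refine norm_integral_le_of_norm_le (hw.const_mul _) (Filter.Eventually.of_forall fun x => ?_)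
  refine (Finset.abs_sum_le_sum_abs _ _).trans ?_
  calc _ ≤ ∑ i, cc * ((k : ℝ) + 1)⁻¹ * |v i x| := Finset.sum_le_sum fun i _ => by
        rw [abs_mul]; exact mul_le_mul_of_nonneg_right (abs_pd_chi_le k i x) (abs_nonneg _)
    _ ≤ _ := by rw [← Finset.mul_sum]; exact mul_le_mul_of_nonneg_left (h x) hcc

lemma le_of_tendsto_add_inv {f : ℕ → ℝ} {l C c : ℝ} (hl : Filter.Tendsto f Filter.atTop (𝓝 l))
    (h : ∀ k : ℕ, |f k| ≤ C + c * ((k : ℝ) + 1)⁻¹) : |l| ≤ C := by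
  refine le_of_tendsto_of_tendsto' hl.abs ?_ h
  simpa using (tendsto_inv_nat.const_mul c).const_add C

/-- The total (kinetic plus potential) energy, up to normalisation. -/
def energy (a b : E3 → ℝ) : ℝ := (∫ x, gsq a b x) + ∫ x, den a b x * pot a b x

namespace Flow

variable {a b : ℝ → E3 → ℝ} (F : Flow a b) {s t Q Y : ℝ}
include F

lemma joint_gsq : Joint 1 fun t => gsq (a t) (b t) :=
  .sum fun i => (F.ja.pd (n := 1) i).sq.add (F.jb.pd (n := 1) i).sq

lemma dt_gsq (t : ℝ) (x : E3) : dt (fun t => gsq (a t) (b t)) t x =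
    2 * ((∑ i, pd i (a t) x * pd i (dt a t) x) + ∑ i, pd i (b t) x * pd i (dt b t) x) := by
  have h : HasDerivAt (fun s => gsq (a s) (b s) x) _ t := HasDerivAt.fun_sum fun i _ =>
    (((F.ja.pd (n := 1) i).hasDerivAt (n := 0) t x).fun_pow 2).fun_add
      (((F.jb.pd (n := 1) i).hasDerivAt (n := 0) t x).fun_pow 2)
  refine h.deriv.trans ?_
  rw [← Finset.sum_add_distrib, Finset.mul_sum]
  refine Finset.sum_congr rfl fun i _ => ?_
  rw [F.ja.dt_pd, F.jb.dt_pd]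
  norm_num; ring

lemma integral_chi_dt_gsq (ht : 0 ≤ t) (k : ℕ) :
    ∫ x, chi k x * dt (fun t => gsq (a t) (b t)) t x =
      -(2 * ∫ x, chi k x * dt (fun t => den (a t) (b t)) t x * pot (a t) (b t) x) -
      2 * ∫ x, ∑ i, pd i (chi k) x * (pd i (a t) x * dt a t x + pd i (b t) x * dt b t x) := by
  have ca : ContDiff ℝ 1 (dt a t) := (F.ja.dt (n := 1)).slice t
  have cb : ContDiff ℝ 1 (dt b t) := (F.jb.dt (n := 1)).slice t
  have na := F.na t
  have nb := F.nb t
  have hc := hasCompactSupport_chi k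
  have c1 := continuous_chi k
  have cχ : ContDiff ℝ 1 (chi k) := contDiff_chi k
  have h1 := integral_mul_inner_pd cχ hc na.smooth ca
  have h2 := integral_mul_inner_pd cχ hc nb.smooth cb
  have p1 : ∀ {f : E3 → ℝ} {i}, ContDiff ℝ 1 f → Continuous (pd i f) := fun h => continuous_pd h
  have i1 : ∀ {f g : E3 → ℝ}, ContDiff ℝ 2 f → ContDiff ℝ 1 g →
      Integrable fun x => chi k x * ∑ i, pd i f x * pd i g x := fun hf hg =>
    integrable_mul_of_compactSupport c1 hc
      (continuous_finsetSum _ fun i _ => (p1 (hf.of_le one_le_two)).mul (p1 hg))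
  have i2 : ∀ {f g : E3 → ℝ}, ContDiff ℝ 2 f → ContDiff ℝ 1 g →
      Integrable fun x => chi k x * (lap f x * g x) := fun hf hg =>
    integrable_mul_of_compactSupport c1 hc ((continuous_lap hf).mul hg.continuous)
  have i3 : ∀ {f g : E3 → ℝ}, ContDiff ℝ 2 f → ContDiff ℝ 1 g →
      Integrable fun x => ∑ i, pd i (chi k) x * (pd i f x * g x) := fun hf hg =>
    integrable_finsetSum _ fun i _ => integrable_mul_of_compactSupport (p1 cχ)
      (hasCompactSupport_pd hc) ((p1 (hf.of_le one_le_two)).mul hg.continuous)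
  calc _ = 2 * ((∫ x, chi k x * ∑ i, pd i (a t) x * pd i (dt a t) x) +
        ∫ x, chi k x * ∑ i, pd i (b t) x * pd i (dt b t) x) := by
        rw [← integral_add (i1 na.smooth ca) (i1 nb.smooth cb), ← integral_const_mul]
        congr 1; ext x; rw [F.dt_gsq]; ring
    _ = -(2 * ((∫ x, chi k x * (lap (a t) x * dt a t x)) +
          ∫ x, chi k x * (lap (b t) x * dt b t x))) -
        2 * ((∫ x, ∑ i, pd i (chi k) x * (pd i (a t) x * dt a t x)) +
          ∫ x, ∑ i, pd i (chi k) x * (pd i (b t) x * dt b t x)) := by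
        rw [h1, h2]; ring
    _ = _ := by
        rw [← integral_add (i2 na.smooth ca) (i2 nb.smooth cb),
          ← integral_add (i3 na.smooth ca) (i3 nb.smooth cb)]
        congr 2
        · congr 2; ext x
          rw [Joint.dt_den (F.ja.of_le one_le_two) (F.jb.of_le one_le_two)]
          have e1 : lap (a t) x = 2 * (dt b t x + pot (a t) (b t) x * a t x) := by
            rw [F.eqb t ht]; ring
          have e2 : lap (b t) x = 2 * (pot (a t) (b t) x * b t x - dt a t x) := by
            rw [F.eqa t ht]; ring
          rw [e1, e2]; ring
        · congr 2; ext x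
          rw [← Finset.sum_add_distrib]
          exact Finset.sum_congr rfl fun i _ => by ring

end Flow

lemma Nice.hardy_le {a b : E3 → ℝ} (ha : Nice a) (hb : Nice b) {Q : ℝ}
    (hK : ∫ x, gsq a b x ≤ Q) (y : E3) :
    ∫ x, (‖x - y‖ ^ 2)⁻¹ * den a b x ≤ (2 * √Q) ^ 2 := by
  have h := (ha.hardy hb 0 y).2
  rw [gd_zero] at h
  rw [mul_pow, Real.sq_sqrt ((integral_gsq_nonneg a b).trans hK)]
  linarith

lemma Nice.integrable_den_mul_pot {a b a' b' : E3 → ℝ} (ha : Nice a) (hb : Nice b)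
    (ha' : Nice a') (hb' : Nice b') : Integrable fun x => den a' b' x * pot a b x := by
  have h := ((ha'.rd_den hb').integrable.bdd_mul (c := (∫ x, den a b x) + 4 * ∫ x, gsq a b x)
    (ha.continuous_pot hb).aestronglyMeasurable (Filter.Eventually.of_forall fun x => by
      rw [Real.norm_eq_abs, abs_of_nonneg (pot_nonneg a b x)]; exact ha.pot_le hb x))
  exact h.congr (Filter.Eventually.of_forall fun x => mul_comm _ _)

lemma eq_of_abs_sub_le_sq {f : ℝ → ℝ} {s t C : ℝ} (hst : s ≤ t)
    (h : ∀ u ∈ Icc s t, ∀ v ∈ Icc u t, |f v - f u| ≤ C * (v - u) ^ 2) : f t = f s := by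
  have hd : ∀ x ∈ Ico s t, HasDerivWithinAt f 0 (Ici x) x := fun x hx => by
    rw [hasDerivWithinAt_iff_isLittleO]
    have : (fun y => f y - f x - (y - x) • (0 : ℝ)) =O[𝓝[Ici x] x] fun y => (y - x) ^ 2 := by
      refine Asymptotics.IsBigO.of_bound C ?_
      filter_upwards [Icc_mem_nhdsGE hx.2] with y hy
      simpa using h x ⟨hx.1, hx.2.le⟩ y hy
    refine this.trans_isLittleO ?_
    have h2 : Filter.Tendsto (fun y : ℝ => y - x) (𝓝[Ici x] x) (𝓝 0) := by
      have : Continuous fun y : ℝ => y - x := by fun_prop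
      simpa using (this.tendsto x).mono_left nhdsWithin_le_nhds
    have := ((Asymptotics.isLittleO_one_iff ℝ).2 h2).mul_isBigO
      (Asymptotics.isBigO_refl (fun y : ℝ => y - x) (𝓝[Ici x] x))
    simpa [pow_two] using this
  refine constant_of_has_deriv_right_zero (fun x hx => ?_) hd t ⟨hst, le_rfl⟩
  have hL : ∀ u ∈ Icc s t, ∀ v ∈ Icc s t, |f v - f u| ≤ |C| * |v - u| ^ 2 := by
    intro u hu v hv
    rcases le_total u v with huv | huv
    · exact (h u hu v ⟨huv, hv.2⟩).trans (by
        rw [sq_abs]; exact mul_le_mul_of_nonneg_right (le_abs_self C) (sq_nonneg _))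
    · rw [abs_sub_comm, abs_sub_comm v]
      exact (h v hv u ⟨huv, hu.2⟩).trans (by
        rw [sq_abs]; exact mul_le_mul_of_nonneg_right (le_abs_self C) (sq_nonneg _))
  refine tendsto_iff_norm_sub_tendsto_zero.2 (squeeze_zero' (Filter.Eventually.of_forall
    fun _ => norm_nonneg _) (eventually_mem_nhdsWithin.mono fun v hv => hL x hx v hv) ?_)
  have : Continuous fun v : ℝ => |C| * |v - x| ^ 2 := by fun_prop
  simpa using (this.tendsto x).mono_left (nhdsWithin_le_nhds (s := Icc s t))

namespace Flow

variable {a b : ℝ → E3 → ℝ} (F : Flow a b) {s t Q Y : ℝ}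
include F

lemma abs_integral_chi_mul_pot_sub_le {a' b' : E3 → ℝ} (ha' : Nice a') (hb' : Nice b')
    {g h : E3 → ℝ} (cg : Continuous g) (ch : Continuous h)
    (ih : Integrable fun x => h x ^ 2) (h0 : ∀ x, 0 ≤ h x)
    (hgh : ∀ x, |g x| ≤ h x * √(den a' b' x)) (hs : 0 ≤ s) (hst : s ≤ t)
    (hM : ∀ τ ∈ Icc s t, ∫ x, den (a τ) (b τ) x ≤ Q)
    (hK : ∀ τ ∈ Icc s t, ∫ x, gsq (a τ) (b τ) x ≤ Q) (hK' : ∫ x, gsq a' b' x ≤ Q) (k : ℕ) :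
    |∫ x, chi k x * g x * (pot (a t) (b t) x - pot (a s) (b s) x)| ≤
      √(∫ x, h x ^ 2) * (4 * Q) * √Q * (t - s) := by
  have hQ := (integral_gsq_nonneg _ _).trans hK'
  have := abs_integral_pot_sub_le F ha' hb' (Real.sqrt_nonneg Q)
    (g := fun x => chi k x * g x) ((continuous_chi k).mul cg) (hasCompactSupport_chi k).mul_right
    ch ih h0 (fun x => (by
      rw [abs_mul, abs_of_nonneg (chi_nonneg k x)]
      exact (mul_le_of_le_one_left (abs_nonneg _) (chi_le_one k x)).trans (hgh x)))
    hs hst (S := 2 * √Q) (Q := Q) (fun τ hτ y => (F.na τ).hardy_le (F.nb τ) (hK τ hτ) y)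
    (fun y => ha'.hardy_le hb' hK' y) (fun τ hτ => (Real.sq_sqrt hQ).symm ▸ hK τ hτ) hM hK
  rwa [mul_pow, Real.sq_sqrt hQ, show (2 : ℝ) ^ 2 = 4 by norm_num] at this

lemma abs_energy_sub_le (hs : 0 ≤ s) (hst : s ≤ t) (hY : 0 ≤ Y)
    (hM : ∀ τ ∈ Icc s t, ∫ x, den (a τ) (b τ) x ≤ Q)
    (hK : ∀ τ ∈ Icc s t, ∫ x, gsq (a τ) (b τ) x ≤ Q)
    (hD : ∀ τ ∈ Icc s t, ∫ x, den (dt a τ) (dt b τ) x ≤ Y ^ 2) :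
    |energy (a t) (b t) - energy (a s) (b s)| ≤ 8 * Q * √Q * Y * (t - s) ^ 2 := by
  set V : ℝ → E3 → ℝ := fun τ => pot (a τ) (b τ) with hV
  have cV : ∀ τ, Continuous (V τ) := fun τ => (F.na τ).continuous_pot (F.nb τ)
  have jd : Joint 2 fun t => den (a t) (b t) := F.ja.den F.jb
  set d : ℝ → E3 → ℝ := dt fun t => den (a t) (b t) with hd
  have cd : ∀ τ, Continuous (d τ) := fun τ => ((jd.dt (n := 1)).slice τ).continuous
  have hd_eq : ∀ τ x, d τ x = 2 * (a τ x * dt a τ x + b τ x * dt b τ x) := fun τ x =>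
    Joint.dt_den (F.ja.of_le one_le_two) (F.jb.of_le one_le_two) τ x
  have cat : ∀ τ, Continuous (dt a τ) := fun τ => ((F.ja.dt (n := 1)).slice τ).continuous
  have cbt : ∀ τ, Continuous (dt b τ) := fun τ => ((F.jb.dt (n := 1)).slice τ).continuous
  set h : ℝ → E3 → ℝ := fun τ x => 2 * √(den (dt a τ) (dt b τ) x) with hh
  have hsq : ∀ τ, (fun x => h τ x ^ 2) = fun x => 4 * den (dt a τ) (dt b τ) x := fun τ => by
    ext x; rw [hh]; simp only
    rw [mul_pow, Real.sq_sqrt (den_nonneg _ _ _)]; norm_num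
  have hgh : ∀ τ x, |d τ x| ≤ h τ x * √(den (a τ) (b τ) x) := fun τ x => by
    rw [hd_eq, abs_mul, abs_two, hh, mul_assoc]
    refine mul_le_mul_of_nonneg_left ?_ two_pos.le
    rw [← Real.sqrt_mul (den_nonneg _ _ _)]
    refine Real.abs_le_sqrt ?_
    unfold den
    nlinarith [sq_nonneg (dt a τ x * b τ x - dt b τ x * a τ x)]
  have ch : ∀ τ, Continuous (h τ) := fun τ =>
    ((((cat τ).pow 2).add ((cbt τ).pow 2)).sqrt).const_mul 2
  have key : ∀ k : ℕ,
      |((∫ x, chi k x * gsq (a t) (b t) x) + ∫ x, (chi k x * (V s x + V t x)) * den (a t) (b t) x) -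
        ((∫ x, chi k x * gsq (a s) (b s) x) +
          ∫ x, (chi k x * (V s x + V t x)) * den (a s) (b s) x)| ≤
      8 * Q * √Q * Y * (t - s) ^ 2 +
        ((Q + 3 * Y ^ 2) * cc * (t - s)) * ((k : ℝ) + 1)⁻¹ := by
    intro k
    have := abs_sub_le_of_abs_deriv_le
      (f := fun τ => (∫ x, chi k x * gsq (a τ) (b τ) x) +
        ∫ x, (chi k x * (V s x + V t x)) * den (a τ) (b τ) x) hst
      (fun τ _ => (F.joint_gsq.hasDerivAt_integral (continuous_chi k)
        (hasCompactSupport_chi k) τ).fun_add ((jd.of_le one_le_two).hasDerivAt_integral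
          ((continuous_chi k).mul ((cV s).add (cV t))) (hasCompactSupport_chi k).mul_right τ))
      (fun τ _ => (hasDerivAt_id τ).const_mul
        (8 * Q * √Q * Y * (t - s) + (Q + 3 * Y ^ 2) * (cc * ((k : ℝ) + 1)⁻¹))) ?_
    · refine this.trans (le_of_eq ?_)
      simp only [id]; ring
    intro τ hτ
    have hτ0 := hs.trans hτ.1
    have na := F.na τ
    have nb := F.nb τ
    have iχ : ∀ f : E3 → ℝ, Continuous f → Integrable fun x => chi k x * d τ x * f x := fun f hf =>
      integrable_mul_of_compactSupport ((continuous_chi k).mul (cd τ))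
        (hasCompactSupport_chi k).mul_right hf
    have e : (∫ x, chi k x * dt (fun t => gsq (a t) (b t)) τ x) +
        (∫ x, (chi k x * (V s x + V t x)) * dt (fun t => den (a t) (b t)) τ x) =
        (∫ x, chi k x * d τ x * (V t x - V τ x)) - (∫ x, chi k x * d τ x * (V τ x - V s x)) -
        2 * ∫ x, ∑ i, pd i (chi k) x * (pd i (a τ) x * dt a τ x + pd i (b τ) x * dt b τ x) := by
      rw [F.integral_chi_dt_gsq hτ0]
      have e1 : (∫ x, (chi k x * (V s x + V t x)) * dt (fun t => den (a t) (b t)) τ x) =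
          (∫ x, chi k x * d τ x * V s x) + ∫ x, chi k x * d τ x * V t x := by
        rw [← integral_add (iχ _ (cV s)) (iχ _ (cV t))]
        congr 1; ext x; rw [hd]; ring
      have e2 : ∀ u v, ∫ x, chi k x * d τ x * (V u x - V v x) =
          (∫ x, chi k x * d τ x * V u x) - ∫ x, chi k x * d τ x * V v x := fun u v => by
        rw [← integral_sub (iχ _ (cV u)) (iχ _ (cV v))]
        congr 1; ext x; ring
      rw [e1, e2, e2]; ring
    simp only [Pi.mul_apply, Pi.add_apply]
    rw [e, mul_one]
    have hb := integrable_den_dt F hτ0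
    have hdn := integral_den_nonneg (dt a τ) (dt b τ)
    have hh2 : √(∫ x, h τ x ^ 2) ≤ 2 * Y := by
      rw [hsq, integral_const_mul]
      refine Real.sqrt_le_iff.2 ⟨by positivity, ?_⟩
      linarith [hD τ hτ]
    have ih : Integrable fun x => h τ x ^ 2 := by rw [hsq]; exact hb.const_mul 4
    have hQ := (integral_gsq_nonneg _ _).trans (hK τ hτ)
    have b1 := F.abs_integral_chi_mul_pot_sub_le na nb (cd τ) (ch τ) ih (fun x => by positivity)
      (hgh τ) hτ0 hτ.2 (fun r hr => hM r ⟨hτ.1.trans hr.1, hr.2⟩)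
      (fun r hr => hK r ⟨hτ.1.trans hr.1, hr.2⟩) (hK τ hτ) k
    have b2 := F.abs_integral_chi_mul_pot_sub_le na nb (cd τ) (ch τ) ih (fun x => by positivity)
      (hgh τ) hs hτ.1 (fun r hr => hM r ⟨hr.1, hr.2.trans hτ.2⟩)
      (fun r hr => hK r ⟨hr.1, hr.2.trans hτ.2⟩) (hK τ hτ) k
    have b3 := abs_integral_pd_chi_mul_le
      (v := fun i x => pd i (a τ) x * dt a τ x + pd i (b τ) x * dt b τ x)
      (((na.rd_gsq nb).integrable.const_mul (1 / 2)).add (hb.const_mul (3 / 2))) (fun x => by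
        have : ∀ i : Fin 3, |pd i (a τ) x * dt a τ x + pd i (b τ) x * dt b τ x| ≤
            1 / 2 * (pd i (a τ) x ^ 2 + pd i (b τ) x ^ 2) + 1 / 2 * den (dt a τ) (dt b τ) x :=
          fun i => by
            unfold den
            rw [abs_le]
            constructor <;> nlinarith [sq_nonneg (pd i (a τ) x + dt a τ x),
              sq_nonneg (pd i (a τ) x - dt a τ x), sq_nonneg (pd i (b τ) x + dt b τ x),
              sq_nonneg (pd i (b τ) x - dt b τ x)]
        refine (Finset.sum_le_sum fun i _ => this i).trans (le_of_eq ?_)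
        simp only [Pi.add_apply, gsq, Fin.sum_univ_three]; ring) k
    rw [integral_add' ((na.rd_gsq nb).integrable.const_mul _) (hb.const_mul _),
      integral_const_mul, integral_const_mul] at b3
    have hc : 0 ≤ cc * ((k : ℝ) + 1)⁻¹ := mul_nonneg cc_pos.le (by positivity)
    have b4 : cc * ((k : ℝ) + 1)⁻¹ * (1 / 2 * (∫ x, gsq (a τ) (b τ) x) +
        3 / 2 * ∫ x, den (dt a τ) (dt b τ) x) ≤ cc * ((k : ℝ) + 1)⁻¹ * ((Q + 3 * Y ^ 2) / 2) :=
      mul_le_mul_of_nonneg_left (by linarith [hK τ hτ, hD τ hτ]) hc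
    have b5 : ∀ w, 0 ≤ w → √(∫ x, h τ x ^ 2) * (4 * Q) * √Q * w ≤ 8 * Q * √Q * Y * w :=
      fun w hw => by
        calc _ ≤ 2 * Y * (4 * Q) * √Q * w := by gcongr
          _ = _ := by ring
    have b6 := b1.trans (b5 _ (sub_nonneg.2 hτ.2))
    have b7 := b2.trans (b5 _ (sub_nonneg.2 hτ.1))
    have b8 := b3.trans b4
    rw [abs_le] at b6 b7 b8 ⊢
    simp only [hV]
    constructor <;> nlinarith [b6.1, b6.2, b7.1, b7.2, b8.1, b8.2]
  refine le_of_tendsto_add_inv ?_ key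
  have i1 : ∀ u v, Integrable fun x => den (a u) (b u) x * V v x := fun u v =>
    (F.na v).integrable_den_mul_pot (F.nb v) (F.na u) (F.nb u)
  have T : ∀ τ, Filter.Tendsto (fun k => (∫ x, chi k x * gsq (a τ) (b τ) x) +
      ∫ x, (chi k x * (V s x + V t x)) * den (a τ) (b τ) x) Filter.atTop
      (𝓝 ((∫ x, gsq (a τ) (b τ) x) + ((∫ x, den (a τ) (b τ) x * V s x) +
        ∫ x, den (a τ) (b τ) x * V t x))) := fun τ => by
    refine (tendsto_integral_chi_mul ((F.na τ).rd_gsq (F.nb τ)).integrable).add ?_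
    rw [← integral_add (i1 τ s) (i1 τ t)]
    refine (tendsto_integral_chi_mul ((i1 τ s).add (i1 τ t))).congr fun k => ?_
    congr 1; ext x; simp only [Pi.add_apply]; ring
  have h1 := integral_den_mul_pot_comm (F.na s) (F.nb s) (F.na t) (F.nb t)
  convert (T t).sub (T s) using 2
  unfold energy
  rw [hV]; simp only
  rw [h1]; ring

lemma abs_potential_sub_le (hs : 0 ≤ s) (hst : s ≤ t)
    (hM : ∀ τ ∈ Icc s t, ∫ x, den (a τ) (b τ) x ≤ Q)
    (hK : ∀ τ ∈ Icc s t, ∫ x, gsq (a τ) (b τ) x ≤ Q) :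
    |(∫ x, den (a t) (b t) x * pot (a t) (b t) x) - ∫ x, den (a s) (b s) x * pot (a s) (b s) x| ≤
      8 * Q ^ 2 * (t - s) := by
  set V : ℝ → E3 → ℝ := fun τ => pot (a τ) (b τ) with hV
  have i1 : ∀ u v, Integrable fun x => den (a u) (b u) x * V v x := fun u v =>
    (F.na v).integrable_den_mul_pot (F.nb v) (F.na u) (F.nb u)
  have hb : ∀ τ ∈ Icc s t, |∫ x, den (a τ) (b τ) x * (V t x - V s x)| ≤ 4 * Q ^ 2 * (t - s) := by
    intro τ hτ
    have na := F.na τ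
    have nb := F.nb τ
    have hQ := (integral_gsq_nonneg _ _).trans (hK τ hτ)
    have cd : Continuous (den (a τ) (b τ)) := na.continuous_den nb
    have hsq : (fun x => √(den (a τ) (b τ) x) ^ 2) = den (a τ) (b τ) := by
      ext x; exact Real.sq_sqrt (den_nonneg _ _ _)
    have key : ∀ k, |∫ x, chi k x * (den (a τ) (b τ) x * (V t x - V s x))| ≤
        4 * Q ^ 2 * (t - s) + 0 * ((k : ℝ) + 1)⁻¹ := fun k => by
      have := F.abs_integral_chi_mul_pot_sub_le na nb cd cd.sqrt
        (by rw [hsq]; exact (na.rd_den nb).integrable) (fun x => Real.sqrt_nonneg _)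
        (fun x => by
          rw [Real.mul_self_sqrt (den_nonneg _ _ _), abs_of_nonneg (den_nonneg _ _ _)])
        hs hst hM hK (hK τ hτ) k
      rw [hsq] at this
      simp_rw [mul_assoc] at this
      refine this.trans ?_
      have h1 : √(∫ x, den (a τ) (b τ) x) * √Q ≤ Q := by
        calc _ ≤ √Q * √Q := by gcongr; exact hM τ hτ
          _ = Q := Real.mul_self_sqrt hQ
      have h2 := mul_le_mul_of_nonneg_right h1 (mul_nonneg (by positivity : 0 ≤ 4 * Q)
        (sub_nonneg.2 hst))
      linarith
    refine le_of_tendsto_add_inv (tendsto_integral_chi_mul ?_) key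
    exact ((i1 τ t).sub (i1 τ s)).congr (Filter.Eventually.of_forall fun x => by
      simp only [Pi.sub_apply]; ring)
  have e : ∀ τ, ∫ x, den (a τ) (b τ) x * (V t x - V s x) =
      (∫ x, den (a τ) (b τ) x * V t x) - ∫ x, den (a τ) (b τ) x * V s x := fun τ => by
    rw [← integral_sub (i1 τ t) (i1 τ s)]
    congr 1; ext x; ring
  have h1 := hb s ⟨le_rfl, hst⟩
  have h2 := hb t ⟨hst, le_rfl⟩
  rw [e] at h1 h2
  have h3 := integral_den_mul_pot_comm (F.na s) (F.nb s) (F.na t) (F.nb t)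
  simp only [hV] at h1 h2 ⊢
  rw [h3] at h2
  rw [abs_le] at *
  constructor <;> linarith [h1.1, h1.2, h2.1, h2.2]

lemma integral_den_dt_le_of_bounded (hs : 0 ≤ s)
    (hM : ∀ τ ∈ Icc s t, ∫ x, den (a τ) (b τ) x ≤ Q)
    (hK : ∀ τ ∈ Icc s t, ∫ x, gsq (a τ) (b τ) x ≤ Q) {τ : ℝ} (hτ : τ ∈ Icc s t) :
    ∫ x, den (dt a τ) (dt b τ) x ≤ (√(speed Q (a s) (b s)) + 4 * Q * √Q * (t - s)) ^ 2 := by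
  have hQ := (integral_gsq_nonneg _ _).trans (hK τ hτ)
  have hsub : ∀ r ∈ Icc s τ, r ∈ Icc s t := fun r hr => ⟨hr.1, hr.2.trans hτ.2⟩
  have := F.integral_den_dt_le hs hτ.1 (Real.sqrt_nonneg Q) (S := fun _ => 2 * √Q)
    (B := fun r => 4 * Q * √Q * r) (β := fun _ => 4 * Q * √Q)
    (fun r hr => hM r (hsub r hr)) (fun r hr => hK r (hsub r hr))
    (fun r hr => (Real.sq_sqrt hQ).symm ▸ hK r (hsub r hr))
    (fun r hr r' hr' y => (F.na r').hardy_le (F.nb r') (hK r' (hsub r' ⟨hr.1.trans hr'.1, hr'.2⟩)) y)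
    (fun r _ => by simpa using (hasDerivAt_id r).const_mul (4 * Q * √Q))
    (fun r _ => by rw [mul_pow, Real.sq_sqrt hQ]; norm_num)
  refine this.trans (pow_le_pow_left₀ (add_nonneg (Real.sqrt_nonneg _) ?_) ?_ 2)
  · have := mul_nonneg (by positivity : 0 ≤ 4 * Q * √Q) (sub_nonneg.2 hτ.1); linarith
  · have := mul_le_mul_of_nonneg_left hτ.2 (by positivity : 0 ≤ 4 * Q * √Q)
    linarith

lemma energy_eq (hs : 0 ≤ s) (hst : s ≤ t)
    (hM : ∀ τ ∈ Icc s t, ∫ x, den (a τ) (b τ) x ≤ Q)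
    (hK : ∀ τ ∈ Icc s t, ∫ x, gsq (a τ) (b τ) x ≤ Q) :
    energy (a t) (b t) = energy (a s) (b s) := by
  have hQ := (integral_gsq_nonneg _ _).trans (hK s ⟨le_rfl, hst⟩)
  set Y := √(speed Q (a s) (b s)) + 4 * Q * √Q * (t - s)
  have hY : 0 ≤ Y := add_nonneg (Real.sqrt_nonneg _)
    (mul_nonneg (by positivity) (sub_nonneg.2 hst))
  refine eq_of_abs_sub_le_sq (f := fun τ => energy (a τ) (b τ)) (C := 8 * Q * √Q * Y) hst
    fun u hu v hv => ?_
  have hsub : ∀ r ∈ Icc u v, r ∈ Icc s t := fun r hr => ⟨hu.1.trans hr.1, hr.2.trans hv.2⟩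
  exact F.abs_energy_sub_le (hs.trans hu.1) hv.1 hY (fun r hr => hM r (hsub r hr))
    (fun r hr => hK r (hsub r hr))
    (fun r hr => F.integral_den_dt_le_of_bounded hs hM hK (hsub r hr))

end Flow

lemma bounded_on_Icc_of_eventually {N : ℝ → ℝ} {s t : ℝ}
    (h : ∀ x ∈ Icc s t, ∃ Q, ∀ᶠ τ in 𝓝 x, N τ ≤ Q) : ∃ Q, ∀ τ ∈ Icc s t, N τ ≤ Q := by
  refine isCompact_Icc.induction_on (p := fun S => ∃ Q, ∀ τ ∈ S, N τ ≤ Q) ⟨0, by simp⟩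
    (fun S T hST ⟨Q, hQ⟩ => ⟨Q, fun τ hτ => hQ τ (hST hτ)⟩)
    (fun S T ⟨Q, hQ⟩ ⟨Q', hQ'⟩ => ⟨max Q Q', fun τ hτ => hτ.elim
      (fun h => (hQ τ h).trans (le_max_left _ _)) fun h => (hQ' τ h).trans (le_max_right _ _)⟩)
    fun x hx => ?_
  obtain ⟨Q, hQ⟩ := h x hx
  exact ⟨{τ | N τ ≤ Q}, mem_nhdsWithin_of_mem_nhds hQ, Q, fun τ hτ => hτ⟩

lemma bounded_of_conserved {N g : ℝ → ℝ} (hN : ∀ c, IsClosed {t | N t ≤ c})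
    (hg : ∀ t, N t ≤ g t) {G : ℝ → ℝ} (hG : ∀ t c, N t ≤ c → g t ≤ G c)
    (hc : ∀ s t, s ≤ t → (∃ Q, ∀ τ ∈ Icc s t, N τ ≤ Q) → g s = g t) (s t : ℝ) :
    ∃ Q, ∀ τ ∈ Icc s t, N τ ≤ Q := by
  set U : Set ℝ := {x | ∃ Q, ∀ᶠ τ in 𝓝 x, N τ ≤ Q} with hU
  have oU : IsOpen U := isOpen_iff_mem_nhds.2 fun x ⟨Q, hQ⟩ =>
    (eventually_eventually_nhds.2 hQ).mono fun y hy => ⟨Q, hy⟩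
  suffices h : U = univ from
    bounded_on_Icc_of_eventually fun x _ => by have : x ∈ U := h ▸ mem_univ x; exact this
  by_contra hne
  obtain ⟨e₀, he₀⟩ := (ne_univ_iff_exists_notMem U).1 hne
  have cE : IsClosed Uᶜ := oU.isClosed_compl
  have : Nonempty ↥Uᶜ := ⟨⟨e₀, he₀⟩⟩
  have : CompleteSpace ↥Uᶜ := cE.completeSpace_coe
  obtain ⟨n, ⟨e, heE⟩, he⟩ := nonempty_interior_of_iUnion_of_closed
    (f := fun n : ℕ => {x : ↥Uᶜ | N x ≤ n}) (fun n => (hN n).preimage continuous_subtype_val)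
    (eq_univ_of_forall fun x => mem_iUnion.2 (exists_nat_ge (N x)))
  obtain ⟨δ, hδ, hball⟩ := Metric.mem_nhds_iff.1 (mem_interior_iff_mem_nhds.1 he)
  have hE : ∀ x ∈ Uᶜ, |x - e| < δ → N x ≤ n := fun x hx hd =>
    @hball ⟨x, hx⟩ (by rw [Metric.mem_ball, Subtype.dist_eq, Real.dist_eq]; exact hd)
  refine heE ⟨max n (G n), Metric.eventually_nhds_iff.2 ⟨δ, hδ, fun x hx => ?_⟩⟩
  rw [Real.dist_eq] at hx
  by_cases hxE : x ∈ Uᶜ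
  · exact (hE x hxE hx).trans (le_max_left _ _)
  refine le_trans ?_ (le_max_right _ _)
  have hxe : x ≠ e := fun h => hxE (h ▸ heE)
  rcases lt_or_gt_of_ne hxe with hlt | hgt
  · obtain ⟨α, ⟨hαE, hα⟩, hmin⟩ := (isCompact_Icc.inter_left cE).exists_isLeast
      ⟨e, heE, hlt.le, le_rfl⟩
    have hxα : x < α := lt_of_le_of_ne hα.1 fun h => hxE (h ▸ hαE)
    have hNα : N α ≤ n := hE α hαE (by
      rw [abs_lt] at hx ⊢; constructor <;> linarith [hα.1, hα.2])
    have hs : ∀ τ ∈ Ico x α, g x = g τ := fun τ hτ => hc x τ hτ.1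
      (bounded_on_Icc_of_eventually fun y hy => by
        by_contra hy'
        exact absurd (hmin ⟨hy', hy.1, (hy.2.trans hτ.2.le).trans hα.2⟩)
          (not_le.2 (hy.2.trans_lt hτ.2)))
    have := hc x α hxα.le ⟨max n (g x), fun τ hτ => by
      rcases hτ.2.eq_or_lt with h | h
      · exact h ▸ hNα.trans (le_max_left _ _)
      · exact ((hg τ).trans (hs τ ⟨hτ.1, h⟩).ge).trans (le_max_right _ _)⟩
    exact ((hg x).trans this.le).trans (hG α n hNα)
  · obtain ⟨α, ⟨hαE, hα⟩, hmax⟩ := (isCompact_Icc.inter_left cE).exists_isGreatest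
      ⟨e, heE, le_rfl, hgt.le⟩
    have hxα : α < x := lt_of_le_of_ne hα.2 fun h => hxE (h ▸ hαE)
    have hNα : N α ≤ n := hE α hαE (by
      rw [abs_lt] at hx ⊢; constructor <;> linarith [hα.1, hα.2])
    have hs : ∀ τ ∈ Ioc α x, g τ = g x := fun τ hτ => hc τ x hτ.2
      (bounded_on_Icc_of_eventually fun y hy => by
        by_contra hy'
        exact absurd (hmax ⟨hy', (hα.1.trans hτ.1.le).trans hy.1, hy.2⟩)
          (not_le.2 (hτ.1.trans_le hy.1)))
    have := hc α x hxα.le ⟨max n (g x), fun τ hτ => by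
      rcases hτ.1.eq_or_lt with h | h
      · exact h ▸ hNα.trans (le_max_left _ _)
      · exact ((hg τ).trans (hs τ ⟨h, hτ.2⟩).le).trans (le_max_right _ _)⟩
    exact ((hg x).trans this.ge).trans (hG α n hNα)

lemma potential_nonneg (a b : E3 → ℝ) : 0 ≤ ∫ x, den a b x * pot a b x :=
  integral_nonneg fun x => mul_nonneg (den_nonneg a b x) (pot_nonneg a b x)

lemma integral_gsq_le_energy (a b : E3 → ℝ) : ∫ x, gsq a b x ≤ energy a b :=
  le_add_of_nonneg_right (potential_nonneg a b)

lemma Nice.potential_le {a b : E3 → ℝ} (ha : Nice a) (hb : Nice b) {Q : ℝ}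
    (hM : ∫ x, den a b x ≤ Q) (hK : ∫ x, gsq a b x ≤ Q) :
    ∫ x, den a b x * pot a b x ≤ 5 * Q ^ 2 := by
  have hQ := (integral_den_nonneg _ _).trans hM
  calc _ ≤ ∫ x, den a b x * (5 * Q) := integral_mono (ha.integrable_den_mul_pot hb ha hb)
        ((ha.rd_den hb).integrable.mul_const _)
        fun x => mul_le_mul_of_nonneg_left (ha.pot_le_of_le hb hM hK x) (den_nonneg a b x)
    _ = (∫ x, den a b x) * (5 * Q) := integral_mul_const _ _
    _ ≤ Q * (5 * Q) := by gcongr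
    _ = _ := by ring

namespace Flow

variable {a b : ℝ → E3 → ℝ} (F : Flow a b) {s t : ℝ}
include F

lemma isClosed_mass_add_kinetic_le (c : ℝ) :
    IsClosed {t | (∫ x, den (a t) (b t) x) + ∫ x, gsq (a t) (b t) x ≤ c} := by
  have e : {t | (∫ x, den (a t) (b t) x) + ∫ x, gsq (a t) (b t) x ≤ c} =
      ⋂ k, {t | ∫ x, chi k x * (den (a t) (b t) x + gsq (a t) (b t) x) ≤ c} := by
    ext t
    have i1 := ((F.na t).rd_den (F.nb t)).integrable
    have i2 := ((F.na t).rd_gsq (F.nb t)).integrable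
    rw [mem_iInter, mem_ofPred_eq, ← integral_add i1 i2]
    refine ⟨fun h k => le_trans (integral_chi_mul_le k (i1.add i2) fun x =>
      add_nonneg (den_nonneg _ _ _) (gsq_nonneg _ _ _)) h, fun h => ?_⟩
    exact le_of_tendsto' (tendsto_integral_chi_mul (i1.add i2)) h
  rw [e]
  refine isClosed_iInter fun k => isClosed_le ?_ continuous_const
  refine continuous_iff_continuousAt.2 fun t => ?_
  exact (Joint.hasDerivAt_integral (((F.ja.den F.jb).of_le one_le_two).add F.joint_gsq)
    (continuous_chi k) (hasCompactSupport_chi k) t).continuousAt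

lemma exists_bound (T : ℝ) : ∃ Q, ∀ τ ∈ Icc 0 T,
    (∫ x, den (a τ) (b τ) x) ≤ Q ∧ ∫ x, gsq (a τ) (b τ) x ≤ Q := by
  set N : ℝ → ℝ := fun t => (∫ x, den (a t) (b t) x) + ∫ x, gsq (a t) (b t) x with hN
  set g : ℝ → ℝ := fun t => (∫ x, den (a t) (b t) x) + energy (a t) (b t) with hg
  have hmk : ∀ t c, N t ≤ c → (∫ x, den (a t) (b t) x) ≤ c ∧ ∫ x, gsq (a t) (b t) x ≤ c :=
    fun t c h => by
      have h1 := integral_den_nonneg (a t) (b t)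
      have h2 := integral_gsq_nonneg (a t) (b t)
      simp only [hN] at h
      constructor <;> linarith
  obtain ⟨Q, hQ⟩ := bounded_of_conserved (N := fun t => N (max t 0)) (g := fun t => g (max t 0))
    (G := fun c => c + 5 * c ^ 2) (fun c => (F.isClosed_mass_add_kinetic_le c).preimage (by fun_prop))
    (fun t => add_le_add_right (integral_gsq_le_energy _ _) _)
    (fun t c h => by
      have := (F.na (max t 0)).potential_le (F.nb _) (hmk _ _ h).1 (hmk _ _ h).2
      simp only [hN, hg, energy] at h ⊢
      linarith)
    (fun s t hst ⟨Q, hQ⟩ => by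
      have hQ' : ∀ τ ∈ Icc (max s 0) (max t 0), N τ ≤ Q := fun τ hτ => by
        have hτ0 : 0 ≤ τ := (le_max_right s 0).trans hτ.1
        rcases le_total t 0 with h | h
        · rw [max_eq_right h] at hτ
          have := hQ t ⟨hst, le_rfl⟩
          rwa [max_eq_right h, ← le_antisymm hτ.2 hτ0] at this
        · rw [max_eq_left h] at hτ
          have := hQ τ ⟨(le_max_left s 0).trans hτ.1, hτ.2⟩
          rwa [max_eq_left hτ0] at this
      have hM := fun τ hτ => (hmk τ Q (hQ' τ hτ)).1
      have hK := fun τ hτ => (hmk τ Q (hQ' τ hτ)).2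
      have h0 := le_max_right s 0
      have hst' := max_le_max_right 0 hst
      simp only [hg]
      rw [F.mass_eq h0 hst' hM hK, F.energy_eq h0 hst' hM hK]) 0 T
  refine ⟨Q, fun τ hτ => hmk τ Q ?_⟩
  simpa only [max_eq_left hτ.1] using hQ τ hτ

lemma mass_const (ht : 0 ≤ t) : ∫ x, den (a t) (b t) x = ∫ x, den (a 0) (b 0) x := by
  obtain ⟨Q, hQ⟩ := F.exists_bound t
  exact F.mass_eq le_rfl ht (fun τ hτ => (hQ τ hτ).1) fun τ hτ => (hQ τ hτ).2

lemma energy_const (ht : 0 ≤ t) : energy (a t) (b t) = energy (a 0) (b 0) := by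
  obtain ⟨Q, hQ⟩ := F.exists_bound t
  exact F.energy_eq le_rfl ht (fun τ hτ => (hQ τ hτ).1) fun τ hτ => (hQ τ hτ).2

lemma exists_uniform_bound : ∃ Q, 0 ≤ Q ∧ ∀ t, 0 ≤ t →
    (∫ x, den (a t) (b t) x) ≤ Q ∧ ∫ x, gsq (a t) (b t) x ≤ Q := by
  have h1 := integral_den_nonneg (a 0) (b 0)
  have h2 := (integral_gsq_nonneg (a 0) (b 0)).trans (integral_gsq_le_energy (a 0) (b 0))
  refine ⟨(∫ x, den (a 0) (b 0) x) + energy (a 0) (b 0), by linarith, fun t ht => ?_⟩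
  have h3 := integral_gsq_le_energy (a t) (b t)
  rw [F.energy_const ht] at h3
  rw [F.mass_const ht]
  constructor <;> linarith

end Flow

lemma pd_norm_sq (i : Fin 3) : pd i (fun x : E3 => ‖x‖ ^ 2) = fun x => 2 * x i := by
  ext x
  unfold pd
  rw [(hasStrictFDerivAt_norm_sq x).hasFDerivAt.fderiv]
  simp [EuclideanSpace.inner_single_right, two_mul]

lemma abs_coord_le (x : E3) (i : Fin 3) : |x i| ≤ ‖x‖ := by
  simpa using PiLp.norm_apply_le x i

lemma abs_cur_le (a b : E3 → ℝ) (i : Fin 3) (x : E3) :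
    |cur a b i x| ≤ √(den a b x) * √(gsq a b x) := by
  rw [← Real.sqrt_mul (den_nonneg a b x)]
  refine Real.abs_le_sqrt ?_
  have h1 : pd i a x ^ 2 + pd i b x ^ 2 ≤ gsq a b x :=
    Finset.single_le_sum (f := fun i => pd i a x ^ 2 + pd i b x ^ 2)
      (fun i _ => by positivity) (Finset.mem_univ i)
  refine le_trans ?_ (mul_le_mul_of_nonneg_left h1 (den_nonneg a b x))
  unfold cur den
  nlinarith [sq_nonneg (a x * pd i a x + b x * pd i b x)]

lemma Nice.rd_norm_sq_mul_den {a b : E3 → ℝ} (ha : Nice a) (hb : Nice b) :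
    RapidDecay fun x => ‖x‖ ^ 2 * den a b x :=
  (ha.rd_den hb).mul_of_le (by fun_prop) 1 2 fun x => by
    rw [abs_of_nonneg (by positivity)]; linarith

/-- The virial density `x · Im (ψ̄ ∇ψ)`. -/
def vir (a b : E3 → ℝ) (x : E3) : ℝ := ∑ i, x i * cur a b i x

lemma Nice.rd_vir {a b : E3 → ℝ} (ha : Nice a) (hb : Nice b) : RapidDecay (vir a b) :=
  .sum _ fun i => (ha.rd_cur hb i).coord_mul i

namespace Flow

variable {a b : ℝ → E3 → ℝ} (F : Flow a b) {s t : ℝ}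
include F

lemma hasDerivAt_integral_mul_den (ht : 0 ≤ t) {φ : E3 → ℝ} (hφ : ContDiff ℝ 1 φ)
    (hc : HasCompactSupport φ) : HasDerivAt (fun t => ∫ x, φ x * den (a t) (b t) x)
      (∫ x, ∑ i, pd i φ x * cur (a t) (b t) i x) t := by
  have h := ((F.ja.den F.jb).of_le one_le_two).hasDerivAt_integral hφ.continuous hc t
  have e := integral_mul_curl hφ hc (F.na t).smooth (F.nb t).smooth
  convert h using 1
  simp_rw [F.dt_den ht, mul_neg, integral_neg, e, neg_neg]

lemma exists_moment_bound (T : ℝ) :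
    ∃ J, 0 ≤ J ∧ ∀ τ ∈ Icc 0 T, ∫ x, ‖x‖ ^ 2 * den (a τ) (b τ) x ≤ J := by
  obtain ⟨Q, hQ0, hQ⟩ := F.exists_uniform_bound
  set φ : ℕ → E3 → ℝ := fun k x => chi k x ^ 2 * ‖x‖ ^ 2 with hφ
  have cφ : ∀ k, ContDiff ℝ 1 (φ k) := fun k => (contDiff_chi k).pow 2 |>.mul (contDiff_norm_sq ℝ)
  have sφ : ∀ k, HasCompactSupport (φ k) := fun k =>
    HasCompactSupport.mul_right ((hasCompactSupport_chi k).comp_left (g := (· ^ 2)) (by norm_num))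
  have hpd : ∀ k i x, |pd i (φ k) x| ≤ 2 * (cc + 1) * (chi k x * ‖x‖) := fun k i x => by
    have d1 : Differentiable ℝ (chi k) := (contDiff_chi k (n := 1)).differentiable one_ne_zero
    have d2 : Differentiable ℝ fun x : E3 => ‖x‖ ^ 2 :=
      (contDiff_norm_sq ℝ (n := 1)).differentiable one_ne_zero
    rw [hφ]; simp only
    rw [pd_mul (d1.fun_pow 2) d2, pd_sq d1, pd_norm_sq]
    have h0 := chi_nonneg k x
    have h1 : ‖x‖ * |pd i (chi k) x| ≤ cc := by
      have e := pd_chi_le k i x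
      have : ((k : ℝ) + 1)⁻¹ ≤ 1 := inv_le_one_of_one_le₀ (by linarith [k.cast_nonneg (α := ℝ)])
      have := mul_le_of_le_one_right cc_pos.le this
      nlinarith [abs_nonneg (pd i (chi k) x)]
    calc |2 * chi k x * pd i (chi k) x * ‖x‖ ^ 2 + chi k x ^ 2 * (2 * x i)|
        ≤ 2 * chi k x * ‖x‖ * (‖x‖ * |pd i (chi k) x|) + 2 * chi k x * (chi k x * |x i|) := by
          refine (abs_add_le _ _).trans (le_of_eq ?_)
          simp only [abs_mul, abs_pow, abs_two, abs_of_nonneg h0, abs_norm]; ring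
      _ ≤ 2 * chi k x * ‖x‖ * cc + 2 * chi k x * (1 * ‖x‖) := by
          gcongr
          · exact chi_le_one k x
          · exact abs_coord_le x i
      _ = _ := by ring
  set C := 6 * (cc + 1) with hC
  have hC0 : 0 ≤ C := by have := cc_pos; positivity
  set f : ℕ → ℝ → ℝ := fun k τ => ∫ x, φ k x * den (a τ) (b τ) x with hf
  have f0 : ∀ k τ, 0 ≤ f k τ := fun k τ => integral_nonneg fun x =>
    mul_nonneg (by positivity) (den_nonneg _ _ _)
  have fle : ∀ k τ, f k τ ≤ ∫ x, ‖x‖ ^ 2 * den (a τ) (b τ) x := fun k τ => by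
    refine integral_mono (integrable_mul_of_compactSupport (cφ k).continuous (sφ k)
      ((F.na τ).continuous_den (F.nb τ))) ((F.na τ).rd_norm_sq_mul_den (F.nb τ)).integrable
      fun x => mul_le_mul_of_nonneg_right ?_ (den_nonneg _ _ _)
    exact mul_le_of_le_one_left (by positivity)
      (pow_le_one₀ (chi_nonneg k x) (chi_le_one k x))
  have hd : ∀ k, ∀ τ, 0 ≤ τ → |∫ x, ∑ i, pd i (φ k) x * cur (a τ) (b τ) i x| ≤
      C * √(f k τ) * √Q := fun k τ hτ => by
    have na := F.na τ
    have nb := F.nb τ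
    have h := (integral_le_sqrt_mul_sqrt
      (u := fun x => ∑ i, pd i (φ k) x * cur (a τ) (b τ) i x)
      (f := fun x => C ^ 2 * (φ k x * den (a τ) (b τ) x))
      ((integrable_mul_of_compactSupport (cφ k).continuous (sφ k)
        (na.continuous_den nb)).const_mul _) (na.rd_gsq nb).integrable
      (continuous_finsetSum _ fun i _ => (continuous_pd (cφ k)).mul
        (na.rd_cur nb i).cont).aestronglyMeasurable
      (fun x => mul_nonneg (sq_nonneg _) (mul_nonneg (by positivity) (den_nonneg _ _ _)))
      (fun x => gsq_nonneg _ _ x) (fun x => by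
        have e : √(C ^ 2 * (φ k x * den (a τ) (b τ) x)) =
            C * (chi k x * ‖x‖ * √(den (a τ) (b τ) x)) := by
          rw [Real.sqrt_mul (sq_nonneg _), Real.sqrt_sq hC0, Real.sqrt_mul (by positivity)]
          simp only [hφ]
          rw [← mul_pow, Real.sqrt_sq (mul_nonneg (chi_nonneg k x) (norm_nonneg _))]
        rw [e]
        refine (Finset.abs_sum_le_sum_abs _ _).trans ?_
        calc ∑ i, |pd i (φ k) x * cur (a τ) (b τ) i x|
            ≤ ∑ _i : Fin 3, 2 * (cc + 1) * (chi k x * ‖x‖) *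
              (√(den (a τ) (b τ) x) * √(gsq (a τ) (b τ) x)) :=
              Finset.sum_le_sum fun i _ => by
                rw [abs_mul]
                exact mul_le_mul (hpd k i x) (abs_cur_le _ _ i x) (abs_nonneg _)
                  ((abs_nonneg _).trans (hpd k i x))
          _ = _ := by
              rw [Finset.sum_const, Finset.card_univ, Fintype.card_fin, hC]; simp; ring)).2
    refine h.trans ?_
    rw [integral_const_mul, Real.sqrt_mul (sq_nonneg _), Real.sqrt_sq hC0]
    have := (hQ τ hτ).2
    gcongr
  have hlip : ∀ k, ∀ τ ∈ Icc 0 T, √(f k τ + 1) ≤ √(f k 0 + 1) + C * √Q * T := fun k τ hτ => by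
    have := abs_sub_le_of_abs_deriv_le (f := fun τ => √(f k τ + 1)) hτ.1
      (fun r hr => ((F.hasDerivAt_integral_mul_den hr.1 (cφ k) (sφ k)).add_const 1).sqrt
        (add_pos_of_nonneg_of_pos (f0 k r) one_pos).ne')
      (fun r _ => (hasDerivAt_id r).const_mul (C * √Q)) (fun r hr => ?_)
    · have h1 := (abs_le.1 this).2
      have h2 := mul_le_mul_of_nonneg_left hτ.2 (by positivity : 0 ≤ C * √Q)
      simp only [id] at h1
      linarith
    · have hp : 0 < √(f k r + 1) := Real.sqrt_pos.2 (add_pos_of_nonneg_of_pos (f0 k r) one_pos)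
      have h1 := hd k r hr.1
      have h2 : √(f k r) ≤ √(f k r + 1) := Real.sqrt_le_sqrt (by linarith)
      rw [abs_div, abs_of_pos (mul_pos two_pos hp), div_le_iff₀ (mul_pos two_pos hp)]
      refine h1.trans ?_
      calc C * √(f k r) * √Q ≤ C * √(f k r + 1) * √Q := by gcongr
        _ ≤ _ := by
          have : 0 ≤ C * √Q * √(f k r + 1) := by positivity
          linarith
  set J₀ := ∫ x, ‖x‖ ^ 2 * den (a 0) (b 0) x with hJ₀
  refine ⟨(√(J₀ + 1) + C * √Q * T) ^ 2, sq_nonneg _, fun τ hτ => ?_⟩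
  have i1 := ((F.na τ).rd_norm_sq_mul_den (F.nb τ)).integrable
  refine (integrable_and_integral_le_of_tendsto (F := fun k x => φ k x * den (a τ) (b τ) x)
    (fun k => integrable_mul_of_compactSupport (cφ k).continuous (sφ k)
      ((F.na τ).continuous_den (F.nb τ)))
    (fun k => Filter.Eventually.of_forall fun x => mul_nonneg (by positivity) (den_nonneg _ _ _))
    (fun k => ?_) (Filter.Eventually.of_forall fun x => ?_)).2
  · have h1 := hlip k τ hτ
    have h2 : √(f k 0 + 1) ≤ √(J₀ + 1) := Real.sqrt_le_sqrt (by linarith [fle k 0])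
    have h3 : √(f k τ + 1) ≤ √(J₀ + 1) + C * √Q * T := by linarith
    have h4 := (Real.sqrt_le_left ((Real.sqrt_nonneg _).trans h3)).1 h3
    exact (le_add_of_nonneg_right zero_le_one).trans h4
  · have := (((tendsto_chi x).pow 2).mul_const (‖x‖ ^ 2)).mul_const (den (a τ) (b τ) x)
    simpa using this

end Flow

/-- The generator `div (x n)` of mass-preserving dilations applied to the density. -/
def dil (a b : E3 → ℝ) (x : E3) : ℝ := (∑ i, x i * pd i (den a b) x) + 3 * den a b x

section FixedTime

variable {a b : E3 → ℝ} (ha : Nice a) (hb : Nice b)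
include ha hb

lemma Nice.rd_dil : RapidDecay (dil a b) :=
  (RapidDecay.sum _ fun i => (ha.rd_pd_den hb i).coord_mul i).add ((ha.rd_den hb).const_mul 3)

lemma pd_coord_mul_den (i : Fin 3) :
    pd i (fun x => x i * den a b x) = fun x => den a b x + x i * pd i (den a b) x := by
  rw [pd_mul (by fun_prop) ((ha.smooth_den hb).differentiable two_ne_zero), pd_coord]
  simp

lemma integral_dil_mul_kap {ε : ℝ} (hε : 0 < ε) (y : E3) :
    ∫ x, dil a b x * kap ε y x =
      ∫ x, (∑ i, x i * (x i - y i)) * kap ε y x ^ 3 * den a b x := by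
  have rdn := ha.rd_den hb
  have e1 : ∀ x, dil a b x * kap ε y x =
      ∑ i, kap ε y x * pd i (fun x => x i * den a b x) x := fun x => by
    simp_rw [pd_coord_mul_den ha hb, dil, Fin.sum_univ_three]; ring
  have rp : ∀ i, RapidDecay (pd i fun x => x i * den a b x) := fun i => by
    rw [pd_coord_mul_den ha hb]
    exact rdn.add ((ha.rd_pd_den hb i).coord_mul i)
  have bk : ∀ x, |kap ε y x| ≤ (√ε)⁻¹ := fun x => by
    rw [abs_of_pos (kap_pos hε _ _)]; exact kap_le hε _ _
  have hk2 : ∀ x, kap ε y x ^ 2 ≤ ε⁻¹ := fun x => by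
    calc kap ε y x ^ 2 ≤ ((√ε)⁻¹) ^ 2 := pow_le_pow_left₀ (kap_pos hε _ _).le (kap_le hε _ _) 2
      _ = ε⁻¹ := by rw [inv_pow, Real.sq_sqrt hε.le]
  have bp : ∀ i x, |pd i (kap ε y) x| ≤ ε⁻¹ := fun i x => by
    rw [pd_kap hε]; simp only
    have h1 := abs_coord_mul_kap_le hε x y i
    have h0 := kap_pos hε x y
    rw [abs_mul, abs_neg, abs_pow, abs_of_pos h0]
    calc |x i - y i| * kap ε y x ^ 3 = |x i - y i| * kap ε y x * kap ε y x ^ 2 := by ring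
      _ ≤ 1 * ε⁻¹ := by gcongr; exact hk2 x
      _ = ε⁻¹ := one_mul _
  have hI : ∀ i, ∫ x, kap ε y x * pd i (fun x => x i * den a b x) x =
      -∫ x, pd i (kap ε y) x * (x i * den a b x) := fun i =>
    integral_mul_pd (C := max (√ε)⁻¹ ε⁻¹) ((contDiff_kap hε y (n := 1)))
      (fun x => (bk x).trans (le_max_left _ _)) (fun x => (bp i x).trans (le_max_right _ _))
      ((by fun_prop : Differentiable ℝ fun x : E3 => x i).mul
        ((ha.smooth_den hb).differentiable two_ne_zero)) (rdn.coord_mul i) (rp i)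
  have ck : Continuous (kap ε y) := (contDiff_kap hε y (n := 0)).continuous
  have cp : ∀ i, Continuous (pd i (kap ε y)) := fun i =>
    continuous_pd (contDiff_kap hε y (n := 1))
  simp_rw [e1]
  rw [integral_finsetSum _ fun i _ => (rp i).integrable.bdd_mul ck.aestronglyMeasurable
    (Filter.Eventually.of_forall bk)]
  simp_rw [hI, ← integral_neg]
  rw [← integral_finsetSum _ fun i _ => ((rdn.coord_mul i).integrable.bdd_mul
    (cp i).aestronglyMeasurable (Filter.Eventually.of_forall (bp i))).fun_neg]
  congr 1; ext x
  simp_rw [pd_kap hε, Fin.sum_univ_three]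
  ring

lemma integral_dil_mul_integral_kap {ε : ℝ} (hε : 0 < ε) :
    2 * ∫ x, dil a b x * ∫ y, kap ε x y * den a b y =
      ∫ y, den a b y * ∫ x, (kap ε y x - ε * kap ε y x ^ 3) * den a b x := by
  have rdn := ha.rd_den hb
  have cdn := ha.continuous_den hb
  set G : E3 → E3 → ℝ := fun x y =>
    (∑ i, x i * (x i - y i)) * kap ε y x ^ 3 * den a b x * den a b y with hG
  have cG : Continuous fun p : E3 × E3 => G p.1 p.2 := by
    have h := continuous_kap₂ hε
    simp only [hG]
    fun_prop
  have iG : Integrable (fun p : E3 × E3 => G p.1 p.2) (volume.prod volume) := by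
    have i1 : Integrable fun x : E3 => ∑ i, |x i * den a b x| :=
      integrable_finsetSum _ fun i _ => (rdn.coord_mul i).integrable.abs
    refine ((i1.mul_prod rdn.integrable).const_mul ε⁻¹).mono' cG.aestronglyMeasurable
      (Filter.Eventually.of_forall fun p => ?_)
    obtain ⟨x, y⟩ := p
    have h0 := kap_pos hε x y
    have h2 : kap ε y x ^ 2 ≤ ε⁻¹ := by
      calc kap ε y x ^ 2 ≤ ((√ε)⁻¹) ^ 2 := pow_le_pow_left₀ h0.le (kap_le hε _ _) 2
        _ = ε⁻¹ := by rw [inv_pow, Real.sq_sqrt hε.le]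
    have h3 : |∑ i, x i * (x i - y i)| * kap ε y x ≤ ∑ i, |x i| := by
      calc _ ≤ (∑ i, |x i * (x i - y i)|) * kap ε y x :=
            mul_le_mul_of_nonneg_right (Finset.abs_sum_le_sum_abs _ _) h0.le
        _ = ∑ i, |x i| * (|x i - y i| * kap ε y x) := by
            rw [Finset.sum_mul]; refine Finset.sum_congr rfl fun i _ => ?_
            rw [abs_mul]; ring
        _ ≤ ∑ i, |x i| * 1 := by gcongr with i; exact abs_coord_mul_kap_le hε x y i
        _ = _ := by simp
    have dx := den_nonneg a b x
    have dy := den_nonneg a b y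
    simp only [hG, Real.norm_eq_abs, abs_mul, abs_pow, abs_of_pos h0, abs_of_nonneg dx,
      abs_of_nonneg dy, ← Finset.sum_mul]
    calc _ = (|∑ i, x i * (x i - y i)| * kap ε y x) * kap ε y x ^ 2 * den a b x * den a b y := by
          ring
      _ ≤ (∑ i, |x i|) * ε⁻¹ * den a b x * den a b y := by gcongr
      _ = _ := by ring
  have e1 : ∫ x, dil a b x * ∫ y, kap ε x y * den a b y = ∫ y, ∫ x, G x y := by
    rw [← integral_kap_swap ha hb hε (ha.rd_dil hb).integrable]
    congr 1; ext y
    rw [integral_dil_mul_kap ha hb hε, ← integral_mul_const]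
  have e2 : ∫ y, ∫ x, G x y = ∫ y, ∫ x, G y x := (integral_integral_swap iG).symm
  have iG1 : Integrable fun y => ∫ x, G x y := iG.integral_prod_right
  have iG2 : Integrable fun y => ∫ x, G y x := iG.integral_prod_left
  rw [two_mul, e1]
  nth_rewrite 2 [e2]
  rw [← integral_add iG1 iG2]
  refine integral_congr_ae ?_
  filter_upwards [iG.prod_right_ae, iG.prod_left_ae] with y h1 h2
  rw [← integral_add h2 h1,
    ← integral_const_mul]
  congr 1; ext x
  have h := kap_sq_mul hε x y
  have h' : kap ε y x - ε * kap ε y x ^ 3 = kap ε y x * (kap ε y x ^ 2 * ∑ i, (x i - y i) ^ 2) := by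
    rw [h]; ring
  rw [h']
  simp only [hG, kap_comm ε y x, Fin.sum_univ_three]
  ring

lemma integral_dil_mul_pot :
    ∫ x, dil a b x * pot a b x = 1 / 2 * ∫ x, den a b x * pot a b x := by
  have rdn := ha.rd_den hb
  set K := ∫ x, gsq a b x with hK
  set M := ∫ x, den a b x with hM
  have hin : ∀ {ε : ℝ}, 0 < ε → ∀ y : E3,
      Integrable (fun x => (kap ε y x - ε * kap ε y x ^ 3) * den a b x) ∧
      |(∫ x, (kap ε y x - ε * kap ε y x ^ 3) * den a b x) - 4 * π * pot a b y| ≤ √ε * (8 * K) := by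
    intro ε hε y
    have ck : Continuous (kap ε y) := (contDiff_kap hε y (n := 0)).continuous
    have hs : 0 < √ε := Real.sqrt_pos.2 hε
    have bd : ∀ n : ℕ, Integrable fun x => kap ε y x ^ n * den a b x := fun n =>
      rdn.integrable.bdd_mul (c := (√ε)⁻¹ ^ n) (ck.pow n).aestronglyMeasurable
        (Filter.Eventually.of_forall fun x => by
          rw [Real.norm_eq_abs, abs_pow, abs_of_pos (kap_pos hε x y)]
          exact pow_le_pow_left₀ (kap_pos hε x y).le (kap_le hε x y) n)
    have i1 : Integrable fun x => kap ε y x * den a b x := by simpa using bd 1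
    have i3 : Integrable fun x => ε * (kap ε y x ^ 3 * den a b x) := (bd 3).const_mul ε
    have e : ∀ x, (kap ε y x - ε * kap ε y x ^ 3) * den a b x =
        kap ε y x * den a b x - ε * (kap ε y x ^ 3 * den a b x) := fun x => by ring
    simp_rw [e]
    refine ⟨i1.sub i3, ?_⟩
    rw [integral_sub i1 i3]
    have h1 := abs_integral_kap_sub_le ha hb hε y
    rw [← hK] at h1
    have h2 : 0 ≤ ∫ x, ε * (kap ε y x ^ 3 * den a b x) := integral_nonneg fun x => by
      have := (kap_pos hε x y).le
      have := den_nonneg a b x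
      positivity
    have h3 : ∫ x, ε * (kap ε y x ^ 3 * den a b x) ≤ √ε * (4 * K) := by
      have hh := ha.hardy_regularised hb 0 hε y
      rw [gd_zero] at hh
      calc _ ≤ ∫ x, √ε * (kap ε y x ^ 2 * den a b x) := integral_mono i3 ((bd 2).const_mul _)
            fun x => by
              have hk : ε * kap ε y x ≤ √ε := by
                calc ε * kap ε y x ≤ ε * (√ε)⁻¹ := by gcongr; exact kap_le hε x y
                  _ = √ε := by
                    rw [← div_eq_mul_inv, Real.div_sqrt]
              calc ε * (kap ε y x ^ 3 * den a b x) =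
                    (ε * kap ε y x) * (kap ε y x ^ 2 * den a b x) := by ring
                _ ≤ _ := mul_le_mul_of_nonneg_right hk
                  (mul_nonneg (sq_nonneg _) (den_nonneg a b x))
        _ ≤ _ := by rw [integral_const_mul]; gcongr
    rw [abs_le] at h1 ⊢
    constructor <;> linarith [h1.1, h1.2]
  have idp : Integrable fun x => den a b x * pot a b x := ha.integrable_den_mul_pot hb ha hb
  have T1 := (tendsto_integral_mul_kap ha hb (ha.rd_dil hb).integrable).const_mul 2
  have hlim : Filter.Tendsto (fun m => 2 * ∫ x, dil a b x * ∫ y, kap (eps m) x y * den a b y)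
      Filter.atTop (𝓝 (4 * π * ∫ x, den a b x * pot a b x)) := by
    refine tendsto_iff_norm_sub_tendsto_zero.2 (squeeze_zero (fun m => norm_nonneg _)
      (g := fun m => √(eps m) * (8 * K * M)) (fun m => ?_) ?_)
    · have hε := eps_pos m
      rw [integral_dil_mul_integral_kap ha hb hε, ← integral_const_mul]
      have iL : Integrable fun y => den a b y *
          ∫ x, (kap (eps m) y x - eps m * kap (eps m) y x ^ 3) * den a b x := by
        have h1 := (ha.rd_dil hb).integrable
        refine ((idp.const_mul (4 * π)).add ((rdn.integrable.const_mul (√(eps m) * (8 * K))))).mono'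
          ?_ (Filter.Eventually.of_forall fun y => ?_)
        · refine (ha.continuous_den hb).aestronglyMeasurable.mul ?_
          have hc : Continuous fun z : E3 × E3 =>
              (kap (eps m) z.1 z.2 - eps m * kap (eps m) z.1 z.2 ^ 3) * den a b z.2 := by
            have := (continuous_kap₂ hε).comp continuous_swap
            have h2 : Continuous fun z : E3 × E3 => kap (eps m) z.1 z.2 := this
            have := ha.continuous_den hb
            fun_prop
          exact (hc.stronglyMeasurable.integral_prod_right).aestronglyMeasurable
        · have h := (hin hε y).2
          have hp := pot_nonneg a b y
          have hd := den_nonneg a b y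
          rw [norm_mul, Real.norm_eq_abs, Real.norm_eq_abs, abs_of_nonneg hd]
          simp only [Pi.add_apply]
          have h' : |∫ x, (kap (eps m) y x - eps m * kap (eps m) y x ^ 3) * den a b x| ≤
              4 * π * pot a b y + √(eps m) * (8 * K) := by
            have := abs_sub_abs_le_abs_sub
              (∫ x, (kap (eps m) y x - eps m * kap (eps m) y x ^ 3) * den a b x) (4 * π * pot a b y)
            rw [abs_of_nonneg (by positivity : 0 ≤ 4 * π * pot a b y)] at this
            linarith
          calc _ ≤ den a b y * (4 * π * pot a b y + √(eps m) * (8 * K)) := by gcongr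
            _ = _ := by ring
      rw [← integral_sub iL (idp.const_mul _), hM, ← mul_assoc, ← integral_const_mul]
      refine norm_integral_le_of_norm_le (rdn.integrable.const_mul _)
        (Filter.Eventually.of_forall fun y => ?_)
      have h := (hin hε y).2
      have hd := den_nonneg a b y
      rw [Real.norm_eq_abs]
      calc |den a b y * (∫ x, (kap (eps m) y x - eps m * kap (eps m) y x ^ 3) * den a b x) -
            4 * π * (den a b y * pot a b y)| = den a b y *
            |(∫ x, (kap (eps m) y x - eps m * kap (eps m) y x ^ 3) * den a b x) -
              4 * π * pot a b y| := by
            rw [← abs_of_nonneg hd, ← abs_mul, abs_of_nonneg hd]; congr 1; ring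
        _ ≤ den a b y * (√(eps m) * (8 * K)) := by gcongr
        _ = _ := by ring
    · have := (tendsto_eps.sqrt).mul_const (8 * K * M)
      simpa using this
  have h := tendsto_nhds_unique T1 hlim
  have hp : (4 * π : ℝ) ≠ 0 := by positivity
  have h2 : 4 * π * (2 * ∫ x, dil a b x * pot a b x) = 4 * π * ∫ x, den a b x * pot a b x := by
    rw [← h]; ring
  linarith [mul_left_cancel₀ hp h2]

lemma Nice.norm_mul_pot_le {J : ℝ} (hJ : ∫ x, ‖x‖ ^ 2 * den a b x ≤ J) (x : E3) :
    ‖x‖ * pot a b x ≤ (∫ y, den a b y) + J + 2 * ∫ y, gsq a b y := by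
  have hh := ha.hardy hb 0 x
  rw [gd_zero] at hh
  have i0 := (ha.rd_den hb).integrable
  have i1 := (ha.rd_norm_sq_mul_den hb).integrable
  have h : ∫ y, ‖x‖ * (‖x - y‖⁻¹ * den a b y) ≤
      ∫ y, (den a b y + 1 / 2 * (‖y‖ ^ 2 * den a b y) +
        1 / 2 * ((‖y - x‖ ^ 2)⁻¹ * den a b y)) := by
    refine integral_mono ((ha.integrable_inv_mul_den hb x).const_mul _)
      ((i0.fun_add (i1.const_mul _)).add (hh.1.const_mul _)) fun y => ?_
    simp only
    have e : den a b y + 1 / 2 * (‖y‖ ^ 2 * den a b y) + 1 / 2 * ((‖y - x‖ ^ 2)⁻¹ * den a b y) =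
        (1 + 1 / 2 * ‖y‖ ^ 2 + 1 / 2 * (‖x - y‖⁻¹) ^ 2) * den a b y := by
      rw [norm_sub_rev y x, inv_pow]; ring
    rw [e, ← mul_assoc]
    refine mul_le_mul_of_nonneg_right ?_ (den_nonneg a b y)
    have h1 : ‖x‖ ≤ ‖x - y‖ + ‖y‖ := by simpa using norm_add_le (x - y) y
    have h2 : ‖x - y‖ * ‖x - y‖⁻¹ ≤ 1 := mul_inv_le_one
    have h3 : 0 ≤ ‖x - y‖⁻¹ := by positivity
    nlinarith [mul_le_mul_of_nonneg_right h1 h3, sq_nonneg (‖y‖ - ‖x - y‖⁻¹)]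
  rw [integral_add (i0.fun_add (i1.const_mul _)) (hh.1.const_mul _), integral_add i0 (i1.const_mul _),
    integral_const_mul, integral_const_mul, integral_const_mul] at h
  have hX : 0 ≤ ∫ y, ‖x‖ * (‖x - y‖⁻¹ * den a b y) := integral_nonneg fun y =>
    mul_nonneg (norm_nonneg _) (mul_nonneg (by positivity) (den_nonneg a b y))
  rw [integral_const_mul] at hX
  have hJ0 : 0 ≤ ∫ x, ‖x‖ ^ 2 * den a b x := integral_nonneg fun y =>
    mul_nonneg (sq_nonneg _) (den_nonneg a b y)
  have e : ‖x‖ * pot a b x = 1 / (4 * π) * (‖x‖ * ∫ y, ‖x - y‖⁻¹ * den a b y) := by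
    unfold pot; ring
  have hp : 1 / (4 * π) ≤ 1 := by
    rw [div_le_one (by positivity)]; linarith [Real.pi_gt_three]
  rw [e]
  calc _ ≤ 1 * (‖x‖ * ∫ y, ‖x - y‖⁻¹ * den a b y) := mul_le_mul_of_nonneg_right hp hX
    _ ≤ _ := by linarith

end FixedTime

/-- The Euler (radial) derivative `x · ∇f`. -/
def eul (f : E3 → ℝ) (x : E3) : ℝ := ∑ i, x i * pd i f x

section Euler

variable {χ f : E3 → ℝ} (hχ : ContDiff ℝ 1 χ) (hc : HasCompactSupport χ)

lemma continuous_eul (hf : ContDiff ℝ 1 f) : Continuous (eul f) :=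
  continuous_finsetSum _ fun i _ => by
    have := continuous_pd (i := i) hf
    fun_prop

lemma contDiff_eul (hf : ContDiff ℝ 2 f) : ContDiff ℝ 1 (eul f) :=
  ContDiff.sum fun i _ => (by fun_prop : ContDiff ℝ 1 fun x : E3 => x i).mul (contDiff_one_pd hf)

lemma eul_mul {g : E3 → ℝ} (hf : Differentiable ℝ f) (hg : Differentiable ℝ g) (x : E3) :
    eul (fun x => f x * g x) x = f x * eul g x + g x * eul f x := by
  simp only [eul, pd_mul hf hg, Fin.sum_univ_three]; ring

lemma eul_sub {g : E3 → ℝ} (hf : Differentiable ℝ f) (hg : Differentiable ℝ g) (x : E3) :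
    eul (fun x => f x - g x) x = eul f x - eul g x := by
  simp only [eul, pd_sub hf hg, Fin.sum_univ_three]; ring

include hχ hc

lemma integrable_pd_mul (i : Fin 3) (hf : Continuous f) : Integrable fun x => pd i χ x * f x :=
  integrable_mul_of_compactSupport (continuous_pd hχ) (hasCompactSupport_pd hc) hf

lemma integrable_eul_mul (hf : Continuous f) : Integrable fun x => eul χ x * f x := by
  simp only [eul, Finset.sum_mul]
  refine integrable_finsetSum _ fun i _ => ?_
  refine (integrable_pd_mul hχ hc i (f := fun x => x i * f x) (by fun_prop)).congr
    (Filter.Eventually.of_forall fun x => by simp only; ring)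

lemma integral_mul_eul (hf : ContDiff ℝ 1 f) :
    ∫ x, χ x * eul f x = -(3 * ∫ x, χ x * f x) - ∫ x, eul χ x * f x := by
  have df := hf.differentiable one_ne_zero
  have dχ := hχ.differentiable one_ne_zero
  have h := integral_div_eq_zero (v := fun i x => χ x * (x i * f x))
    (fun i => hχ.mul ((by fun_prop : ContDiff ℝ 1 fun x : E3 => x i).mul hf))
    (fun i => hc.mul_right)
  have i1 := integrable_mul_of_compactSupport hχ.continuous hc (continuous_eul hf)
  have i2 := (integrable_mul_of_compactSupport hχ.continuous hc hf.continuous).const_mul 3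
  have i3 := integrable_eul_mul hχ hc hf.continuous
  have e : ∀ x, ∑ i, pd i (fun x : E3 => χ x * (x i * f x)) x =
      χ x * eul f x + 3 * (χ x * f x) + eul χ x * f x := fun x => by
    have : ∀ i, pd i (fun x : E3 => χ x * (x i * f x)) x =
        pd i χ x * (x i * f x) + χ x * (f x + x i * pd i f x) := fun i => by
      have dx : Differentiable ℝ fun x : E3 => x i := by fun_prop
      rw [pd_mul dχ (dx.fun_mul df), pd_mul dx df, pd_coord]; simp
    simp only [this, eul, Fin.sum_univ_three]; ring
  simp_rw [e] at h
  rw [integral_add (i1.fun_add i2) i3, integral_add i1 i2, integral_const_mul] at h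
  linarith

lemma integral_mul_lap_mul_eul (hf : ContDiff ℝ 2 f) :
    ∫ x, χ x * (lap f x * eul f x) = 1 / 2 * (∫ x, χ x * ∑ i, pd i f x ^ 2) +
      1 / 2 * (∫ x, eul χ x * ∑ i, pd i f x ^ 2) -
      ∫ x, ∑ i, pd i χ x * (pd i f x * eul f x) := by
  have hf1 := hf.of_le one_le_two
  have hG : ContDiff ℝ 1 fun x => ∑ i, pd i f x ^ 2 :=
    ContDiff.sum fun i _ => (contDiff_one_pd hf).pow 2
  have dp : ∀ i, Differentiable ℝ (pd i f) := fun i =>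
    (contDiff_one_pd hf).differentiable one_ne_zero
  have h := integral_mul_inner_pd hχ hc hf (contDiff_eul hf)
  have h2 := integral_mul_eul hχ hc hG
  have e1 : ∀ i x, pd i (eul f) x = pd i f x + ∑ j, x j * pd i (pd j f) x := fun i x => by
    have h3 := fderiv_fun_sum (𝕜 := ℝ) (u := Finset.univ) (x := x)
      (A := fun (j : Fin 3) (x : E3) => x j * pd j f x) fun j _ =>
        ((by fun_prop : Differentiable ℝ fun x : E3 => x j).fun_mul (dp j)).differentiableAt
    have h4 : pd i (eul f) x = ∑ j, pd i (fun x : E3 => x j * pd j f x) x := by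
      unfold pd at h3 ⊢
      unfold eul pd
      rw [h3]; simp
    rw [h4]
    have : ∀ j, pd i (fun x : E3 => x j * pd j f x) x =
        (if i = j then 1 else 0) * pd j f x + x j * pd i (pd j f) x := fun j => by
      rw [pd_mul (by fun_prop) (dp j), pd_coord]
    simp_rw [this, Finset.sum_add_distrib]
    simp
  have e2 : ∀ i x, pd i (fun x => ∑ j, pd j f x ^ 2) x = ∑ j, 2 * pd j f x * pd i (pd j f) x :=
    fun i x => by
      have h3 := fderiv_fun_sum (𝕜 := ℝ) (u := Finset.univ) (x := x)
        (A := fun (j : Fin 3) (x : E3) => pd j f x ^ 2) fun j _ => ((dp j).fun_pow 2).differentiableAt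
      have h4 : pd i (fun x => ∑ j, pd j f x ^ 2) x = ∑ j, pd i (fun x => pd j f x ^ 2) x := by
        unfold pd at h3 ⊢
        rw [h3]; simp
      simp_rw [h4, pd_sq (dp _)]
  have e3 : ∀ x, χ x * ∑ i, pd i f x * pd i (eul f) x =
      χ x * (∑ i, pd i f x ^ 2) + 1 / 2 * (χ x * eul (fun x => ∑ i, pd i f x ^ 2) x) := fun x => by
    have c10 := pd_comm hf 1 0 x
    have c20 := pd_comm hf 2 0 x
    have c21 := pd_comm hf 2 1 x
    simp only [eul, e2]
    simp only [e1]
    simp only [Fin.sum_univ_three, c10, c20, c21]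
    ring
  have i1 := integrable_mul_of_compactSupport hχ.continuous hc hG.continuous
  have i2 := (integrable_mul_of_compactSupport hχ.continuous hc (continuous_eul hG)).const_mul (1/2)
  simp_rw [e3] at h
  rw [integral_add i1 i2, integral_const_mul, h2] at h
  linarith

end Euler

lemma abs_integral_pd_chi_mul_le_weighted {v : Fin 3 → E3 → ℝ} {w : E3 → ℝ} (hw : Integrable w)
    (h : ∀ x, ∑ i, |v i x| ≤ (1 + ‖x‖) * w x) (k : ℕ) :
    |∫ x, ∑ i, pd i (chi k) x * v i x| ≤ cc * ((k : ℝ) + 1)⁻¹ * ∫ x, w x := by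
  have hcc : 0 ≤ cc * ((k : ℝ) + 1)⁻¹ := mul_nonneg cc_pos.le (by positivity)
  rw [← integral_const_mul, ← Real.norm_eq_abs]
  refine norm_integral_le_of_norm_le (hw.const_mul _) (Filter.Eventually.of_forall fun x => ?_)
  refine (Finset.abs_sum_le_sum_abs _ _).trans ?_
  have h1 : 0 < 1 + ‖x‖ := by positivity
  refine le_of_mul_le_mul_left ?_ h1
  rw [Finset.mul_sum]
  calc _ ≤ ∑ i, cc * ((k : ℝ) + 1)⁻¹ * |v i x| := Finset.sum_le_sum fun i _ => by
        rw [abs_mul, ← mul_assoc]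
        exact mul_le_mul_of_nonneg_right (pd_chi_le k i x) (abs_nonneg _)
    _ ≤ cc * ((k : ℝ) + 1)⁻¹ * ((1 + ‖x‖) * w x) := by
      rw [← Finset.mul_sum]; exact mul_le_mul_of_nonneg_left (h x) hcc
    _ = _ := by ring

/-- The boundary flux produced by a cutoff in the virial identity. -/
def flux (a b a' b' : E3 → ℝ) (i : Fin 3) (x : E3) : ℝ :=
  pd i a x * eul a x + pd i b x * eul b x - 1 / 2 * (x i * gsq a b x) +
    3 / 2 * (a x * pd i a x + b x * pd i b x) - x i * (a x * b' x - b x * a' x)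

lemma abs_eul_mul_le (f : E3 → ℝ) (i : Fin 3) (x : E3) :
    |pd i f x * eul f x| ≤ 3 * (‖x‖ * ∑ i, pd i f x ^ 2) := by
  have h1 : ∀ i, |pd i f x| ≤ √(∑ i, pd i f x ^ 2) := fun i =>
    Real.abs_le_sqrt (Finset.single_le_sum (f := fun i => pd i f x ^ 2)
      (fun i _ => by positivity) (Finset.mem_univ i))
  have h2 : |eul f x| ≤ ∑ _i : Fin 3, ‖x‖ * √(∑ i, pd i f x ^ 2) :=
    (Finset.abs_sum_le_sum_abs _ _).trans (Finset.sum_le_sum fun i _ => by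
      rw [abs_mul]
      exact mul_le_mul (abs_coord_le x i) (h1 i) (abs_nonneg _) (norm_nonneg _))
  rw [Finset.sum_const, Finset.card_univ, Fintype.card_fin, nsmul_eq_mul] at h2
  have h3 : 0 ≤ ∑ i, pd i f x ^ 2 := Finset.sum_nonneg fun i _ => sq_nonneg _
  rw [abs_mul]
  calc _ ≤ √(∑ i, pd i f x ^ 2) * ((3 : ℕ) * (‖x‖ * √(∑ i, pd i f x ^ 2))) := by
        gcongr; exact h1 i
    _ = 3 * (‖x‖ * (√(∑ i, pd i f x ^ 2) * √(∑ i, pd i f x ^ 2))) := by push_cast; ring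
    _ = _ := by rw [Real.mul_self_sqrt h3]

lemma sum_abs_flux_le (a b a' b' : E3 → ℝ) (x : E3) : ∑ i, |flux a b a' b' i x| ≤
    (1 + ‖x‖) * (15 * gsq a b x + 6 * den a b x + 3 * den a' b' x) := by
  have hg := gsq_nonneg a b x
  have hd := den_nonneg a b x
  have hd' := den_nonneg a' b' x
  have hx := norm_nonneg x
  have key : ∀ i, |flux a b a' b' i x| ≤
      (1 + ‖x‖) * (5 * gsq a b x + 2 * den a b x + den a' b' x) := fun i => by
    have h1 := abs_eul_mul_le a i x
    have h2 := abs_eul_mul_le b i x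
    have h3 : ‖x‖ * (∑ i, pd i a x ^ 2) + ‖x‖ * (∑ i, pd i b x ^ 2) = ‖x‖ * gsq a b x := by
      rw [← mul_add, ← Finset.sum_add_distrib]; rfl
    have h4 : |a x * pd i a x + b x * pd i b x| ≤ 1 / 2 * (den a b x + gsq a b x) := by
      have h5 : pd i a x ^ 2 + pd i b x ^ 2 ≤ gsq a b x :=
        Finset.single_le_sum (f := fun i => pd i a x ^ 2 + pd i b x ^ 2)
          (fun i _ => by positivity) (Finset.mem_univ i)
      unfold den
      rw [abs_le]
      constructor <;> nlinarith [sq_nonneg (a x - pd i a x), sq_nonneg (a x + pd i a x),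
        sq_nonneg (b x - pd i b x), sq_nonneg (b x + pd i b x)]
    have h6 : |x i * (a x * b' x - b x * a' x)| ≤ ‖x‖ * (1 / 2 * (den a b x + den a' b' x)) := by
      rw [abs_mul]
      refine mul_le_mul (abs_coord_le x i) ?_ (abs_nonneg _) hx
      unfold den
      rw [abs_le]
      constructor <;> nlinarith [sq_nonneg (a x - b' x), sq_nonneg (a x + b' x),
        sq_nonneg (b x - a' x), sq_nonneg (b x + a' x)]
    have h7 : |x i * gsq a b x| ≤ ‖x‖ * gsq a b x := by
      rw [abs_mul, abs_of_nonneg hg]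
      exact mul_le_mul_of_nonneg_right (abs_coord_le x i) hg
    have m1 := mul_nonneg hx hg
    have m2 := mul_nonneg hx hd
    have m3 := mul_nonneg hx hd'
    unfold flux
    rw [abs_le] at h1 h2 h4 h6 h7 ⊢
    constructor <;> nlinarith [h1.1, h1.2, h2.1, h2.2, h4.1, h4.2, h6.1, h6.2, h7.1, h7.2]
  calc _ ≤ ∑ _i : Fin 3, (1 + ‖x‖) * (5 * gsq a b x + 2 * den a b x + den a' b' x) :=
        Finset.sum_le_sum fun i _ => key i
    _ = _ := by
      rw [Finset.sum_const, Finset.card_univ, Fintype.card_fin, nsmul_eq_mul]; push_cast; ring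

namespace Flow

variable {a b : ℝ → E3 → ℝ} (F : Flow a b) {t : ℝ}
include F

lemma joint_vir : Joint 1 fun t => vir (a t) (b t) :=
  .sum fun i => (Joint.const (by fun_prop : ContDiff ℝ 1 fun x : E3 => x i)).mul
    (((F.ja.of_le one_le_two).mul (F.jb.pd (n := 1) i)).sub
      ((F.jb.of_le one_le_two).mul (F.ja.pd (n := 1) i)))

lemma dt_vir (t : ℝ) (x : E3) : dt (fun t => vir (a t) (b t)) t x =
    2 * (dt a t x * eul (b t) x - dt b t x * eul (a t) x) +
      eul (fun x => a t x * dt b t x - b t x * dt a t x) x := by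
  have ha := fun t x => F.ja.hasDerivAt (n := 1) t x
  have hb := fun t x => F.jb.hasDerivAt (n := 1) t x
  have h : HasDerivAt (fun s => vir (a s) (b s) x) _ t := HasDerivAt.fun_sum fun i _ =>
    (((ha t x).fun_mul ((F.jb.pd (n := 1) i).hasDerivAt (n := 0) t x)).fun_sub
      ((hb t x).fun_mul ((F.ja.pd (n := 1) i).hasDerivAt (n := 0) t x))).const_mul (x i)
  refine h.deriv.trans ?_
  have da : Differentiable ℝ (dt a t) :=
    ((F.ja.dt (n := 1)).slice t).differentiable one_ne_zero
  have db : Differentiable ℝ (dt b t) :=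
    ((F.jb.dt (n := 1)).slice t).differentiable one_ne_zero
  rw [eul_sub ((F.na t).diff.fun_mul db) ((F.nb t).diff.fun_mul da), eul_mul (F.na t).diff db,
    eul_mul (F.nb t).diff da]
  simp only [F.ja.dt_pd, F.jb.dt_pd, eul, Fin.sum_univ_three]
  ring

lemma eul_den (t : ℝ) (x : E3) : eul (den (a t) (b t)) x =
    2 * (a t x * eul (a t) x + b t x * eul (b t) x) := by
  simp only [eul, (F.na t).pd_den (F.nb t), Fin.sum_univ_three]; ring

lemma hasDerivAt_integral_chi_vir (ht : 0 ≤ t) (k : ℕ) :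
    HasDerivAt (fun t => ∫ x, chi k x * vir (a t) (b t) x)
      ((∫ x, chi k x * gsq (a t) (b t) x) +
        (∫ x, chi k x * (dil (a t) (b t) x * pot (a t) (b t) x)) +
        ∫ x, ∑ i, pd i (chi k) x * flux (a t) (b t) (dt a t) (dt b t) i x) t := by
  have hc := hasCompactSupport_chi k
  have hχ : ContDiff ℝ 1 (chi k) := contDiff_chi k
  have h := F.joint_vir.hasDerivAt_integral hχ.continuous hc t
  convert h using 1
  have sa : ContDiff ℝ 1 (dt a t) := (F.ja.dt (n := 1)).slice t
  have sb : ContDiff ℝ 1 (dt b t) := (F.jb.dt (n := 1)).slice t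
  have na := F.na t
  have nb := F.nb t
  have na1 := na.smooth.of_le one_le_two
  have nb1 := nb.smooth.of_le one_le_two
  set H : E3 → ℝ := fun x => a t x * dt b t x - b t x * dt a t x with hH
  have sH : ContDiff ℝ 1 H := (na1.mul sb).sub (nb1.mul sa)
  have cV : Continuous (pot (a t) (b t)) := na.continuous_pot nb
  have cea := continuous_eul na1
  have ceb := continuous_eul nb1
  have cla := continuous_lap na.smooth
  have clb := continuous_lap nb.smooth
  have ca := na1.continuous
  have cb := nb1.continuous
  have cg := (na.rd_gsq nb).cont
  have cd := (na.rd_dil nb).cont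
  have cpa : ∀ i, Continuous (pd i (a t)) := fun i => continuous_pd na1
  have cpb : ∀ i, Continuous (pd i (b t)) := fun i => continuous_pd nb1
  have I := fun {f : E3 → ℝ} (hf : Continuous f) => integrable_chi_mul k hf
  have P := fun (i : Fin 3) {f : E3 → ℝ} (hf : Continuous f) => integrable_pd_mul hχ hc i hf
  have csa : Continuous fun x => ∑ i, pd i (a t) x ^ 2 :=
    continuous_finsetSum _ fun i _ => (cpa i).pow 2
  have csb : Continuous fun x => ∑ i, pd i (b t) x ^ 2 :=
    continuous_finsetSum _ fun i _ => (cpb i).pow 2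
  have i1 := I (cla.mul cea)
  have i2 := I (clb.mul ceb)
  have i3 := I (ca.mul cla)
  have i4 := I (cb.mul clb)
  have i5 := I (cd.mul cV)
  have i6 := I (f := fun x => eul H x + 3 * H x)
    ((continuous_eul sH).add (sH.continuous.const_mul 3))
  simp only [Pi.mul_apply] at i1 i2 i3 i4 i5
  have e1 : ∀ x, chi k x * dt (fun t => vir (a t) (b t)) t x =
      (chi k x * (eul H x + 3 * H x) + chi k x * (dil (a t) (b t) x * pot (a t) (b t) x)) -
      ((chi k x * (lap (a t) x * eul (a t) x) + chi k x * (lap (b t) x * eul (b t) x)) +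
      3 / 2 * (chi k x * (a t x * lap (a t) x) + chi k x * (b t x * lap (b t) x))) := fun x => by
    have hd : dil (a t) (b t) x = 2 * (a t x * eul (a t) x + b t x * eul (b t) x) +
        3 * den (a t) (b t) x := by rw [← F.eul_den]; rfl
    rw [F.dt_vir, hd]
    simp only [← hH]
    have hx : H x = a t x * dt b t x - b t x * dt a t x := rfl
    rw [hx, F.eqa t ht, F.eqb t ht]
    unfold den
    ring
  simp_rw [e1]
  rw [integral_sub (i6.fun_add i5) ((i1.fun_add i2).fun_add ((i3.fun_add i4).const_mul _)),
    integral_add i6 i5, integral_add (i1.fun_add i2) ((i3.fun_add i4).const_mul _),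
    integral_add i1 i2, integral_const_mul, integral_add i3 i4]
  have r1 := integral_mul_lap_mul_eul hχ hc na.smooth
  have r2 := integral_mul_lap_mul_eul hχ hc nb.smooth
  have r3 := integral_mul_inner_pd hχ hc na.smooth na1
  have r4 := integral_mul_inner_pd hχ hc nb.smooth nb1
  have r5 := integral_mul_eul hχ hc sH
  have r6 : ∫ x, chi k x * (eul H x + 3 * H x) =
      (∫ x, chi k x * eul H x) + 3 * ∫ x, chi k x * H x := by
    rw [← integral_const_mul, ← integral_add (I (continuous_eul sH))
      ((I sH.continuous).const_mul 3)]
    congr 1; ext x; ring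
  have S := fun {f : Fin 3 → E3 → ℝ} (hf : ∀ i, Continuous (f i)) =>
    integrable_finsetSum Finset.univ fun i _ => P i (hf i)
  have s1 := S fun i => (cpa i).mul cea
  have s2 := S fun i => (cpb i).mul ceb
  have s3 := S fun i => (cpa i).mul ca
  have s4 := S fun i => (cpb i).mul cb
  have m1 := integrable_eul_mul hχ hc csa
  have m2 := integrable_eul_mul hχ hc csb
  have m3 := integrable_eul_mul hχ hc sH.continuous
  simp only [Pi.mul_apply] at s1 s2 s3 s4
  have e2 : ∀ x, ∑ i, pd i (chi k) x * flux (a t) (b t) (dt a t) (dt b t) i x =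
      ((∑ i, pd i (chi k) x * (pd i (a t) x * eul (a t) x)) +
        ∑ i, pd i (chi k) x * (pd i (b t) x * eul (b t) x)) +
      -(1 / 2) * (eul (chi k) x * (∑ i, pd i (a t) x ^ 2) +
        eul (chi k) x * ∑ i, pd i (b t) x ^ 2) +
      3 / 2 * ((∑ i, pd i (chi k) x * (pd i (a t) x * a t x)) +
        ∑ i, pd i (chi k) x * (pd i (b t) x * b t x)) - eul (chi k) x * H x := fun x => by
    simp only [flux, hH, gsq, eul, Fin.sum_univ_three]; ring
  have g1 : ∫ x, chi k x * gsq (a t) (b t) x =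
      (∫ x, chi k x * ∑ i, pd i (a t) x ^ 2) + ∫ x, chi k x * ∑ i, pd i (b t) x ^ 2 := by
    rw [← integral_add (I csa) (I csb)]
    congr 1; ext x
    rw [← mul_add, ← Finset.sum_add_distrib]; rfl
  simp_rw [e2]
  rw [integral_sub (((s1.fun_add s2).fun_add ((m1.fun_add m2).const_mul _)).fun_add
    ((s3.fun_add s4).const_mul _)) m3, integral_add ((s1.fun_add s2).fun_add
    ((m1.fun_add m2).const_mul _)) ((s3.fun_add s4).const_mul _),
    integral_add (s1.fun_add s2) ((m1.fun_add m2).const_mul _), integral_add s1 s2,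
    integral_const_mul, integral_const_mul, integral_add m1 m2, integral_add s3 s4, g1, r1, r2,
    r6, r5]
  simp_rw [← sq] at r3 r4
  have c1 : ∀ f : E3 → ℝ, (fun x => chi k x * (lap f x * f x)) =
      fun x => chi k x * (f x * lap f x) := fun f => by ext x; ring
  rw [c1] at r3 r4
  linarith

end Flow

lemma sub_eq_integral_of_tendsto {f f' : ℕ → ℝ → ℝ} {G g : ℝ → ℝ} {u v C : ℝ} (huv : u ≤ v)
    (hd : ∀ k, ∀ τ ∈ Icc u v, HasDerivAt (f k) (f' k τ) τ)
    (hb : ∀ k, ∀ τ ∈ Icc u v, |f' k τ| ≤ C)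
    (hg : ∀ τ ∈ Icc u v, Filter.Tendsto (fun k => f' k τ) Filter.atTop (𝓝 (g τ)))
    (hG : ∀ τ ∈ Icc u v, Filter.Tendsto (fun k => f k τ) Filter.atTop (𝓝 (G τ))) :
    G v - G u = ∫ τ in u..v, g τ := by
  have hsub : ∀ τ ∈ Set.uIoc u v, τ ∈ Icc u v := fun τ hτ => by
    rw [uIoc_of_le huv] at hτ; exact Ioc_subset_Icc_self hτ
  have hm : ∀ k, AEStronglyMeasurable (f' k) (volume.restrict (Set.uIoc u v)) := fun k => by
    refine (stronglyMeasurable_deriv (f k)).aestronglyMeasurable.congr ?_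
    filter_upwards [ae_restrict_mem measurableSet_uIoc] with τ hτ
    exact (hd k τ (hsub τ hτ)).deriv
  have T := intervalIntegral.tendsto_integral_filter_of_dominated_convergence (μ := volume)
    (a := u) (b := v) (F := f') (f := g) (l := Filter.atTop) (fun _ => C)
    (Filter.Eventually.of_forall hm)
    (Filter.Eventually.of_forall fun k => Filter.Eventually.of_forall fun τ hτ =>
      hb k τ (hsub τ hτ))
    intervalIntegrable_const
    (Filter.Eventually.of_forall fun τ hτ => hg τ (hsub τ hτ))
  have T2 := (hG v ⟨huv, le_rfl⟩).sub (hG u ⟨le_rfl, huv⟩)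
  refine tendsto_nhds_unique T2 (T.congr fun k => ?_)
  refine intervalIntegral.integral_eq_sub_of_hasDerivAt
    (fun τ hτ => hd k τ (by rwa [uIcc_of_le huv] at hτ)) ?_
  rw [intervalIntegrable_iff]
  have : IsFiniteMeasure (volume.restrict (Set.uIoc u v)) := by
    rw [uIoc_of_le huv]; infer_instance
  refine Integrable.of_bound (hm k) C ?_
  filter_upwards [ae_restrict_mem measurableSet_uIoc] with τ hτ
  exact hb k τ (hsub τ hτ)

lemma hasDerivAt_of_sub_eq_integral {G g : ℝ → ℝ} (hg : ContinuousOn g (Ici 0))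
    (h : ∀ t, 0 ≤ t → G t - G 0 = ∫ τ in (0 : ℝ)..t, g τ) :
    ContinuousOn G (Ici 0) ∧ ∀ t, 0 < t → HasDerivAt G (g t) t := by
  set γ : ℝ → ℝ := fun t => g (max 0 t) with hγ
  have cγ : Continuous γ := hg.comp_continuous (by fun_prop) fun t => le_max_left 0 t
  have e : ∀ t, 0 ≤ t → G t = G 0 + ∫ τ in (0 : ℝ)..t, γ τ := fun t ht => by
    rw [← sub_eq_iff_eq_add', h t ht]
    refine intervalIntegral.integral_congr fun τ hτ => ?_
    rw [uIcc_of_le ht] at hτ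
    simp only [hγ, max_eq_right hτ.1]
  have hd : ∀ t, HasDerivAt (fun t => G 0 + ∫ τ in (0 : ℝ)..t, γ τ) (γ t) t := fun t =>
    (intervalIntegral.integral_hasDerivAt_right (cγ.intervalIntegrable _ _)
      (cγ.stronglyMeasurableAtFilter _ _) cγ.continuousAt).const_add _
  refine ⟨ContinuousOn.congr (fun t _ => (hd t).continuousAt.continuousWithinAt)
    fun t ht => e t ht, fun t ht => ?_⟩
  have h1 := hd t
  simp only [hγ, max_eq_right ht.le] at h1
  refine h1.congr_of_eventuallyEq ?_
  filter_upwards [lt_mem_nhds ht] with τ hτ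
  exact e τ hτ.le

namespace Flow

variable {a b : ℝ → E3 → ℝ} (F : Flow a b) {t : ℝ}
include F

lemma continuousOn_potential :
    ContinuousOn (fun t => ∫ x, den (a t) (b t) x * pot (a t) (b t) x) (Ici 0) := by
  obtain ⟨Q, hQ0, hQ⟩ := F.exists_uniform_bound
  have h : ∀ s t : ℝ, 0 ≤ s → s ≤ t → _ := fun s t hs hst => F.abs_potential_sub_le hs hst
    (fun τ hτ => (hQ τ (hs.trans hτ.1)).1) (fun τ hτ => (hQ τ (hs.trans hτ.1)).2)
  refine (LipschitzOnWith.of_dist_le_mul (K := ⟨8 * Q ^ 2, by positivity⟩)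
    fun s hs t ht => ?_).continuousOn
  rw [Real.dist_eq, Real.dist_eq]
  rcases le_total s t with hst | hst
  · rw [abs_sub_comm, abs_sub_comm s, abs_of_nonneg (sub_nonneg.2 hst)]
    exact h s t hs hst
  · rw [abs_of_nonneg (sub_nonneg.2 hst)]
    exact h t s ht hst

/-- The virial identity, with a uniform-in-time integral form. -/
lemma virial_sub_eq (ht : 0 ≤ t) :
    (∫ x, vir (a t) (b t) x) - (∫ x, vir (a 0) (b 0) x) =
      ∫ τ in (0 : ℝ)..t, ((∫ x, gsq (a τ) (b τ) x) +
        1 / 2 * ∫ x, den (a τ) (b τ) x * pot (a τ) (b τ) x) := by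
  obtain ⟨Q, hQ0, hQ⟩ := F.exists_uniform_bound
  obtain ⟨J, hJ0, hJ⟩ := F.exists_moment_bound t
  set Y := √(speed Q (a 0) (b 0)) + 4 * Q * √Q * (t - 0) with hY
  have hD : ∀ τ ∈ Icc 0 t, ∫ x, den (dt a τ) (dt b τ) x ≤ Y ^ 2 := fun τ hτ =>
    F.integral_den_dt_le_of_bounded le_rfl (fun r hr => (hQ r hr.1).1)
      (fun r hr => (hQ r hr.1).2) hτ
  have idil : ∀ τ, Integrable fun x => dil (a τ) (b τ) x * pot (a τ) (b τ) x := fun τ =>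
    ((F.na τ).rd_dil (F.nb τ)).integrable.mul_bdd (c := 5 * max (∫ x, den (a τ) (b τ) x)
      (∫ x, gsq (a τ) (b τ) x)) ((F.na τ).continuous_pot (F.nb τ)).aestronglyMeasurable
      (Filter.Eventually.of_forall fun x => by
        rw [Real.norm_eq_abs, abs_of_nonneg (pot_nonneg _ _ _)]
        exact (F.na τ).pot_le_of_le (F.nb τ) (le_max_left _ _) (le_max_right _ _) x)
  have hdil : ∀ τ ∈ Icc 0 t, ∀ k, |∫ x, chi k x * (dil (a τ) (b τ) x * pot (a τ) (b τ) x)| ≤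
      3 * (J + 3 * Q) * (2 * Q) + 15 * Q * Q := fun τ hτ k => by
    have na := F.na τ
    have nb := F.nb τ
    have hq := hQ τ hτ.1
    have hw : Integrable fun x => 3 * (J + 3 * Q) * (den (a τ) (b τ) x + gsq (a τ) (b τ) x) +
        15 * Q * den (a τ) (b τ) x :=
      (((na.rd_den nb).add (na.rd_gsq nb)).integrable.const_mul _).add
        ((na.rd_den nb).integrable.const_mul _)
    have h1 : |∫ x, chi k x * (dil (a τ) (b τ) x * pot (a τ) (b τ) x)| ≤ _ :=
      norm_integral_le_of_norm_le (f := fun x => chi k x * (dil (a τ) (b τ) x *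
        pot (a τ) (b τ) x)) hw (Filter.Eventually.of_forall fun x => ?_)
    · refine h1.trans ?_
      rw [integral_add ((((na.rd_den nb).add (na.rd_gsq nb)).integrable.const_mul _))
        ((na.rd_den nb).integrable.const_mul _), integral_const_mul, integral_const_mul,
        integral_add (na.rd_den nb).integrable (na.rd_gsq nb).integrable]
      have := hq.1
      have := hq.2
      gcongr; linarith
    · have hp := pot_nonneg (a τ) (b τ) x
      have hd := den_nonneg (a τ) (b τ) x
      have hg := gsq_nonneg (a τ) (b τ) x
      have h2 : ‖x‖ * pot (a τ) (b τ) x ≤ J + 3 * Q := by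
        have := na.norm_mul_pot_le nb (hJ τ hτ) x
        linarith [hq.1, hq.2]
      have h3 : pot (a τ) (b τ) x ≤ 5 * Q := na.pot_le_of_le nb hq.1 hq.2 x
      have h4 : ∀ i, |x i * pd i (den (a τ) (b τ)) x| * pot (a τ) (b τ) x ≤
          (J + 3 * Q) * (den (a τ) (b τ) x + gsq (a τ) (b τ) x) := fun i => by
        have h5 : |pd i (den (a τ) (b τ)) x| ≤ den (a τ) (b τ) x + gsq (a τ) (b τ) x := by
          have h6 : pd i (a τ) x ^ 2 + pd i (b τ) x ^ 2 ≤ gsq (a τ) (b τ) x :=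
            Finset.single_le_sum (f := fun i => pd i (a τ) x ^ 2 + pd i (b τ) x ^ 2)
              (fun i _ => by positivity) (Finset.mem_univ i)
          rw [na.pd_den nb]
          unfold den
          rw [abs_le]
          constructor <;> nlinarith [sq_nonneg (a τ x - pd i (a τ) x),
            sq_nonneg (a τ x + pd i (a τ) x), sq_nonneg (b τ x - pd i (b τ) x),
            sq_nonneg (b τ x + pd i (b τ) x)]
        rw [abs_mul]
        calc _ = (|x i| * pot (a τ) (b τ) x) * |pd i (den (a τ) (b τ)) x| := by ring
          _ ≤ (‖x‖ * pot (a τ) (b τ) x) * (den (a τ) (b τ) x + gsq (a τ) (b τ) x) := by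
            gcongr; exact abs_coord_le x i
          _ ≤ _ := by gcongr
      rw [Real.norm_eq_abs, abs_mul, abs_of_nonneg (chi_nonneg k x), abs_mul, abs_of_nonneg hp]
      refine (mul_le_of_le_one_left (by positivity) (chi_le_one k x)).trans ?_
      have h7 : |dil (a τ) (b τ) x| ≤ (∑ i, |x i * pd i (den (a τ) (b τ)) x|) +
          3 * den (a τ) (b τ) x := by
        unfold dil
        refine (abs_add_le _ _).trans (add_le_add (Finset.abs_sum_le_sum_abs _ _) ?_)
        rw [abs_of_nonneg (by positivity)]
      calc _ ≤ ((∑ i, |x i * pd i (den (a τ) (b τ)) x|) + 3 * den (a τ) (b τ) x) *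
            pot (a τ) (b τ) x := by gcongr
        _ = (∑ i, |x i * pd i (den (a τ) (b τ)) x| * pot (a τ) (b τ) x) +
            3 * den (a τ) (b τ) x * pot (a τ) (b τ) x := by rw [add_mul, Finset.sum_mul]
        _ ≤ (∑ _i : Fin 3, (J + 3 * Q) * (den (a τ) (b τ) x + gsq (a τ) (b τ) x)) +
            3 * den (a τ) (b τ) x * (5 * Q) :=
          add_le_add (Finset.sum_le_sum fun i _ => h4 i)
            (mul_le_mul_of_nonneg_left h3 (by positivity))
        _ = _ := by
          rw [Finset.sum_const, Finset.card_univ, Fintype.card_fin, nsmul_eq_mul]; push_cast; ring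
  have herr : ∀ τ ∈ Icc 0 t, ∀ k : ℕ,
      |∫ x, ∑ i, pd i (chi k) x * flux (a τ) (b τ) (dt a τ) (dt b τ) i x| ≤
      (cc * (21 * Q + 3 * Y ^ 2)) * ((k : ℝ) + 1)⁻¹ := fun τ hτ k => by
    have na := F.na τ
    have nb := F.nb τ
    have hq := hQ τ hτ.1
    have i1 := (na.rd_gsq nb).integrable.const_mul 15
    have i2 := (na.rd_den nb).integrable.const_mul 6
    have i3 := (F.integrable_den_dt hτ.1).const_mul 3
    have h := abs_integral_pd_chi_mul_le_weighted ((i1.fun_add i2).fun_add i3)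
      (sum_abs_flux_le (a τ) (b τ) (dt a τ) (dt b τ)) k
    rw [integral_add (i1.fun_add i2) i3, integral_add i1 i2, integral_const_mul,
      integral_const_mul, integral_const_mul] at h
    have hc : 0 ≤ cc * ((k : ℝ) + 1)⁻¹ := mul_nonneg cc_pos.le (by positivity)
    have h2 := mul_le_mul_of_nonneg_left (by linarith [hq.1, hq.2, hD τ hτ] :
      15 * (∫ x, gsq (a τ) (b τ) x) + 6 * (∫ x, den (a τ) (b τ) x) +
        3 * (∫ x, den (dt a τ) (dt b τ) x) ≤ 21 * Q + 3 * Y ^ 2) hc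
    linarith
  refine sub_eq_integral_of_tendsto (C := Q + (3 * (J + 3 * Q) * (2 * Q) + 15 * Q * Q) +
    cc * (21 * Q + 3 * Y ^ 2)) ht (fun k τ hτ => F.hasDerivAt_integral_chi_vir hτ.1 k)
    (fun k τ hτ => ?_) (fun τ hτ => ?_)
    fun τ _ => tendsto_integral_chi_mul ((F.na τ).rd_vir (F.nb τ)).integrable
  · refine (abs_add_three _ _ _).trans (add_le_add (add_le_add ?_ (hdil τ hτ k)) ?_)
    · rw [abs_of_nonneg (integral_nonneg fun x => mul_nonneg (chi_nonneg k x) (gsq_nonneg _ _ x))]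
      exact (integral_chi_mul_le k ((F.na τ).rd_gsq (F.nb τ)).integrable
        (gsq_nonneg _ _)).trans (hQ τ hτ.1).2
    · refine (herr τ hτ k).trans (mul_le_of_le_one_right ?_ ?_)
      · have := cc_pos; positivity
      · exact inv_le_one_of_one_le₀ (by linarith [k.cast_nonneg (α := ℝ)])
  · have T1 := tendsto_integral_chi_mul ((F.na τ).rd_gsq (F.nb τ)).integrable
    have T2 := tendsto_integral_chi_mul (idil τ)
    have T3 : Filter.Tendsto (fun k => ∫ x, ∑ i, pd i (chi k) x *
        flux (a τ) (b τ) (dt a τ) (dt b τ) i x) Filter.atTop (𝓝 0) :=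
      squeeze_zero_norm (herr τ hτ) (by simpa using tendsto_inv_nat.const_mul _)
    rw [integral_dil_mul_pot (F.na τ) (F.nb τ)] at T2
    simpa using (T1.add T2).add T3

lemma virial_hasDerivAt : ContinuousOn (fun t => ∫ x, vir (a t) (b t) x) (Ici 0) ∧
    ∀ t, 0 < t → HasDerivAt (fun t => ∫ x, vir (a t) (b t) x)
      ((∫ x, gsq (a t) (b t) x) + 1 / 2 * ∫ x, den (a t) (b t) x * pot (a t) (b t) x) t := by
  refine hasDerivAt_of_sub_eq_integral (g := fun t => (∫ x, gsq (a t) (b t) x) +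
    1 / 2 * ∫ x, den (a t) (b t) x * pot (a t) (b t) x) ?_ fun t ht => F.virial_sub_eq ht
  refine ContinuousOn.congr (f := fun t => energy (a 0) (b 0) -
    1 / 2 * ∫ x, den (a t) (b t) x * pot (a t) (b t) x)
    (continuousOn_const.sub (F.continuousOn_potential.const_mul _)) fun t ht => ?_
  simp only
  rw [← F.energy_const ht, energy]; ring

lemma moment_sub_eq (ht : 0 ≤ t) :
    (∫ x, ‖x‖ ^ 2 * den (a t) (b t) x) - (∫ x, ‖x‖ ^ 2 * den (a 0) (b 0) x) =
      ∫ τ in (0 : ℝ)..t, 2 * ∫ x, vir (a τ) (b τ) x := by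
  obtain ⟨Q, hQ0, hQ⟩ := F.exists_uniform_bound
  obtain ⟨J, hJ0, hJ⟩ := F.exists_moment_bound t
  set φ : ℕ → E3 → ℝ := fun k x => chi k x * ‖x‖ ^ 2 with hφ
  have cφ : ∀ k, ContDiff ℝ 1 (φ k) := fun k => (contDiff_chi k).mul (contDiff_norm_sq ℝ)
  have sφ : ∀ k, HasCompactSupport (φ k) := fun k => (hasCompactSupport_chi k).mul_right
  have epd : ∀ k i x, pd i (φ k) x = 2 * (chi k x * x i) + pd i (chi k) x * ‖x‖ ^ 2 :=
    fun k i x => by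
      rw [hφ, pd_mul ((contDiff_chi k (n := 1)).differentiable one_ne_zero)
        ((contDiff_norm_sq ℝ (n := 1)).differentiable one_ne_zero), pd_norm_sq]
      simp only; ring
  have hpd : ∀ k i x, |pd i (φ k) x| ≤ (2 + cc) * ‖x‖ := fun k i x => by
    have h1 : ‖x‖ * |pd i (chi k) x| ≤ cc := by
      have e := pd_chi_le k i x
      have : ((k : ℝ) + 1)⁻¹ ≤ 1 := inv_le_one_of_one_le₀ (by linarith [k.cast_nonneg (α := ℝ)])
      have := mul_le_of_le_one_right cc_pos.le this
      nlinarith [abs_nonneg (pd i (chi k) x)]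
    have h2 : chi k x * |x i| ≤ 1 * ‖x‖ := by
      gcongr
      exacts [chi_le_one k x, abs_coord_le x i]
    rw [epd]
    refine (abs_add_le _ _).trans ?_
    simp only [abs_mul, abs_two, abs_of_nonneg (chi_nonneg k x), abs_pow, abs_norm]
    nlinarith [mul_le_mul_of_nonneg_left h1 (norm_nonneg x)]
  refine sub_eq_integral_of_tendsto (f := fun k t => ∫ x, φ k x * den (a t) (b t) x)
    (G := fun t => ∫ x, ‖x‖ ^ 2 * den (a t) (b t) x)
    (g := fun t => 2 * ∫ x, vir (a t) (b t) x)
    (C := 3 * (2 + cc) * (J + Q)) ht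
    (fun k τ hτ => F.hasDerivAt_integral_mul_den hτ.1 (cφ k) (sφ k))
    (fun k τ hτ => ?_) (fun τ hτ => ?_) fun τ _ => ?_
  · have na := F.na τ
    have nb := F.nb τ
    have i1 := (na.rd_norm_sq_mul_den nb).integrable
    have i2 := (na.rd_gsq nb).integrable
    have h : |∫ x, ∑ i, pd i (φ k) x * cur (a τ) (b τ) i x| ≤ _ :=
      norm_integral_le_of_norm_le (f := fun x => ∑ i, pd i (φ k) x * cur (a τ) (b τ) i x)
      ((i1.fun_add i2).const_mul (3 * (2 + cc))) (Filter.Eventually.of_forall fun x => by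
        refine (Finset.abs_sum_le_sum_abs _ _).trans ?_
        have hc := cc_pos
        have key : ∀ i, |pd i (φ k) x * cur (a τ) (b τ) i x| ≤
            (2 + cc) * (‖x‖ ^ 2 * den (a τ) (b τ) x + gsq (a τ) (b τ) x) := fun i => by
          have h1 := hpd k i x
          have h2 := abs_cur_le (a τ) (b τ) i x
          have h3 := Real.sq_sqrt (den_nonneg (a τ) (b τ) x)
          have h4 := Real.sq_sqrt (gsq_nonneg (a τ) (b τ) x)
          rw [abs_mul]
          calc _ ≤ ((2 + cc) * ‖x‖) * (√(den (a τ) (b τ) x) * √(gsq (a τ) (b τ) x)) := by gcongr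
            _ = (2 + cc) * ((‖x‖ * √(den (a τ) (b τ) x)) * √(gsq (a τ) (b τ) x)) := by ring
            _ ≤ _ := by
              gcongr
              have h5 := sq_nonneg (‖x‖ * √(den (a τ) (b τ) x) - √(gsq (a τ) (b τ) x))
              have h6 : (‖x‖ * √(den (a τ) (b τ) x)) ^ 2 = ‖x‖ ^ 2 * den (a τ) (b τ) x := by
                rw [mul_pow, h3]
              nlinarith [sq_nonneg (‖x‖ * √(den (a τ) (b τ) x)), gsq_nonneg (a τ) (b τ) x]
        refine (Finset.sum_le_sum fun i _ => key i).trans (le_of_eq ?_)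
        rw [Finset.sum_const, Finset.card_univ, Fintype.card_fin, nsmul_eq_mul]; push_cast; ring)
    refine h.trans ?_
    rw [integral_const_mul, integral_add i1 i2]
    have := cc_pos
    have := hJ τ hτ
    have := (hQ τ hτ.1).2
    gcongr
  · have na := F.na τ
    have nb := F.nb τ
    have hmom : ∀ i, RapidDecay fun x => ‖x‖ ^ 2 * cur (a τ) (b τ) i x := fun i =>
      (na.rd_cur nb i).mul_of_le (by fun_prop) 1 2 fun x => by
        rw [abs_of_nonneg (by positivity)]; linarith
    have T1 := (tendsto_integral_chi_mul (na.rd_vir nb).integrable).const_mul 2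
    have T2 : Filter.Tendsto (fun k => ∫ x, ∑ i, pd i (chi k) x *
        (‖x‖ ^ 2 * cur (a τ) (b τ) i x)) Filter.atTop (𝓝 0) :=
      squeeze_zero_norm (fun k => abs_integral_pd_chi_mul_le
        (RapidDecay.sum Finset.univ fun i => (hmom i).abs).integrable (fun x => le_rfl) k)
        (by simpa only [mul_zero, zero_mul] using (tendsto_inv_nat.const_mul cc).mul_const
              (∫ x, ∑ i, |‖x‖ ^ 2 * cur (a τ) (b τ) i x|))
    have T := T1.add T2
    rw [add_zero] at T
    refine T.congr fun k => ?_
    rw [← integral_const_mul, ← integral_add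
      ((integrable_chi_mul k (na.rd_vir nb).cont).const_mul 2)
      (integrable_finsetSum _ fun i _ => integrable_pd_mul (contDiff_chi k)
        (hasCompactSupport_chi k) i (hmom i).cont)]
    congr 1; ext x
    simp only [epd, vir, Fin.sum_univ_three]; ring
  · refine (tendsto_integral_chi_mul
      ((F.na τ).rd_norm_sq_mul_den (F.nb τ)).integrable).congr fun k => ?_
    simp only [hφ, mul_assoc]

lemma moment_hasDerivAt : ContinuousOn (fun t => ∫ x, ‖x‖ ^ 2 * den (a t) (b t) x) (Ici 0) ∧
    ∀ t, 0 < t → HasDerivAt (fun t => ∫ x, ‖x‖ ^ 2 * den (a t) (b t) x)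
      (2 * ∫ x, vir (a t) (b t) x) t :=
  hasDerivAt_of_sub_eq_integral (F.virial_hasDerivAt.1.const_mul 2) fun _ ht =>
    F.moment_sub_eq ht

end Flow

lemma gd_eq (α : ℝ) (a b : E3 → ℝ) (x : E3) :
    gd α a b x = gsq a b x + (-(2 * α) * vir a b x + α ^ 2 * (‖x‖ ^ 2 * den a b x)) := by
  have h := norm_sub_sq_eq x 0
  simp only [sub_zero, PiLp.zero_apply] at h
  rw [h]
  simp only [gd, gsq, vir, cur, den, Fin.sum_univ_three]; ring

lemma Nice.integral_gd {a b : E3 → ℝ} (ha : Nice a) (hb : Nice b) (α : ℝ) :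
    ∫ x, gd α a b x = (∫ x, gsq a b x) + (-(2 * α) * (∫ x, vir a b x) +
      α ^ 2 * ∫ x, ‖x‖ ^ 2 * den a b x) := by
  have h1 := (ha.rd_gsq hb).integrable
  have h2 := (ha.rd_vir hb).integrable.const_mul (-(2 * α))
  have h3 := (ha.rd_norm_sq_mul_den hb).integrable.const_mul (α ^ 2)
  simp only [gd_eq]
  rw [integral_add h1 (h2.fun_add h3), integral_add h2 h3, integral_const_mul, integral_const_mul]

/-- The scale factor of the expansion: the solution of `R̈ = R⁻²` started at rest from `1`. -/
structure Scale (R : ℝ → ℝ) : Prop where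
  smooth : ContDiff ℝ 2 R
  zero : R 0 = 1
  deriv_zero : deriv R 0 = 0
  pos : ∀ t, 0 ≤ t → 0 < R t
  ode : ∀ t, 0 ≤ t → deriv (deriv R) t = (R t ^ 2)⁻¹

namespace Scale

variable {R : ℝ → ℝ} (S : Scale R) {s t : ℝ}
include S

lemma hasDerivAt (t : ℝ) : HasDerivAt R (deriv R t) t :=
  (S.smooth.differentiable two_ne_zero t).hasDerivAt

lemma contDiff_deriv : ContDiff ℝ 1 (deriv R) :=
  ((contDiff_succ_iff_deriv (n := 1)).1 (by rw [one_add_one_eq_two]; exact S.smooth)).2.2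

lemma hasDerivAt_deriv (ht : 0 ≤ t) : HasDerivAt (deriv R) (R t ^ 2)⁻¹ t := by
  rw [← S.ode t ht]
  exact (S.contDiff_deriv.differentiable one_ne_zero t).hasDerivAt

lemma strictMonoOn_deriv : StrictMonoOn (deriv R) (Ici 0) := by
  refine strictMonoOn_of_deriv_pos (convex_Ici 0) S.contDiff_deriv.continuous.continuousOn
    fun t ht => ?_
  rw [interior_Ici, mem_Ioi] at ht
  rw [S.ode t ht.le]
  have := S.pos t ht.le
  positivity

lemma deriv_pos (ht : 0 < t) : 0 < deriv R t := by
  rw [← S.deriv_zero]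
  exact S.strictMonoOn_deriv self_mem_Ici ht.le ht

lemma deriv_nonneg (ht : 0 ≤ t) : 0 ≤ deriv R t := by
  rcases ht.eq_or_lt with rfl | h
  · rw [S.deriv_zero]
  · exact (S.deriv_pos h).le

lemma monotoneOn : MonotoneOn R (Ici 0) :=
  monotoneOn_of_deriv_nonneg (convex_Ici 0) S.smooth.continuous.continuousOn
    (S.smooth.differentiable two_ne_zero).differentiableOn
    fun _ ht => S.deriv_nonneg (interior_subset ht)

lemma one_le (ht : 0 ≤ t) : 1 ≤ R t := by
  rw [← S.zero]
  exact S.monotoneOn self_mem_Ici ht ht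

lemma deriv_sq (ht : 0 ≤ t) : deriv R t ^ 2 = 2 * (1 - (R t)⁻¹) := by
  have hd : ∀ τ ∈ Ici (0 : ℝ), HasDerivAt (fun t => deriv R t ^ 2 - 2 * (1 - (R t)⁻¹)) 0 τ := by
    intro τ hτ
    have hR := S.pos τ hτ
    have h := ((S.hasDerivAt_deriv hτ).fun_pow 2).fun_sub
      ((((S.hasDerivAt τ).inv hR.ne').const_sub 1).const_mul 2)
    refine h.congr_deriv ?_
    field_simp
    norm_num
  have h := (convex_Ici (0 : ℝ)).is_const_of_fderivWithin_eq_zero (𝕜 := ℝ)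
    (f := fun t => deriv R t ^ 2 - 2 * (1 - (R t)⁻¹))
    (fun τ hτ => (hd τ hτ).differentiableAt.differentiableWithinAt)
    (fun τ hτ => by
      rw [(hd τ hτ).hasFDerivAt.hasFDerivWithinAt.fderivWithin
        (uniqueDiffOn_Ici 0 τ hτ)]; ext; simp) self_mem_Ici ht
  simp only [S.deriv_zero, S.zero] at h
  linarith

lemma deriv_le (ht : 0 ≤ t) : deriv R t ≤ 2 := by
  have h := S.deriv_sq ht
  have := inv_pos.2 (S.pos t ht)
  nlinarith

lemma exists_linear_le : ∃ c, 0 < c ∧ ∀ t, 0 ≤ t → c * (1 + t) ≤ R t := by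
  have hv := S.deriv_pos one_pos
  have hv2 := S.deriv_le zero_le_one
  refine ⟨deriv R 1 / 4, by positivity, fun t ht => ?_⟩
  rcases le_total t 1 with h | h
  · nlinarith [S.one_le ht]
  · have h1 : deriv R 1 * (t - 1) ≤ R t - R 1 :=
      (convex_Ici (1 : ℝ)).mul_sub_le_image_sub_of_le_deriv S.smooth.continuous.continuousOn
        (S.smooth.differentiable two_ne_zero).differentiableOn
        (fun τ hτ => S.strictMonoOn_deriv.monotoneOn (mem_Ici.2 zero_le_one)
          (mem_Ici.2 (zero_le_one.trans (mem_Ici.1 (interior_subset hτ))))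
          (mem_Ici.1 (interior_subset hτ))) 1 self_mem_Ici t h h
    nlinarith [S.one_le zero_le_one]

end Scale

/-- The modified energy in the expanding frame. -/
def lyap (R : ℝ → ℝ) (a b : ℝ → E3 → ℝ) (t : ℝ) : ℝ :=
  R t * (∫ x, gd (deriv R t / R t) (a t) (b t) x) + R t * (∫ x, den (a t) (b t) x *
    pot (a t) (b t) x) + (R t ^ 2)⁻¹ * ∫ x, ‖x‖ ^ 2 * den (a t) (b t) x

namespace Flow

variable {a b : ℝ → E3 → ℝ} (F : Flow a b) {R : ℝ → ℝ} (S : Scale R) {t : ℝ}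
include F S

lemma lyap_eq (ht : 0 ≤ t) : lyap R a b t = R t * energy (a 0) (b 0) -
    2 * deriv R t * (∫ x, vir (a t) (b t) x) +
    (2 * (R t)⁻¹ - (R t)⁻¹ ^ 2) * ∫ x, ‖x‖ ^ 2 * den (a t) (b t) x := by
  have hR := S.pos t ht
  have h := S.deriv_sq ht
  rw [lyap, (F.na t).integral_gd (F.nb t), ← F.energy_const ht, energy, div_pow, h]
  field_simp
  ring

lemma antitoneOn_lyap : AntitoneOn (lyap R a b) (Ici 0) := by
  obtain ⟨cA, dA⟩ := F.virial_hasDerivAt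
  obtain ⟨cI, dI⟩ := F.moment_hasDerivAt
  have cR := S.smooth.continuous.continuousOn (s := Ici 0)
  have cR' := S.contDiff_deriv.continuous.continuousOn (s := Ici 0)
  have ci : ContinuousOn (fun t => (R t)⁻¹) (Ici 0) := cR.inv₀ fun t ht => (S.pos t ht).ne'
  refine AntitoneOn.congr ?_ fun t ht => (F.lyap_eq S ht).symm
  refine antitoneOn_of_hasDerivWithinAt_nonpos (f' := fun t =>
    -(deriv R t * ∫ x, gd (deriv R t / R t) (a t) (b t) x)) (convex_Ici 0)
    (((cR.mul_const _).sub ((cR'.const_mul 2).mul cA)).add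
      (((ci.const_mul 2).sub (ci.pow 2)).mul cI)) (fun t ht => ?_) fun t ht => ?_
  · rw [interior_Ici, mem_Ioi] at ht
    have hR := S.pos t ht.le
    have h := S.deriv_sq ht.le
    have dR := S.hasDerivAt t
    have di := dR.inv hR.ne'
    refine HasDerivAt.hasDerivWithinAt (((dR.mul_const _).fun_sub
      (((S.hasDerivAt_deriv ht.le).const_mul 2).fun_mul (dA t ht))).fun_add
      (((di.const_mul 2).fun_sub (di.fun_pow 2)).fun_mul (dI t ht)) |>.congr_deriv ?_)
    rw [(F.na t).integral_gd (F.nb t), ← F.energy_const ht.le, energy]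
    set A := ∫ x, vir (a t) (b t) x
    set I := ∫ x, ‖x‖ ^ 2 * den (a t) (b t) x
    simp only [Pi.inv_apply, Nat.cast_ofNat, Nat.add_one_sub_one, pow_one]
    linear_combination (deriv R t * (R t)⁻¹ ^ 2 * I - 2 * A * (R t)⁻¹) * h
  · have h : 0 ≤ ∫ x, gd (deriv R t / R t) (a t) (b t) x :=
      integral_nonneg fun x => gd_nonneg _ _ _ x
    have := S.deriv_nonneg (interior_subset ht)
    simp only [Left.neg_nonpos_iff]
    positivity

lemma integral_gd_le (ht : 0 ≤ t) :
    ∫ x, gd (deriv R t / R t) (a t) (b t) x ≤ lyap R a b 0 / R t := by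
  rw [le_div_iff₀' (S.pos t ht)]
  refine le_trans ?_ (F.antitoneOn_lyap S self_mem_Ici ht ht)
  have h1 := potential_nonneg (a t) (b t)
  have h2 : 0 ≤ ∫ x, ‖x‖ ^ 2 * den (a t) (b t) x :=
    integral_nonneg fun x => mul_nonneg (sq_nonneg _) (den_nonneg _ _ x)
  have := S.pos t ht
  have h3 := mul_nonneg this.le h1
  have h4 := mul_nonneg (inv_nonneg.2 (sq_nonneg (R t))) h2
  rw [lyap]
  linarith

end Flow

namespace Flow

variable {a b : ℝ → E3 → ℝ} (F : Flow a b) {R : ℝ → ℝ} (S : Scale R) {t : ℝ}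
include F S

lemma lyap_zero_nonneg : 0 ≤ lyap R a b 0 := by
  have h := F.integral_gd_le S le_rfl
  rw [S.zero, div_one, div_one] at h
  exact (integral_nonneg fun x => gd_nonneg (deriv R 0) (a 0) (b 0) x).trans h

lemma exists_speed_growth : ∃ C, 0 ≤ C ∧ ∀ t, 0 ≤ t →
    ∫ x, den (dt a t) (dt b t) x ≤ C * R t := by
  obtain ⟨Q, hQ0, hQ⟩ := F.exists_uniform_bound
  obtain ⟨c, hc, hcR⟩ := S.exists_linear_le
  have hL := F.lyap_zero_nonneg S
  set ℓ := lyap R a b 0 with hℓ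
  set A := √(speed Q (a 0) (b 0)) with hA
  have hA0 : 0 ≤ A := Real.sqrt_nonneg _
  set m := 4 * ℓ / c * √Q with hm
  have hm0 : 0 ≤ m := by positivity
  refine ⟨(A + 2 * m) ^ 2 / c, by positivity, fun t ht => ?_⟩
  have h1 : ∀ τ, 0 ≤ τ → ∀ r, τ ≤ r → ∀ y,
      ∫ x, (‖x - y‖ ^ 2)⁻¹ * den (a r) (b r) x ≤ √(4 * ℓ / (c * (1 + τ))) ^ 2 := by
    intro τ hτ r hr y
    have hr0 := hτ.trans hr
    rw [Real.sq_sqrt (by positivity)]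
    refine (((F.na r).hardy (F.nb r) (deriv R r / R r) y).2.trans
      (mul_le_mul_of_nonneg_left (F.integral_gd_le S hr0) (by norm_num))).trans ?_
    rw [← mul_div_assoc]
    gcongr
    exact (mul_le_mul_of_nonneg_left (by linarith) hc.le).trans (hcR r hr0)
  have h := F.integral_den_dt_le le_rfl ht (Real.sqrt_nonneg Q)
    (S := fun τ => √(4 * ℓ / (c * (1 + τ)))) (B := fun τ => 2 * m * √(1 + τ))
    (β := fun τ => m / √(1 + τ)) (fun r hr => (hQ r hr.1).1) (fun r hr => (hQ r hr.1).2)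
    (fun r hr => (Real.sq_sqrt hQ0).symm ▸ (hQ r hr.1).2)
    (fun τ hτ r hr y => h1 τ hτ.1 r hr.1 y)
    (fun τ hτ => by
      have h0 : (0 : ℝ) < 1 + τ := by linarith [hτ.1]
      refine ((((hasDerivAt_id τ).const_add 1).sqrt h0.ne').const_mul (2 * m)).congr_deriv ?_
      simp only [id]
      field_simp)
    (fun τ hτ => by
      have h0 : (1 : ℝ) ≤ 1 + τ := by linarith [hτ.1]
      have h2 : √(1 + τ) ≤ 1 + τ := by
        rw [Real.sqrt_le_left (by linarith)]; nlinarith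
      rw [Real.sq_sqrt (by positivity)]
      calc _ = m / (1 + τ) := by rw [hm]; field_simp
        _ ≤ _ := by gcongr)
  have h3 : (1 : ℝ) ≤ √(1 + t) := by
    rw [Real.one_le_sqrt]; linarith
  refine h.trans ?_
  calc _ ≤ ((A + 2 * m) * √(1 + t)) ^ 2 := by
        simp only [add_zero, Real.sqrt_one, mul_one]
        gcongr ?_ ^ 2
        · have := mul_le_mul_of_nonneg_left h3 (by positivity : 0 ≤ 2 * m); linarith
        · nlinarith
    _ = (A + 2 * m) ^ 2 / c * (c * (1 + t)) := by
        rw [mul_pow, Real.sq_sqrt (by linarith)]; field_simp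
    _ ≤ _ := by gcongr; exact hcR t ht

lemma exists_laplacian_growth : ∃ C, 0 ≤ C ∧ ∀ t, 0 ≤ t →
    ∫ x, den (lap (a t)) (lap (b t)) x ≤ C * R t := by
  obtain ⟨Q, hQ0, hQ⟩ := F.exists_uniform_bound
  obtain ⟨C, hC, hCR⟩ := F.exists_speed_growth S
  refine ⟨8 * C + 8 * (5 * Q) ^ 2 * Q, by positivity, fun t ht => ?_⟩
  have h1 := F.integrable_den_dt ht
  have h2 := ((F.na t).rd_den (F.nb t)).integrable
  calc _ ≤ ∫ x, (8 * den (dt a t) (dt b t) x + 8 * (5 * Q) ^ 2 * den (a t) (b t) x) := by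
        refine integral_mono_of_nonneg (Filter.Eventually.of_forall fun x => den_nonneg _ _ x)
          ((h1.const_mul _).fun_add (h2.const_mul _)) (Filter.Eventually.of_forall fun x => ?_)
        have hV0 := pot_nonneg (a t) (b t) x
        have hV := (F.na t).pot_le_of_le (F.nb t) (hQ t ht).1 (hQ t ht).2 x
        have hV2 : pot (a t) (b t) x ^ 2 ≤ (5 * Q) ^ 2 := by gcongr
        have ea : lap (a t) x = 2 * (dt b t x + pot (a t) (b t) x * a t x) := by
          rw [F.eqb t ht x]; ring
        have eb : lap (b t) x = 2 * (pot (a t) (b t) x * b t x - dt a t x) := by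
          rw [F.eqa t ht x]; ring
        have h3 := mul_le_mul_of_nonneg_right hV2 (den_nonneg (a t) (b t) x)
        simp only [den] at h3 ⊢
        rw [ea, eb]
        nlinarith [sq_nonneg (dt b t x - pot (a t) (b t) x * a t x),
          sq_nonneg (pot (a t) (b t) x * b t x + dt a t x)]
    _ = 8 * (∫ x, den (dt a t) (dt b t) x) + 8 * (5 * Q) ^ 2 * ∫ x, den (a t) (b t) x := by
        rw [integral_add (h1.const_mul _) (h2.const_mul _), integral_const_mul, integral_const_mul]
    _ ≤ 8 * (C * R t) + 8 * (5 * Q) ^ 2 * (Q * R t) := by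
        gcongr
        · exact hCR t ht
        · exact (hQ t ht).1.trans (le_mul_of_one_le_right hQ0 (S.one_le ht))
    _ = _ := by ring

end Flow

section Kernel

variable {ε : ℝ} (hε : 0 < ε) (y x : E3) (i : Fin 3)
include hε

lemma pd_pd_kap : pd i (pd i (kap ε y)) x =
    -kap ε y x ^ 3 + 3 * (x i - y i) ^ 2 * kap ε y x ^ 5 := by
  have kd := differentiable_kap hε y
  have cd : Differentiable ℝ fun x : E3 => x i - y i := by fun_prop
  have e : pd i (kap ε y) =
      fun x => -1 * ((x i - y i) * (kap ε y x * kap ε y x ^ 2)) := by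
    rw [pd_kap hε]; ext x; ring
  rw [e, pd_const_mul (cd.fun_mul (kd.fun_mul (kd.fun_pow 2))),
    pd_mul cd (kd.fun_mul (kd.fun_pow 2)), pd_mul kd (kd.fun_pow 2), pd_sq kd, pd_kap hε,
    pd_sub (by fun_prop) (by fun_prop), pd_coord, pd_const]
  simp only [if_true]
  ring

lemma lap_kap : lap (kap ε y) x = -(3 * ε * kap ε y x ^ 5) := by
  have h := kap_sq_mul hε x y
  have e : lap (kap ε y) x = ∑ i : Fin 3, (-kap ε y x ^ 3 +
      3 * (x i - y i) ^ 2 * kap ε y x ^ 5) := Finset.sum_congr rfl fun i _ => pd_pd_kap hε y x i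
  rw [e]
  simp only [Fin.sum_univ_three] at h ⊢
  linear_combination (3 * kap ε y x ^ 3) * h

lemma abs_pd_kap_le : |pd i (kap ε y) x| ≤ (√ε)⁻¹ ^ 2 := by
  have h0 := kap_pos hε x y
  have h1 := abs_coord_mul_kap_le hε x y i
  have h2 : kap ε y x ^ 2 ≤ (√ε)⁻¹ ^ 2 := pow_le_pow_left₀ h0.le (kap_le hε x y) 2
  rw [pd_kap hε]
  simp only [abs_mul, abs_neg, abs_pow, abs_of_pos h0]
  calc _ = (|x i - y i| * kap ε y x) * kap ε y x ^ 2 := by ring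
    _ ≤ 1 * (√ε)⁻¹ ^ 2 := by gcongr
    _ = _ := one_mul _

lemma abs_pd_pd_kap_le : |pd i (pd i (kap ε y)) x| ≤ 4 * (√ε)⁻¹ ^ 3 := by
  have h0 := kap_pos hε x y
  have h1 := abs_coord_mul_kap_le hε x y i
  have h2 : kap ε y x ^ 3 ≤ (√ε)⁻¹ ^ 3 := pow_le_pow_left₀ h0.le (kap_le hε x y) 3
  rw [pd_pd_kap hε]
  refine (abs_add_le _ _).trans ?_
  have e : |3 * (x i - y i) ^ 2 * kap ε y x ^ 5| =
      3 * ((|x i - y i| * kap ε y x) ^ 2 * kap ε y x ^ 3) := by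
    rw [abs_of_nonneg (by positivity), mul_pow, sq_abs]; ring
  rw [e, abs_neg, abs_of_pos (by positivity)]
  have h3 : (|x i - y i| * kap ε y x) ^ 2 * kap ε y x ^ 3 ≤ 1 ^ 2 * (√ε)⁻¹ ^ 3 := by gcongr
  linarith

lemma rapidDecay_kap_mul {f : E3 → ℝ} (hf : RapidDecay f) (m : ℕ) :
    RapidDecay fun x => kap ε y x ^ m * f x :=
  hf.mul_of_le ((differentiable_kap hε y).continuous.pow m) ((√ε)⁻¹ ^ m) 0 fun x => by
    have h0 := kap_pos hε x y
    rw [abs_of_pos (by positivity), pow_zero]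
    have : kap ε y x ^ m ≤ (√ε)⁻¹ ^ m := pow_le_pow_left₀ h0.le (kap_le hε x y) m
    linarith [(by positivity : 0 ≤ (√ε)⁻¹ ^ m)]

lemma integral_kap_mul_lap {f : E3 → ℝ} (hf : Nice f) :
    ∫ x, kap ε y x * lap f x = -(3 * ε * ∫ x, kap ε y x ^ 5 * f x) := by
  have ck : ContDiff ℝ 2 (kap ε y) := contDiff_kap hε y (n := 2)
  have hk0 := fun x => kap_pos hε x y
  have hA : ∀ x, |kap ε y x| ≤ (√ε)⁻¹ + (√ε)⁻¹ ^ 2 := fun x => by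
    rw [abs_of_pos (hk0 x)]
    exact (kap_le hε x y).trans (le_add_of_nonneg_right (by positivity))
  have hB : ∀ i x, |pd i (kap ε y) x| ≤ (√ε)⁻¹ + (√ε)⁻¹ ^ 2 := fun i x =>
    (abs_pd_kap_le hε y x i).trans (le_add_of_nonneg_left (by positivity))
  have hB' : ∀ i x, |pd i (kap ε y) x| ≤ (√ε)⁻¹ ^ 2 + 4 * (√ε)⁻¹ ^ 3 := fun i x =>
    (abs_pd_kap_le hε y x i).trans (le_add_of_nonneg_right (by positivity))
  have hC : ∀ i x, |pd i (pd i (kap ε y)) x| ≤ (√ε)⁻¹ ^ 2 + 4 * (√ε)⁻¹ ^ 3 := fun i x =>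
    (abs_pd_pd_kap_le hε y x i).trans (le_add_of_nonneg_left (by positivity))
  have i1 : ∀ i, Integrable fun x => kap ε y x * pd i (pd i f) x := fun i => by
    simpa using (rapidDecay_kap_mul hε y (hf.rd_pd₂ i) 1).integrable
  have i2 : ∀ i, Integrable fun x => pd i (pd i (kap ε y)) x * f x := fun i =>
    (hf.rd.mul_of_le (continuous_pd (contDiff_one_pd ck)) _ 0 fun x =>
      (hC i x).trans (le_mul_of_one_le_right ((abs_nonneg _).trans (hC i x)) (by simp))).integrable
  have e : ∀ i, ∫ x, kap ε y x * pd i (pd i f) x = ∫ x, pd i (pd i (kap ε y)) x * f x :=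
    fun i => by
      rw [integral_mul_pd (ck.of_le one_le_two) hA (hB i) (hf.diff_pd i) (hf.rd_pd i) (hf.rd_pd₂ i),
        integral_mul_pd (contDiff_one_pd ck) (hB' i) (hC i) hf.diff hf.rd (hf.rd_pd i), neg_neg]
  calc _ = ∑ i, ∫ x, kap ε y x * pd i (pd i f) x := by
        rw [← integral_finsetSum _ fun i _ => i1 i]
        simp only [lap, Finset.mul_sum]
    _ = ∫ x, lap (kap ε y) x * f x := by
        rw [Finset.sum_congr rfl fun i _ => e i, ← integral_finsetSum _ fun i _ => i2 i]
        simp only [lap, Finset.sum_mul]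
    _ = _ := by
        rw [← integral_const_mul, ← integral_neg]
        congr 1; ext x
        rw [lap_kap hε]; ring

end Kernel

lemma Nice.nice_den {a b : E3 → ℝ} (ha : Nice a) (hb : Nice b) : Nice (den a b) where
  smooth := smooth_den ha hb
  rd := ha.rd_den hb
  rd_pd := rd_pd_den ha hb
  rd_pd₂ i := by
    have h : ∀ {f}, Nice f → Differentiable ℝ fun x => 2 * f x := fun h => h.diff.const_mul 2
    have r : ∀ {f}, Nice f → RapidDecay fun x =>
        2 * pd i f x * pd i f x + 2 * f x * pd i (pd i f) x := fun h => by
      simpa only [mul_assoc] using (((h.rd_pd i).mul (h.rd_pd i)).const_mul 2).add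
        ((h.rd.mul (h.rd_pd₂ i)).const_mul 2)
    rw [pd_den ha hb, pd_add ((h ha).fun_mul (ha.diff_pd i)) ((h hb).fun_mul (hb.diff_pd i)),
      pd_mul (h ha) (ha.diff_pd i), pd_mul (h hb) (hb.diff_pd i), pd_const_mul ha.diff,
      pd_const_mul hb.diff]
    exact (r ha).add (r hb)

/-- The mass of `3 ε (|x|² + ε)^(-5/2)` captured by the ball of radius `√ε`. -/
def ballMass : ℝ := 3 * (√2)⁻¹ ^ 5 * volume.real (Metric.ball (0 : E3) 1)

lemma ballMass_pos : 0 < ballMass := by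
  have : 0 < volume.real (Metric.ball (0 : E3) 1) :=
    ENNReal.toReal_pos (Metric.measure_ball_pos _ _ one_pos).ne' measure_ball_lt_top.ne
  unfold ballMass
  positivity

lemma le_of_forall_integral_kap_le {f : E3 → ℝ} (hf : RapidDecay f) (h0 : ∀ x, 0 ≤ f x) (y : E3)
    {B : ℝ} (h : ∀ ε, 0 < ε → 3 * ε * ∫ x, kap ε y x ^ 5 * f x ≤ B) : ballMass * f y ≤ B := by
  have key : ∀ δ, 0 < δ → ballMass * (f y - δ) ≤ B := by
    intro δ hδ
    obtain ⟨ρ, hρ, hfρ⟩ := Metric.continuous_iff.1 hf.cont y δ hδ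
    have hε : 0 < ρ ^ 2 := by positivity
    refine le_trans ?_ (h _ hε)
    have hI := (rapidDecay_kap_mul hε y hf 5).integrable
    have hv : volume.real (Metric.ball y ρ) = ρ ^ 3 * volume.real (Metric.ball (0 : E3) 1) := by
      rw [measureReal_def, Measure.addHaar_ball_of_pos _ _ hρ, ENNReal.toReal_mul,
        ENNReal.toReal_ofReal (by positivity)]; simp [measureReal_def]
    have h1 : volume.real (Metric.ball y ρ) • ((√2 * ρ)⁻¹ ^ 5 * (f y - δ)) ≤
        ∫ x in Metric.ball y ρ, kap (ρ ^ 2) y x ^ 5 * f x := by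
      refine setIntegral_ge_of_const_le measurableSet_ball measure_ball_lt_top.ne (fun x hx => ?_)
        hI.integrableOn
      have hd := hfρ x hx
      rw [Metric.mem_ball, dist_eq_norm] at hx
      have hf1 : f y - δ ≤ f x := by
        rw [Real.dist_eq, abs_lt] at hd; linarith
      have hk : (√2 * ρ)⁻¹ ≤ kap (ρ ^ 2) y x := by
        unfold kap
        have : 0 < ‖x - y‖ ^ 2 + ρ ^ 2 := by positivity
        refine inv_anti₀ (Real.sqrt_pos.2 this) ?_
        rw [Real.sqrt_le_left (by positivity), mul_pow, Real.sq_sqrt zero_le_two]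
        nlinarith [norm_nonneg (x - y)]
      calc _ ≤ (√2 * ρ)⁻¹ ^ 5 * f x := by gcongr
        _ ≤ _ := by gcongr; exact h0 x
    have h2 := setIntegral_le_integral (s := Metric.ball y ρ) hI (Filter.Eventually.of_forall
      fun x => mul_nonneg (pow_nonneg (kap_pos hε x y).le 5) (h0 x))
    calc _ = 3 * ρ ^ 2 * (volume.real (Metric.ball y ρ) • ((√2 * ρ)⁻¹ ^ 5 * (f y - δ))) := by
          rw [hv, ballMass, smul_eq_mul]; field_simp
      _ ≤ _ := by gcongr; exact h1.trans h2
  refine le_of_forall_pos_le_add fun η hη => ?_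
  have := key (η / ballMass) (div_pos hη ballMass_pos)
  rw [mul_sub, mul_div_cancel₀ _ ballMass_pos.ne'] at this
  linarith

lemma Nice.den_le {a b : E3 → ℝ} (ha : Nice a) (hb : Nice b) (α : ℝ) (y : E3) :
    ballMass * den a b y ≤ 4 * (√(∫ x, gd α a b x) * √(∫ x, den (lap a) (lap b) x)) := by
  refine le_of_forall_integral_kap_le (ha.rd_den hb) (den_nonneg a b) y fun ε hε => ?_
  have ck := (differentiable_kap hε y).continuous
  have r2 := rapidDecay_kap_mul hε y (ha.rd_den hb) 2
  have rl : RapidDecay (den (lap a) (lap b)) := ha.rd_lap.sq.add hb.rd_lap.sq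
  have rab := (ha.rd.mul ha.rd_lap).add (hb.rd.mul hb.rd_lap)
  have i1 : Integrable fun x => kap ε y x * (a x * lap a x + b x * lap b x) := by
    simpa using (rapidDecay_kap_mul hε y rab 1).integrable
  have i2 : Integrable fun x => kap ε y x * gsq a b x := by
    simpa using (rapidDecay_kap_mul hε y (ha.rd_gsq hb) 1).integrable
  have h1 := integral_kap_mul_lap hε y (ha.nice_den hb)
  have h2 : ∫ x, kap ε y x * lap (den a b) x = 2 * (∫ x, kap ε y x * gsq a b x) +
      2 * ∫ x, kap ε y x * (a x * lap a x + b x * lap b x) := by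
    rw [← integral_const_mul, ← integral_const_mul,
      ← integral_add (i2.const_mul 2) (i1.const_mul 2)]
    congr 1; ext x
    rw [lap_den ha hb]; ring
  have h3 : 0 ≤ ∫ x, kap ε y x * gsq a b x :=
    integral_nonneg fun x => mul_nonneg (kap_pos hε x y).le (gsq_nonneg a b x)
  have h4 := (integral_le_sqrt_mul_sqrt r2.integrable rl.integrable i1.aestronglyMeasurable
    (fun x => mul_nonneg (sq_nonneg _) (den_nonneg a b x)) (den_nonneg (lap a) (lap b))
    fun x => by
      rw [← Real.sqrt_mul (mul_nonneg (sq_nonneg _) (den_nonneg a b x)),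
        ← Real.sqrt_sq_eq_abs]
      refine Real.sqrt_le_sqrt ?_
      rw [mul_pow, mul_assoc]
      refine mul_le_mul_of_nonneg_left ?_ (sq_nonneg _)
      unfold den
      nlinarith [sq_nonneg (a x * lap b x - b x * lap a x)]).2
  have h5 : √(∫ x, kap ε y x ^ 2 * den a b x) ≤ 2 * √(∫ x, gd α a b x) := by
    refine (Real.sqrt_le_sqrt (hardy_regularised ha hb α hε y)).trans (le_of_eq ?_)
    rw [Real.sqrt_mul (by norm_num), show (4 : ℝ) = 2 ^ 2 by norm_num,
      Real.sqrt_sq zero_le_two]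
  have h6 := mul_le_mul_of_nonneg_right h5 (Real.sqrt_nonneg (∫ x, den (lap a) (lap b) x))
  have h7 := (abs_le.1 h4).1
  linarith

lemma norm_fderiv_sq (f : E3 → ℝ) (x : E3) : ‖fderiv ℝ f x‖ ^ 2 = ∑ i, pd i f x ^ 2 := by
  rw [(EuclideanSpace.basisFun (Fin 3) ℝ).norm_dual]
  simp [pd, EuclideanSpace.basisFun_apply]

lemma exists_sobolev : ∃ C, 0 < C ∧ ∀ f : E3 → ℝ, ContDiff ℝ 1 f → HasCompactSupport f →
    ∫ x, f x ^ 6 ≤ C * (∫ x, ∑ i, pd i f x ^ 2) ^ 3 := by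
  set K := eLpNormLESNormFDerivOfEqInnerConst (volume : Measure E3) 2
  refine ⟨K ^ 6 + 1, by positivity, fun f hf hc => ?_⟩
  have h := eLpNorm_le_eLpNorm_fderiv_of_eq_inner (volume : Measure E3) hf hc (p := 2) (p' := 6)
    one_le_two (by simp) (by simp; norm_num)
  have cd : Continuous (fderiv ℝ f) := hf.continuous_fderiv one_ne_zero
  have m1 := hf.continuous.memLp_of_hasCompactSupport hc (p := 6) (μ := volume)
  have m2 := cd.memLp_of_hasCompactSupport (hc.fderiv (𝕜 := ℝ)) (p := 2) (μ := volume)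
  have e1 : ∀ x, ‖f x‖ ^ (6 : ℝ) = f x ^ 6 := fun x => by
    rw [show (6 : ℝ) = ((6 : ℕ) : ℝ) by norm_num, Real.rpow_natCast, Real.norm_eq_abs,
      Even.pow_abs (by decide)]
  have e2 : ∀ x, ‖fderiv ℝ f x‖ ^ (2 : ℝ) = ∑ i, pd i f x ^ 2 := fun x => by
    rw [Real.rpow_two, norm_fderiv_sq]
  have hA : 0 ≤ ∫ x, f x ^ 6 := integral_nonneg fun x => by positivity
  have hB : 0 ≤ ∫ x, ∑ i, pd i f x ^ 2 := integral_nonneg fun x => by positivity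
  simp only [ENNReal.coe_ofNat] at h
  rw [m1.eLpNorm_eq_integral_rpow_norm (by norm_num) (by norm_num),
    m2.eLpNorm_eq_integral_rpow_norm (by norm_num) (by norm_num)] at h
  simp only [ENNReal.toReal_ofNat, e1, e2] at h
  rw [← ENNReal.ofReal_coe_nnreal, ← ENNReal.ofReal_mul (by positivity),
    ENNReal.ofReal_le_ofReal_iff (by positivity)] at h
  have h6 := pow_le_pow_left₀ (by positivity) h 6
  rw [← Real.rpow_natCast (_ ^ _) 6, ← Real.rpow_mul hA, mul_pow,
    ← Real.rpow_natCast (_ ^ (2 : ℝ)⁻¹) 6, ← Real.rpow_mul hB] at h6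
  norm_num at h6
  refine h6.trans ?_
  gcongr
  linarith

lemma exists_sobolev_of_rapidDecay : ∃ C, 0 < C ∧ ∀ f : E3 → ℝ, ContDiff ℝ 1 f → RapidDecay f →
    (∀ i, RapidDecay (pd i f)) → ∫ x, f x ^ 6 ≤ C * (∫ x, ∑ i, pd i f x ^ 2) ^ 3 := by
  obtain ⟨C, hC, hS⟩ := exists_sobolev
  refine ⟨C * 2 ^ 3, by positivity, fun f hf hr hr' => ?_⟩
  have i0 : Integrable fun x => f x ^ 6 := by
    have := (hr.sq.mul (hr.sq.mul hr.sq)).integrable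
    exact this.congr (Filter.Eventually.of_forall fun x => by ring)
  have i1 : Integrable fun x => ∑ i, pd i f x ^ 2 :=
    integrable_finsetSum _ fun i _ => (hr' i).sq.integrable
  have i2 := hr.sq.integrable
  have T0 : Filter.Tendsto (fun k => ∫ x, (chi k x * f x) ^ 6) Filter.atTop (𝓝 (∫ x, f x ^ 6)) := by
    refine tendsto_integral_of_dominated_convergence (fun x => f x ^ 6)
      (fun k => (((continuous_chi k).mul hr.cont).pow 6).aestronglyMeasurable) i0
      (fun k => Filter.Eventually.of_forall fun x => ?_)
      (Filter.Eventually.of_forall fun x => ?_)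
    · rw [Real.norm_of_nonneg (by positivity), mul_pow]
      exact mul_le_of_le_one_left (by positivity)
        (pow_le_one₀ (chi_nonneg k x) (chi_le_one k x))
    · simpa using ((tendsto_chi x).mul_const (f x)).pow 6
  have T1 : Filter.Tendsto (fun k : ℕ => C * (2 * (∫ x, ∑ i, pd i f x ^ 2) +
      6 * (cc * ((k : ℝ) + 1)⁻¹) ^ 2 * ∫ x, f x ^ 2) ^ 3) Filter.atTop
      (𝓝 (C * (2 * (∫ x, ∑ i, pd i f x ^ 2) + 6 * (cc * 0) ^ 2 * ∫ x, f x ^ 2) ^ 3)) :=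
    (((((tendsto_inv_nat.const_mul cc).pow 2).const_mul 6).mul_const _).const_add _ |>.pow 3).const_mul C
  have hle := le_of_tendsto_of_tendsto' T0 T1 fun k => ?_
  · refine hle.trans (le_of_eq ?_)
    ring
  have hk : ContDiff ℝ 1 fun x => chi k x * f x := (contDiff_chi k).mul hf
  refine (hS _ hk ((hasCompactSupport_chi k).mul_right)).trans ?_
  have hB : 0 ≤ ∫ x, ∑ i, pd i (fun x => chi k x * f x) x ^ 2 :=
    integral_nonneg fun x => by positivity
  gcongr
  rw [← integral_const_mul, ← integral_const_mul, ← integral_add (i1.const_mul 2) (i2.const_mul _)]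
  refine integral_mono_of_nonneg (Filter.Eventually.of_forall fun x => by positivity)
    ((i1.const_mul 2).fun_add (i2.const_mul _)) (Filter.Eventually.of_forall fun x => ?_)
  have key : ∀ i, pd i (fun x => chi k x * f x) x ^ 2 ≤
      2 * pd i f x ^ 2 + 2 * (cc * ((k : ℝ) + 1)⁻¹) ^ 2 * f x ^ 2 := fun i => by
    rw [pd_mul ((contDiff_chi k (n := 1)).differentiable one_ne_zero)
      (hf.differentiable one_ne_zero)]
    have h1 : pd i (chi k) x ^ 2 ≤ (cc * ((k : ℝ) + 1)⁻¹) ^ 2 :=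
      sq_le_sq' (abs_le.1 (abs_pd_chi_le k i x)).1 (abs_le.1 (abs_pd_chi_le k i x)).2
    have h2 : chi k x ^ 2 ≤ 1 := pow_le_one₀ (chi_nonneg k x) (chi_le_one k x)
    nlinarith [mul_le_mul_of_nonneg_right h1 (sq_nonneg (f x)),
      mul_le_mul_of_nonneg_right h2 (sq_nonneg (pd i f x)),
      sq_nonneg (pd i (chi k) x * f x - chi k x * pd i f x)]
  refine (Finset.sum_le_sum fun i _ => key i).trans (le_of_eq ?_)
  simp only [Fin.sum_univ_three]; ring

lemma Nice.sum_pd_den_sq_le {a b : E3 → ℝ} (ha : Nice a) (hb : Nice b) (α : ℝ) (x : E3) :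
    ∑ i, pd i (den a b) x ^ 2 ≤ 4 * den a b x * gd α a b x := by
  rw [gd, Finset.mul_sum]
  refine Finset.sum_le_sum fun i _ => ?_
  rw [pd_den ha hb]
  simp only [den]
  nlinarith [sq_nonneg (a x * (pd i b x - α * x i * a x) - b x * (pd i a x + α * x i * b x))]

/-- The sixth power integral of the density is controlled by its supremum and the kinetic energy
in any quadratic gauge. -/
lemma exists_integral_den_pow_six_le : ∃ C, 0 < C ∧ ∀ (a b : E3 → ℝ), Nice a → Nice b →
    ∀ (α N : ℝ), (∀ x, den a b x ≤ N) →
    ∫ x, den a b x ^ 6 ≤ C * (N * ∫ x, gd α a b x) ^ 3 := by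
  obtain ⟨C, hC, hS⟩ := exists_sobolev_of_rapidDecay
  refine ⟨C * 4 ^ 3, by positivity, fun a b ha hb α N hN => ?_⟩
  have hn := ha.nice_den hb
  refine (hS _ (hn.smooth.of_le one_le_two) hn.rd hn.rd_pd).trans ?_
  have hB : 0 ≤ ∫ x, ∑ i, pd i (den a b) x ^ 2 := integral_nonneg fun x => by positivity
  have h : ∫ x, ∑ i, pd i (den a b) x ^ 2 ≤ 4 * N * ∫ x, gd α a b x := by
    rw [← integral_const_mul]
    refine integral_mono_of_nonneg (Filter.Eventually.of_forall fun x => by positivity)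
      ((ha.rd_gd hb α).integrable.const_mul _) (Filter.Eventually.of_forall fun x => ?_)
    refine (ha.sum_pd_den_sq_le hb α x).trans ?_
    exact mul_le_mul_of_nonneg_right (mul_le_mul_of_nonneg_left (hN x) (by norm_num))
      (gd_nonneg α a b x)
  calc _ ≤ C * (4 * N * ∫ x, gd α a b x) ^ 3 := by gcongr
    _ = _ := by ring

lemma rpow_le_add_interpolation {s X p : ℝ} (hs : 0 ≤ s) (hX : 0 < X) (hp : p ∈ Icc (2 : ℝ) 6) :
    s ^ p ≤ X ^ (p - 2) * s ^ 2 + X ^ (p - 6) * s ^ 6 := by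
  rcases le_total s X with h | h
  · have e : s ^ p = s ^ (p - 2) * s ^ 2 := by
      rw [← rpow_natCast, ← rpow_add_of_nonneg hs (by linarith [hp.1]) (by norm_num)]
      norm_num
    have := mul_le_mul_of_nonneg_right (rpow_le_rpow hs h (by linarith [hp.1] : 0 ≤ p - 2))
      (sq_nonneg s)
    have : 0 ≤ X ^ (p - 6) * s ^ 6 := by positivity
    linarith
  · have s0 := hX.trans_le h
    have e : s ^ p = s ^ (p - 6) * s ^ 6 := by
      rw [← rpow_natCast, ← rpow_add s0]
      norm_num
    have := mul_le_mul_of_nonneg_right (rpow_le_rpow_of_nonpos hX h (by linarith [hp.2] : p - 6 ≤ 0))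
      (by positivity : 0 ≤ s ^ 6)
    have : 0 ≤ X ^ (p - 2) * s ^ 2 := by positivity
    linarith

lemma eLpNorm_le_interpolation {f : E3 → ℝ} (hf : RapidDecay f) (h0 : ∀ x, 0 ≤ f x) {M X p : ℝ}
    (hM : 1 ≤ M) (hX : 0 < X) (hp : p ∈ Icc (2 : ℝ) 6) (h2 : ∫ x, f x ^ 2 ≤ M)
    (h6 : ∫ x, f x ^ 6 ≤ M * X ^ 4) :
    eLpNorm f (ENNReal.ofReal p) volume ≤ ENNReal.ofReal (2 * M * X ^ ((p - 2) / p)) := by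
  have p0 : 0 < p := by linarith [hp.1]
  have i2 : Integrable fun x => f x ^ 2 := hf.sq.integrable
  have i6 : Integrable fun x => f x ^ 6 := by
    refine ((hf.sq.mul hf.sq).mul hf.sq).integrable.congr (.of_forall fun x => ?_)
    ring
  have key : ∫⁻ x, ‖f x‖ₑ ^ p ≤ ENNReal.ofReal (2 * M * X ^ (p - 2)) := by
    calc ∫⁻ x, ‖f x‖ₑ ^ p
        ≤ ∫⁻ x, ENNReal.ofReal (X ^ (p - 2) * f x ^ 2 + X ^ (p - 6) * f x ^ 6) := by
          refine lintegral_mono fun x => ?_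
          rw [enorm_of_nonneg (h0 x), ENNReal.ofReal_rpow_of_nonneg (h0 x) p0.le]
          exact ENNReal.ofReal_le_ofReal (rpow_le_add_interpolation (h0 x) hX hp)
      _ = ENNReal.ofReal (∫ x, (X ^ (p - 2) * f x ^ 2 + X ^ (p - 6) * f x ^ 6)) := by
          refine (ofReal_integral_eq_lintegral_ofReal
            ((i2.const_mul _).fun_add (i6.const_mul _)) (.of_forall fun x => ?_)).symm
          have := h0 x
          simp only [Pi.zero_apply]
          positivity
      _ ≤ _ := by
          refine ENNReal.ofReal_le_ofReal ?_
          rw [integral_add (i2.const_mul _) (i6.const_mul _), integral_const_mul,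
            integral_const_mul]
          have e : X ^ (p - 2) = X ^ (p - 6) * X ^ 4 := by
            rw [← rpow_natCast, ← rpow_add hX]
            congr 1
            push_cast
            ring
          have a2 := mul_le_mul_of_nonneg_left h2 (rpow_nonneg hX.le (p - 2))
          have a6 := mul_le_mul_of_nonneg_left h6 (rpow_nonneg hX.le (p - 6))
          have : X ^ (p - 6) * (M * X ^ 4) = M * X ^ (p - 2) := by rw [e]; ring
          linarith
  rw [eLpNorm_eq_lintegral_rpow_enorm_toReal (by simpa using p0) ENNReal.ofReal_ne_top,
    ENNReal.toReal_ofReal p0.le]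
  refine (ENNReal.rpow_le_rpow key (by positivity)).trans ?_
  rw [ENNReal.ofReal_rpow_of_nonneg (by positivity) (by positivity)]
  refine ENNReal.ofReal_le_ofReal ?_
  rw [mul_rpow (by positivity) (by positivity), ← rpow_mul hX.le, mul_one_div]
  refine mul_le_mul_of_nonneg_right ?_ (by positivity)
  refine (rpow_le_rpow_of_exponent_le (y := 1 / p) (z := 1) (by linarith) ?_).trans_eq (rpow_one _)
  rw [div_le_one p0]
  linarith [hp.1]

namespace Flow

variable {a b : ℝ → E3 → ℝ} {R : ℝ → ℝ} (F : Flow a b) (S : Scale R)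
include F S

lemma exists_density_bound : ∃ N, 0 ≤ N ∧ ∀ t, 0 ≤ t → ∀ x, den (a t) (b t) x ≤ N := by
  obtain ⟨C, C0, hC⟩ := F.exists_laplacian_growth S
  have l0 := F.lyap_zero_nonneg S
  have m0 := ballMass_pos
  refine ⟨4 * (√(lyap R a b 0) * √C) / ballMass, by positivity, fun t ht x => ?_⟩
  have R0 : 0 < R t := S.pos t ht
  rw [le_div_iff₀' m0]
  refine ((F.na t).den_le (F.nb t) (deriv R t / R t) x).trans ?_
  refine mul_le_mul_of_nonneg_left ?_ (by norm_num)
  refine (mul_le_mul (sqrt_le_sqrt (F.integral_gd_le S ht)) (sqrt_le_sqrt (hC t ht))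
    (sqrt_nonneg _) (sqrt_nonneg _)).trans_eq ?_
  rw [← sqrt_mul (by positivity), ← sqrt_mul l0]
  congr 1
  field_simp

lemma exists_eLpNorm_den_le : ∃ C, 0 < C ∧ ∀ p ∈ Icc (2 : ℝ) 6, ∀ t, 0 ≤ t →
    eLpNorm (den (a t) (b t)) (ENNReal.ofReal p) volume ≤
      ENNReal.ofReal (C * R t ^ ((3 / 2) * (1 / p - 1 / 2))) := by
  obtain ⟨N, N0, hN⟩ := F.exists_density_bound S
  obtain ⟨K, K0, hK⟩ := exists_integral_den_pow_six_le
  obtain ⟨Q, Q0, hQ⟩ := F.exists_uniform_bound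
  have l0 := F.lyap_zero_nonneg S
  set ℓ := lyap R a b 0
  set M := 1 + N * Q + K * (N * ℓ) ^ 3 with hM
  have M1 : 1 ≤ M := by
    have : 0 ≤ N * Q + K * (N * ℓ) ^ 3 := by positivity
    linarith
  refine ⟨2 * M, by linarith, fun p hp t ht => ?_⟩
  have R0 : 0 < R t := S.pos t ht
  have hd := (F.na t).rd_den (F.nb t)
  have p0 : 0 < p := by linarith [hp.1]
  have X4 : (R t ^ (-(3 / 4) : ℝ)) ^ 4 = (R t ^ 3)⁻¹ := by
    rw [← rpow_natCast, ← rpow_mul R0.le, ← rpow_natCast, ← rpow_neg R0.le]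
    norm_num
  refine (eLpNorm_le_interpolation hd (den_nonneg _ _) M1 (rpow_pos_of_pos R0 (-(3 / 4))) hp
    ?_ ?_).trans_eq ?_
  · have h1 : ∫ x, den (a t) (b t) x ^ 2 ≤ ∫ x, N * den (a t) (b t) x := by
      refine integral_mono hd.sq.integrable (hd.const_mul N).integrable fun x => ?_
      simp only [sq]
      exact mul_le_mul_of_nonneg_right (hN t ht x) (den_nonneg _ _ x)
    rw [integral_const_mul] at h1
    have h2 := mul_le_mul_of_nonneg_left (hQ t ht).1 N0
    have : 0 ≤ K * (N * ℓ) ^ 3 := by positivity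
    linarith
  · have g0 : 0 ≤ ∫ x, gd (deriv R t / R t) (a t) (b t) x := integral_nonneg fun x => gd_nonneg _ _ _ x
    have h1 := hK _ _ (F.na t) (F.nb t) (deriv R t / R t) N (hN t ht)
    have h2 : K * (N * ∫ x, gd (deriv R t / R t) (a t) (b t) x) ^ 3 ≤ K * (N * (ℓ / R t)) ^ 3 := by
      have := F.integral_gd_le S ht
      gcongr
    have h3 : K * (N * (ℓ / R t)) ^ 3 = K * (N * ℓ) ^ 3 * (R t ^ 3)⁻¹ := by
      field_simp
    have h4 : 0 ≤ (1 + N * Q) * (R t ^ 3)⁻¹ := by positivity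
    rw [X4, hM]
    linarith
  · rw [← rpow_mul R0.le]
    congr 3
    field_simp
    ring

theorem exists_dispersion : ∃ C, 0 < C ∧ ∀ p ∈ Icc (2 : ℝ) 6, ∀ t, 0 < t →
    eLpNorm (den (a t) (b t)) (ENNReal.ofReal p) volume ≤
      ENNReal.ofReal (C * deriv R t ^ (3 * (2 / p - 1)) *
        R t ^ ((3 / 2) * (1 / p - 1 / 2))) := by
  obtain ⟨C, C0, hC⟩ := F.exists_eLpNorm_den_le S
  refine ⟨4 * C, by positivity, fun p hp t ht => (hC p hp t ht.le).trans ?_⟩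
  have R0 : 0 < R t := S.pos t ht.le
  have p0 : 0 < p := by linarith [hp.1]
  refine ENNReal.ofReal_le_ofReal (mul_le_mul_of_nonneg_right ?_ (rpow_nonneg R0.le _))
  have e0 : 3 * (2 / p - 1) ≤ 0 := by
    have := (div_le_one p0).2 hp.1
    linarith
  have e2 : -2 ≤ 3 * (2 / p - 1) := by
    have : 1 / 3 ≤ 2 / p := by
      rw [div_le_div_iff₀ (by norm_num) p0]
      linarith [hp.2]
    linarith
  have h1 : (2 : ℝ) ^ (-2 : ℝ) ≤ deriv R t ^ (3 * (2 / p - 1)) :=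
    (rpow_le_rpow_of_exponent_le one_le_two e2).trans
      (rpow_le_rpow_of_nonpos (S.deriv_pos ht) (S.deriv_le ht.le) e0)
  have h2 : (2 : ℝ) ^ (-2 : ℝ) = 1 / 4 := by
    rw [rpow_neg zero_le_two]
    norm_num
  rw [h2] at h1
  nlinarith

end Flow

lemma rapidDecay_schwartz (g : SchwartzMap E3 ℝ) : RapidDecay g where
  cont := g.continuous
  decay k := by
    obtain ⟨C, hC⟩ := g.decay k 0
    exact ⟨C, fun x => by simpa using hC.2 x⟩

lemma pd_schwartz (g : SchwartzMap E3 ℝ) (i : Fin 3) : pd i g =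
    (LineDeriv.lineDerivOp (EuclideanSpace.single i (1 : ℝ)) g : SchwartzMap E3 ℝ) := rfl

lemma nice_schwartz (g : SchwartzMap E3 ℝ) : Nice g where
  smooth := g.smooth 2
  rd := rapidDecay_schwartz g
  rd_pd i := by
    rw [pd_schwartz]
    exact rapidDecay_schwartz _
  rd_pd₂ i := by
    rw [pd_schwartz, pd_schwartz]
    exact rapidDecay_schwartz _

lemma pd_clm_comp (l : ℂ →L[ℝ] ℝ) {g : E3 → ℂ} (hg : Differentiable ℝ g) (i : Fin 3) :
    pd i (fun x => l (g x)) = fun x => l (fderiv ℝ g x (EuclideanSpace.single i 1)) := by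
  ext x
  exact congrArg (fun L : E3 →L[ℝ] ℝ => L (EuclideanSpace.single i 1))
    ((l.hasFDerivAt.comp x (hg x).hasFDerivAt).fderiv)

lemma lap_clm_comp (l : ℂ →L[ℝ] ℝ) {g : E3 → ℂ} (hg : ContDiff ℝ 2 g) (x : E3) :
    lap (fun x => l (g x)) x = l (∑ i : Fin 3, iteratedFDeriv ℝ 2 g x
      ![EuclideanSpace.single i 1, EuclideanSpace.single i 1]) := by
  rw [map_sum, lap]
  refine Finset.sum_congr rfl fun i _ => ?_
  have h1 : Differentiable ℝ (fderiv ℝ g) :=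
    (hg.fderiv_right (m := 1) (by norm_num)).differentiable one_ne_zero
  have h2 : ∀ x, HasFDerivAt (fun y => fderiv ℝ g y (EuclideanSpace.single i 1))
      ((fderiv ℝ (fderiv ℝ g) x).flip (EuclideanSpace.single i 1)) x := fun x =>
    ((ContinuousLinearMap.apply ℝ ℂ (EuclideanSpace.single i (1 : ℝ))).hasFDerivAt.comp x
      (h1 x).hasFDerivAt)
  rw [pd_clm_comp l (hg.differentiable two_ne_zero),
    pd_clm_comp l (fun x => (h2 x).differentiableAt), iteratedFDeriv_two_apply]
  simp [(h2 x).fderiv]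

lemma norm_sq_eq_den (g : E3 → ℂ) (x : E3) :
    ‖g x‖ ^ 2 = den (fun x => Complex.reCLM (g x)) (fun x => Complex.imCLM (g x)) x := by
  rw [← Complex.normSq_eq_norm_sq, Complex.normSq_apply]
  simp [den, sq]

lemma sum_norm_sq_eq_gd {g : E3 → ℂ} (hg : Differentiable ℝ g) (α : ℝ) (x : E3) :
    ∑ i : Fin 3, ‖fderiv ℝ g x (EuclideanSpace.single i 1) -
      Complex.I * ((α * x i : ℝ) : ℂ) * g x‖ ^ 2 =
    gd α (fun x => Complex.reCLM (g x)) (fun x => Complex.imCLM (g x)) x := by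
  rw [gd]
  refine Finset.sum_congr rfl fun i _ => ?_
  rw [pd_clm_comp _ hg, pd_clm_comp _ hg, ← Complex.normSq_eq_norm_sq, Complex.normSq_apply]
  simp
  ring

lemma flow_of_schrodinger {ψ : ℝ → E3 → ℂ}
    (hs : ContDiff ℝ 2 fun p : ℝ × E3 => ψ p.1 p.2)
    (hd : ∀ t, ∃ g : SchwartzMap E3 ℂ, ∀ x, ψ t x = g x)
    (he : ∀ t, 0 ≤ t → ∀ x, Complex.I * deriv (fun s => ψ s x) t =
      -(1 / 2) * (∑ i : Fin 3, iteratedFDeriv ℝ 2 (ψ t) x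
        ![EuclideanSpace.single i 1, EuclideanSpace.single i 1]) +
      (((1 / (4 * π)) * ∫ y, ‖x - y‖⁻¹ * ‖ψ t y‖ ^ 2 : ℝ) : ℂ) * ψ t x) :
    Flow (fun t x => Complex.reCLM (ψ t x)) (fun t x => Complex.imCLM (ψ t x)) := by
  have hdt (l : ℂ →L[ℝ] ℝ) (t : ℝ) (x : E3) :
      dt (fun t x => l (ψ t x)) t x = l (deriv (fun s => ψ s x) t) := by
    have h : DifferentiableAt ℝ (fun s => ψ s x) t :=
      ((hs.differentiable two_ne_zero).comp
        (differentiable_id.prodMk (differentiable_const x))) t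
    exact (l.hasFDerivAt.comp_hasDerivAt t h.hasDerivAt).deriv
  have hslice (t : ℝ) : ContDiff ℝ 2 (ψ t) := hs.comp (contDiff_prodMk_right t)
  have hn (l : ℂ →L[ℝ] ℝ) (t : ℝ) : Nice fun x => l (ψ t x) := by
    obtain ⟨g, hg⟩ := hd t
    have : (fun x => l (ψ t x)) = SchwartzMap.postcompCLM (𝕜 := ℝ) l g := by
      ext x
      simp [hg]
    rw [this]
    exact nice_schwartz _
  refine ⟨Complex.reCLM.contDiff.comp hs, Complex.imCLM.contDiff.comp hs, hn _, hn _,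
    fun t ht x => ?_, fun t ht x => ?_⟩
  · rw [hdt, lap_clm_comp _ (hslice t), pot]
    have h := congrArg Complex.im (he t ht x)
    simp only [norm_sq_eq_den] at h
    simpa using h
  · rw [hdt, lap_clm_comp _ (hslice t), pot]
    have h := congrArg Complex.re (he t ht x)
    simp only [norm_sq_eq_den] at h
    simp at h ⊢
    linarith

end SchrodingerPoisson

/-- Lyapunov functional and dispersion for the 3-dimensional
Schrödinger–Poisson system (`ℏ = 1`): with `R̈ = R⁻²`, `R(0)=1`, `Ṙ(0)=0`,
`L(t) = R ∫ |∇ψ - i(Ṙ/R)xψ|² + R ∫ V|ψ|² + R^{-2} ∫ |x|²|ψ|²` is nonincreasing,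
and `‖n(t,·)‖_{L^p} ≤ C Ṙ^{3(2/p-1)} R^{(3/2)(1/p-1/2)}` for `p ∈ [2,6]`, `t > 0`. -/
theorem stmt10
    (ψ : ℝ → EuclideanSpace ℝ (Fin 3) → ℂ)
    (V n : ℝ → EuclideanSpace ℝ (Fin 3) → ℝ)
    (R L : ℝ → ℝ)
    -- self-consistent Coulomb potential and position density
    (hV : ∀ t x, V t x = (1 / (4 * π)) * ∫ y, ‖x - y‖⁻¹ * ‖ψ t y‖ ^ 2)
    (hn : ∀ t x, n t x = ‖ψ t x‖ ^ 2)
    -- the rescaling function: `R̈ = R⁻²`, `R(0)=1`, `Ṙ(0)=0`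
    (hR : ContDiff ℝ 2 R) (hR0 : R 0 = 1) (hR'0 : deriv R 0 = 0)
    (hRpos : ∀ t : ℝ, 0 ≤ t → 0 < R t)
    (hRode : ∀ t : ℝ, 0 ≤ t → deriv (deriv R) t = (R t ^ 2)⁻¹)
    -- `ψ` is smooth and Schwartz in `x`
    (hψ_smooth : ∀ k : ℕ,
      ContDiff ℝ k (fun p : ℝ × EuclideanSpace ℝ (Fin 3) => ψ p.1 p.2))
    (hψ_schwartz : ∀ t : ℝ, ∃ g : SchwartzMap (EuclideanSpace ℝ (Fin 3)) ℂ,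
      ∀ x, ψ t x = g x)
    -- the Schrödinger–Poisson equation `i∂_tψ = -(1/2)Δψ + Vψ`
    (hSchrodinger : ∀ t : ℝ, 0 ≤ t → ∀ x,
      Complex.I * deriv (fun s => ψ s x) t =
        -(1 / 2) * (∑ i : Fin 3, iteratedFDeriv ℝ 2 (fun y => ψ t y) x
          ![EuclideanSpace.single i 1, EuclideanSpace.single i 1])
        + (V t x : ℂ) * ψ t x)
    -- the Lyapunov functional
    (hL : ∀ t, L t =
      R t * (∫ x, ∑ i : Fin 3,
        ‖fderiv ℝ (fun y => ψ t y) x (EuclideanSpace.single i 1)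
          - Complex.I * (((deriv R t / R t) * x i : ℝ) : ℂ) * ψ t x‖ ^ 2)
      + R t * (∫ x, V t x * ‖ψ t x‖ ^ 2)
      + (R t ^ 2)⁻¹ * ∫ x, ‖x‖ ^ 2 * ‖ψ t x‖ ^ 2) :
    AntitoneOn L (Ici 0) ∧
    ∃ C : ℝ, 0 < C ∧ ∀ p : ℝ, p ∈ Icc (2 : ℝ) 6 → ∀ t : ℝ, 0 < t →
      eLpNorm (fun x => n t x) (ENNReal.ofReal p) volume ≤
        ENNReal.ofReal (C * deriv R t ^ (3 * (2 / p - 1)) *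
          R t ^ ((3 / 2) * (1 / p - 1 / 2))) := by
  open SchrodingerPoisson in
  have hs : ContDiff ℝ 2 fun p : ℝ × E3 => ψ p.1 p.2 := hψ_smooth 2
  have F := flow_of_schrodinger hs hψ_schwartz fun t ht x => by
    rw [← hV]
    exact hSchrodinger t ht x
  have S : Scale R := ⟨hR, hR0, hR'0, hRpos, hRode⟩
  have e : L = lyap R (fun t x => Complex.reCLM (ψ t x)) (fun t x => Complex.imCLM (ψ t x)) := by
    ext t
    have hd : Differentiable ℝ (ψ t) :=
      (hs.comp (contDiff_prodMk_right t)).differentiable two_ne_zero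
    simp only [hL, lyap, hV, norm_sq_eq_den, sum_norm_sq_eq_gd hd, pot, mul_comm (den _ _ _)]
  rw [e]
  refine ⟨F.antitoneOn_lyap S, ?_⟩
  simp only [hn, norm_sq_eq_den]
  exact F.exists_dispersion S
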